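/- There exists an absolute constant C > 0 such that for all positive integers a ≤ b there exist integers A ≥ a and B ≥ b with A·B + 1 prime and A·B ≤ C·a·b. -/

import Mathlib

namespace PPF

open MeasureTheory

/-- A smooth bump together with its Fourier transform. -/
structure IsBump (φ : ℝ → ℝ) (g : ℝ → ℂ) : Prop where
  nonneg : ∀ u, 0 ≤ φ u
  le_one : ∀ u, φ u ≤ 1
  eq_one : ∀ u, |u| ≤ 2 → φ u = 1
  eq_zero : ∀ u, 4 ≤ |u| → φ u = 0
  lip : ∃ C : ℝ, 0 ≤ C ∧ ∀ u v, |φ u - φ v| ≤ C * |u - v|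
  cont : Continuous g
  integ : ∀ K : ℕ, Integrable (fun ξ : ℝ => (1 + |ξ|) ^ K * ‖g ξ‖)
  inv : ∀ u : ℝ, (φ u : ℂ) = ∫ ξ : ℝ, g ξ * Complex.exp (2 * Real.pi * Complex.I * ξ * u)

theorem exists_bump : ∃ φ g, IsBump φ g := by
  let b : ContDiffBump (0 : ℝ) := ⟨2, 4, by norm_num, by norm_num⟩
  have hb : ContDiff ℝ (⊤ : ℕ∞) (fun u : ℝ => (b u : ℂ)) :=
    Complex.ofRealCLM.contDiff.comp b.contDiff
  have hbr : ContDiff ℝ (⊤ : ℕ∞) (fun u : ℝ => b u) := b.contDiff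
  have hc : HasCompactSupport (fun u : ℝ => (b u : ℂ)) :=
    b.hasCompactSupport.comp_left (g := fun r : ℝ => (r : ℂ)) (by simp)
  let f : SchwartzMap ℝ ℂ := hc.toSchwartzMap hb
  have hf : ∀ u, f u = (b u : ℂ) := fun u => rfl
  let g : SchwartzMap ℝ ℂ := FourierTransform.fourier f
  refine ⟨fun u => b u, fun ξ => g ξ, ?_, ?_, ?_, ?_, ?_, ?_, ?_, ?_⟩
  · intro u; exact b.nonneg
  · intro u; exact b.le_one
  · intro u hu
    apply b.one_of_mem_closedBall
    simpa [b, Real.norm_eq_abs] using hu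
  · intro u hu
    apply b.zero_of_le_dist
    simpa [b, Real.norm_eq_abs] using hu
  · obtain ⟨C, hC⟩ := (hbr.of_le (by simp : (1 : WithTop ℕ∞) ≤ ((⊤ : ℕ∞) : WithTop ℕ∞))).lipschitzWith_of_hasCompactSupport
      b.hasCompactSupport (by simp)
    refine ⟨C, C.2, fun u v => ?_⟩
    simpa [Real.dist_eq] using hC.dist_le_mul u v
  · exact g.continuous
  · intro K
    have h1 : ∀ k : ℕ, Integrable (fun ξ : ℝ => ‖ξ‖ ^ k * ‖g ξ‖) := fun k =>
      g.integrable_pow_mul volume k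
    have h2 : (fun ξ : ℝ => (1 + |ξ|) ^ K * ‖g ξ‖) =
        fun ξ : ℝ => ∑ i ∈ Finset.range (K + 1), (K.choose i : ℝ) * (‖ξ‖ ^ (K - i) * ‖g ξ‖) := by
      funext ξ
      rw [add_pow, Finset.sum_mul]
      apply Finset.sum_congr rfl
      intro i _
      simp only [one_pow, one_mul, Real.norm_eq_abs]
      ring
    rw [h2]
    apply integrable_finsetSum
    intro i _
    exact (h1 _).const_mul _
  · intro u
    have h1 : (FourierTransformInv.fourierInv g : SchwartzMap ℝ ℂ) u = f u := by
      have : (FourierTransformInv.fourierInv g : SchwartzMap ℝ ℂ) = f :=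
        FourierPair.fourierInv_fourier_eq f
      rw [this]
    rw [← hf u, ← h1, SchwartzMap.fourierInv_coe, Real.fourierInv_eq']
    apply integral_congr_ae
    filter_upwards with ξ
    rw [smul_eq_mul, mul_comm]
    congr 2
    simp
    ring

end PPF

namespace PPF

/-! ## A sieve via orthogonality -/

theorem sum_crt {T1 T2 : ℕ} (h1 : 0 < T1) (h2 : 0 < T2) (hc : Nat.Coprime T1 T2) (f h : ℕ → ℝ)
    (hf : ∀ m, f (m % T1) = f m) (hh : ∀ m, h (m % T2) = h m) :
    ∑ m ∈ Finset.range (T1 * T2), f m * h m =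
      (∑ m ∈ Finset.range T1, f m) * ∑ m ∈ Finset.range T2, h m := by
  rw [Finset.sum_mul_sum, ← Finset.sum_product']
  have hmaps : ∀ m ∈ Finset.range (T1 * T2),
      (m % T1, m % T2) ∈ Finset.range T1 ×ˢ Finset.range T2 := by
    intro m _
    simp [Nat.mod_lt _ h1, Nat.mod_lt _ h2]
  have hinj : Set.InjOn (fun m : ℕ => (m % T1, m % T2)) (Finset.range (T1 * T2) : Set ℕ) := by
    intro a ha b hb hab
    simp only [Prod.mk.injEq] at hab
    have := (Nat.modEq_and_modEq_iff_modEq_mul hc).1 ⟨hab.1, hab.2⟩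
    simp only [Finset.coe_range, Set.mem_Iio] at ha hb
    exact Nat.ModEq.eq_of_lt_of_lt this ha hb
  have hsurj : Set.SurjOn (fun m : ℕ => (m % T1, m % T2)) (Finset.range (T1 * T2) : Set ℕ)
      (Finset.range T1 ×ˢ Finset.range T2 : Finset (ℕ × ℕ)) :=
    Finset.surjOn_of_injOn_of_card_le _ hmaps hinj (by simp)
  refine Finset.sum_nbij (fun m => (m % T1, m % T2)) hmaps hinj hsurj ?_
  intro m _
  simp [hf, hh]

theorem prod_periodic (s : Finset ℕ) (v : ℕ → ℕ → ℝ)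
    (hv : ∀ p ∈ s, ∀ m, v p (m % p) = v p m) (m : ℕ) :
    ∏ p ∈ s, v p (m % ∏ p ∈ s, p) = ∏ p ∈ s, v p m := by
  refine Finset.prod_congr rfl fun p hp => ?_
  rw [← hv p hp (m % _), Nat.mod_mod_of_dvd _ (Finset.dvd_prod_of_mem _ hp), hv p hp]

theorem sum_prod_crt (s : Finset ℕ) (hs : ∀ p ∈ s, p.Prime) (v : ℕ → ℕ → ℝ)
    (hv : ∀ p ∈ s, ∀ m, v p (m % p) = v p m) :
    ∑ m ∈ Finset.range (∏ p ∈ s, p), ∏ p ∈ s, v p m = ∏ p ∈ s, ∑ m ∈ Finset.range p, v p m := by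
  induction s using Finset.induction_on with
  | empty => simp
  | insert a s ha ih =>
    have hs' : ∀ p ∈ s, p.Prime := fun p hp => hs p (Finset.mem_insert_of_mem hp)
    have hv' : ∀ p ∈ s, ∀ m, v p (m % p) = v p m := fun p hp => hv p (Finset.mem_insert_of_mem hp)
    have hpa := hs a (Finset.mem_insert_self _ _)
    simp only [Finset.prod_insert ha]
    rw [← ih hs' hv']
    refine sum_crt hpa.pos (Finset.prod_pos fun p hp => (hs' p hp).pos) ?_ _
      (fun m => ∏ p ∈ s, v p m) (hv a (Finset.mem_insert_self _ _)) ?_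
    · refine Nat.Coprime.prod_right fun p hp => ?_
      rw [Nat.coprime_primes hpa (hs' p hp)]
      rintro rfl
      exact ha hp
    · intro m
      exact prod_periodic s v hv' m

theorem periodic_sum (T : ℕ) (hT : 0 < T) (h : ℕ → ℝ) (hp : ∀ m, h (m % T) = h m)
    (hb : ∀ m, |h m| ≤ 1) (M : ℕ) :
    |∑ m ∈ Finset.range M, h m - M * ((∑ m ∈ Finset.range T, h m) / T)| ≤ 2 * T := by
  set S := ∑ m ∈ Finset.range T, h m
  have hper : ∀ k j, h (T * k + j) = h j := by
    intro k j
    rw [← hp, Nat.mul_add_mod, hp]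
  have hblock : ∀ k, ∑ m ∈ Finset.range (T * k), h m = k * S := by
    intro k
    induction k with
    | zero => simp
    | succ k ih =>
      rw [mul_add, mul_one, Finset.sum_range_add, ih]
      simp only [hper]
      push_cast
      ring
  have key : ∀ n, |∑ m ∈ Finset.range n, h m| ≤ n := by
    intro n
    refine (Finset.abs_sum_le_sum_abs _ _).trans ?_
    refine (Finset.sum_le_sum fun m _ => hb m).trans ?_
    simp
  have hM := Nat.div_add_mod M T
  set k := M / T
  set r := M % T
  have hr : r < T := Nat.mod_lt _ hT
  have hTr : (0 : ℝ) < T := by exact_mod_cast hT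
  have e : ∑ m ∈ Finset.range M, h m = k * S + ∑ m ∈ Finset.range r, h m := by
    rw [← hM, Finset.sum_range_add, hblock]
    simp only [hper]
  have e2 : (M : ℝ) = T * k + r := by exact_mod_cast hM.symm
  have hSr : |(r : ℝ) * (S / T)| ≤ T := by
    rw [abs_mul, abs_div, abs_of_pos hTr]
    have := key T
    have h1 : |S| / T ≤ 1 := by rw [div_le_one hTr]; exact this
    have h2 : |(r : ℝ)| ≤ T := by rw [abs_of_nonneg (by positivity)]; exact_mod_cast hr.le
    nlinarith [abs_nonneg (r : ℝ), abs_nonneg S, div_nonneg (abs_nonneg S) hTr.le]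
  have h3 := key r
  have h4 : (r : ℝ) ≤ T := by exact_mod_cast hr.le
  have e3 : ∑ m ∈ Finset.range M, h m - M * (S / T) =
      ∑ m ∈ Finset.range r, h m - r * (S / T) := by
    rw [e, e2]; field_simp; ring
  rw [e3]
  refine (abs_sub _ _).trans ?_
  linarith

theorem sieve_abstract (N : Finset ℕ) (R : ℕ) (u : ℕ → ℕ → ℝ) (g : ℕ → ℝ)
    (hN : ∀ n ∈ N, Squarefree n ∧ 1 ≤ n ∧ n ≤ R)
    (hper : ∀ n ∈ N, ∀ p ∈ n.primeFactors, ∀ m, u p (m % p) = u p m)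
    (hb : ∀ n ∈ N, ∀ p ∈ n.primeFactors, ∀ m, |u p m| ≤ 1)
    (h0 : ∀ n ∈ N, ∀ p ∈ n.primeFactors, ∑ m ∈ Finset.range p, u p m = 0)
    (h2 : ∀ n ∈ N, ∀ p ∈ n.primeFactors, ∑ m ∈ Finset.range p, u p m ^ 2 = p * g p)
    (M : ℕ) (S : Finset ℕ) (hS : S ⊆ Finset.range M)
    (hSu : ∀ m ∈ S, ∀ n ∈ N, ∀ p ∈ n.primeFactors, u p m = g p) :
    (S.card : ℝ) * (∑ n ∈ N, ∏ p ∈ n.primeFactors, g p) ^ 2 ≤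
      M * (∑ n ∈ N, ∏ p ∈ n.primeFactors, g p) + 2 * (R : ℝ) ^ 4 := by
  set L := ∑ n ∈ N, ∏ p ∈ n.primeFactors, g p with hL
  set U : ℕ → ℕ → ℝ := fun n m => ∏ p ∈ n.primeFactors, u p m with hU
  have step1 : (S.card : ℝ) * L ^ 2 ≤ ∑ m ∈ Finset.range M, (∑ n ∈ N, U n m) ^ 2 := by
    have : ∑ m ∈ S, (∑ n ∈ N, U n m) ^ 2 = (S.card : ℝ) * L ^ 2 := by
      rw [← nsmul_eq_mul, ← Finset.sum_const]
      refine Finset.sum_congr rfl fun m hm => ?_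
      congr 1
      refine Finset.sum_congr rfl fun n hn => Finset.prod_congr rfl fun p hp => hSu m hm n hn p hp
    rw [← this]
    exact Finset.sum_le_sum_of_subset_of_nonneg hS fun _ _ _ => sq_nonneg _
  have step2 : ∑ m ∈ Finset.range M, (∑ n ∈ N, U n m) ^ 2 =
      ∑ n ∈ N, ∑ n' ∈ N, ∑ m ∈ Finset.range M, U n m * U n' m := by
    simp only [sq, Finset.sum_mul_sum]
    rw [Finset.sum_comm]
    refine Finset.sum_congr rfl fun n _ => ?_
    rw [Finset.sum_comm]
  have step3 : ∀ n ∈ N, ∀ n' ∈ N, ∑ m ∈ Finset.range M, U n m * U n' m ≤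
      M * (if n = n' then ∏ p ∈ n.primeFactors, g p else 0) + 2 * (R : ℝ) ^ 2 := by
    intro n hn n' hn'
    set s := n.primeFactors ∪ n'.primeFactors with hs
    set v : ℕ → ℕ → ℝ := fun p m => (if p ∈ n.primeFactors then u p m else 1) *
      (if p ∈ n'.primeFactors then u p m else 1) with hv
    have hprod : ∀ m, U n m * U n' m = ∏ p ∈ s, v p m := by
      intro m
      simp only [hv, Finset.prod_mul_distrib, hU]
      rw [Finset.prod_ite_mem, Finset.prod_ite_mem, hs,
        Finset.inter_eq_right.2 Finset.subset_union_left,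
        Finset.inter_eq_right.2 Finset.subset_union_right]
    have hsp : ∀ p ∈ s, p.Prime := by
      intro p hp
      rcases Finset.mem_union.1 hp with h | h <;> exact Nat.prime_of_mem_primeFactors h
    have hvper : ∀ p ∈ s, ∀ m, v p (m % p) = v p m := by
      intro p hp m
      simp only [hv]
      split_ifs with ha hb
      · rw [hper n hn p ha]
      · rw [hper n hn p ha]
      · rw [hper n' hn' p (by assumption)]
      · rfl
    have hvb : ∀ p ∈ s, ∀ m, |v p m| ≤ 1 := by
      intro p hp m
      simp only [hv, abs_mul]
      refine mul_le_one₀ ?_ (abs_nonneg _) ?_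
      · split_ifs with h
        · exact hb n hn p h m
        · simp
      · split_ifs with h
        · exact hb n' hn' p h m
        · simp
    have hTpos : 0 < ∏ p ∈ s, p := Finset.prod_pos fun p hp => (hsp p hp).pos
    have hTle : ∏ p ∈ s, p ≤ R ^ 2 := by
      have h1 : ∏ p ∈ s, p ∣ n * n' := by
        refine Finset.prod_primes_dvd _ (fun p hp => (hsp p hp).prime) ?_
        intro p hp
        rcases Finset.mem_union.1 hp with h | h
        · exact (Nat.dvd_of_mem_primeFactors h).mul_right _
        · exact (Nat.dvd_of_mem_primeFactors h).mul_left _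
      have h3 := hN n hn
      have h4 := hN n' hn'
      refine (Nat.le_of_dvd (Nat.mul_pos h3.2.1 h4.2.1) h1).trans ?_
      rw [sq]
      exact Nat.mul_le_mul h3.2.2 h4.2.2
    have hq := periodic_sum (∏ p ∈ s, p) hTpos (fun m => ∏ p ∈ s, v p m)
      (prod_periodic s v hvper) (by
        intro m
        rw [Finset.abs_prod]
        exact Finset.prod_le_one (fun _ _ => abs_nonneg _) fun p hp => hvb p hp m) M
    have hmean : (∑ m ∈ Finset.range (∏ p ∈ s, p), ∏ p ∈ s, v p m) / (∏ p ∈ s, p : ℕ) =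
        if n = n' then ∏ p ∈ n.primeFactors, g p else 0 := by
      rw [sum_prod_crt s hsp v hvper]
      split_ifs with hnn
      · subst hnn
        have hss : s = n.primeFactors := by simp [hs]
        rw [hss]
        push_cast
        rw [← Finset.prod_div_distrib]
        refine Finset.prod_congr rfl fun p hp => ?_
        have : ∑ m ∈ Finset.range p, v p m = p * g p := by
          rw [← h2 n hn p hp]
          refine Finset.sum_congr rfl fun m _ => ?_
          simp only [hv, if_pos hp, sq]
        rw [this]
        have := (Nat.prime_of_mem_primeFactors hp).pos
        field_simp
      · have hex : ∃ p ∈ s, ∑ m ∈ Finset.range p, v p m = 0 := by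
          by_contra! hcon
          apply hnn
          have hpf : n.primeFactors = n'.primeFactors := by
            ext p
            constructor
            · intro hp
              by_contra hp'
              apply hcon p (Finset.mem_union_left _ hp)
              rw [← h0 n hn p hp]
              refine Finset.sum_congr rfl fun m _ => ?_
              simp only [hv, if_pos hp, if_neg hp', mul_one]
            · intro hp
              by_contra hp'
              apply hcon p (Finset.mem_union_right _ hp)
              rw [← h0 n' hn' p hp]
              refine Finset.sum_congr rfl fun m _ => ?_
              simp only [hv, if_pos hp, if_neg hp', one_mul]
          rw [← Nat.prod_primeFactors_of_squarefree (hN n hn).1,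
            ← Nat.prod_primeFactors_of_squarefree (hN n' hn').1, hpf]
        obtain ⟨p, hp, hp0⟩ := hex
        rw [Finset.prod_eq_zero hp hp0, zero_div]
    rw [hmean] at hq
    have hq2 := (abs_le.1 hq).2
    have hTR : ((∏ p ∈ s, p : ℕ) : ℝ) ≤ (R : ℝ) ^ 2 := by exact_mod_cast hTle
    simp only [hprod]
    linarith
  have hcard : (N.card : ℝ) ≤ R := by
    have : N ⊆ Finset.Icc 1 R := fun n hn => Finset.mem_Icc.2 ⟨(hN n hn).2.1, (hN n hn).2.2⟩
    have := Finset.card_le_card this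
    simp at this
    exact_mod_cast this
  calc (S.card : ℝ) * L ^ 2 ≤ _ := step1
    _ = _ := step2
    _ ≤ ∑ n ∈ N, ∑ n' ∈ N,
      (M * (if n = n' then ∏ p ∈ n.primeFactors, g p else 0) + 2 * (R : ℝ) ^ 2) :=
        Finset.sum_le_sum fun n hn => Finset.sum_le_sum fun n' hn' => step3 n hn n' hn'
    _ = M * L + 2 * ((N.card : ℝ) * N.card * (R : ℝ) ^ 2) := by
        simp only [Finset.sum_add_distrib, ← Finset.mul_sum, Finset.sum_const, nsmul_eq_mul]
        have : ∑ n ∈ N, ∑ n' ∈ N, (if n = n' then ∏ p ∈ n.primeFactors, g p else 0) = L := by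
          rw [hL]
          refine Finset.sum_congr rfl fun n hn => ?_
          simp [hn]
        rw [this]
        ring
    _ ≤ M * L + 2 * (R : ℝ) ^ 4 := by
        have : (N.card : ℝ) * N.card * (R : ℝ) ^ 2 ≤ R * R * (R : ℝ) ^ 2 := by gcongr
        nlinarith

end PPF

namespace PPF

/-- Reciprocal sum of squarefree integers coprime to `H`. -/
noncomputable def sqs (H Y : ℕ) : ℝ :=
  ∑ n ∈ (Finset.Icc 1 Y).filter (fun n => Squarefree n ∧ Nat.Coprime n H), (1 / n : ℝ)

theorem sum_inv_sq_le (Y : ℕ) : ∑ b ∈ Finset.Icc 1 Y, ((b : ℝ) ^ 2)⁻¹ ≤ 2 := by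
  have := sum_Ioo_inv_sq_le (α := ℝ) 0 (Y + 1)
  have e : Finset.Ioo 0 (Y + 1) = Finset.Icc 1 Y := by ext; simp; omega
  rw [e] at this
  simpa using this

theorem log_le_sqs (Y : ℕ) : Real.log (Y + 1) / 2 ≤ sqs 1 Y := by
  have h1 : Real.log (Y + 1) ≤ ∑ n ∈ Finset.Icc 1 Y, (n : ℝ)⁻¹ := by
    have := log_add_one_le_harmonic Y
    rw [harmonic_eq_sum_Icc] at this
    push_cast at this
    exact this
  choose a b hab hsq using Nat.sq_mul_squarefree
  set SF := (Finset.Icc 1 Y).filter (fun n => Squarefree n ∧ Nat.Coprime n 1) with hSF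
  have h2 : ∑ n ∈ Finset.Icc 1 Y, (n : ℝ)⁻¹ ≤
      ∑ z ∈ SF ×ˢ Finset.Icc 1 Y, (1 / (z.1 : ℝ)) * ((z.2 : ℝ) ^ 2)⁻¹ := by
    have hinj : Set.InjOn (fun n => (a n, b n)) (Finset.Icc 1 Y : Set ℕ) := by
      intro n _ m _ h
      simp only [Prod.mk.injEq] at h
      rw [← hab n, ← hab m, h.1, h.2]
    have e : ∑ n ∈ Finset.Icc 1 Y, (n : ℝ)⁻¹ =
        ∑ z ∈ (Finset.Icc 1 Y).image (fun n => (a n, b n)), (1 / (z.1 : ℝ)) * ((z.2 : ℝ) ^ 2)⁻¹ := by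
      rw [Finset.sum_image hinj]
      refine Finset.sum_congr rfl fun n _ => ?_
      have : (n : ℝ) = (b n : ℝ) ^ 2 * a n := by exact_mod_cast (hab n).symm
      rw [this, mul_inv, one_div, mul_comm]
    rw [e]
    refine Finset.sum_le_sum_of_subset_of_nonneg ?_ fun _ _ _ => by positivity
    intro z hz
    obtain ⟨n, hn, rfl⟩ := Finset.mem_image.1 hz
    rw [Finset.mem_Icc] at hn
    have hn0 : b n ^ 2 * a n ≠ 0 := by rw [hab]; omega
    have ha : 0 < a n := Nat.pos_of_ne_zero (right_ne_zero_of_mul hn0)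
    have hb : 0 < b n := Nat.pos_of_ne_zero (fun h => hn0 (by simp [h]))
    have hb2 : 0 < b n ^ 2 := by positivity
    have h3 : a n ≤ Y := (Nat.le_of_dvd (by omega) (Dvd.intro_left _ (hab n))).trans hn.2
    have h4 : b n ≤ Y := by
      have : b n ∣ n := by
        conv_rhs => rw [← hab n]
        exact (dvd_pow_self _ two_ne_zero).mul_right _
      exact (Nat.le_of_dvd (by omega) this).trans hn.2
    simp only [Finset.mem_product, hSF, Finset.mem_filter, Finset.mem_Icc]
    exact ⟨⟨⟨ha, h3⟩, hsq n, by simp⟩, hb, h4⟩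
  rw [Finset.sum_product] at h2
  simp only [← Finset.mul_sum, ← Finset.sum_mul] at h2
  have h3 := sum_inv_sq_le Y
  have h4 : 0 ≤ sqs 1 Y := Finset.sum_nonneg fun _ _ => by positivity
  have h5 : ∑ n ∈ Finset.Icc 1 Y, (n : ℝ)⁻¹ ≤ sqs 1 Y * 2 := h2.trans (by
    unfold sqs
    exact mul_le_mul_of_nonneg_left h3 h4)
  linarith

theorem sqs_mul_prime (H Y p : ℕ) (hp : p.Prime) :
    sqs H Y ≤ (1 + 1 / p) * sqs (H * p) Y := by
  classical
  set s := (Finset.Icc 1 Y).filter (fun n => Squarefree n ∧ Nat.Coprime n H) with hs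
  set t := (Finset.Icc 1 Y).filter (fun n => Squarefree n ∧ Nat.Coprime n (H * p)) with ht
  have hsplit : sqs H Y = ∑ n ∈ s.filter (fun n => p ∣ n), (1 / n : ℝ) +
      ∑ n ∈ s.filter (fun n => ¬ p ∣ n), (1 / n : ℝ) :=
    (Finset.sum_filter_add_sum_filter_not _ _ _).symm
  have h1 : ∑ n ∈ s.filter (fun n => ¬ p ∣ n), (1 / n : ℝ) ≤ sqs (H * p) Y := by
    refine Finset.sum_le_sum_of_subset_of_nonneg ?_ fun _ _ _ => by positivity
    intro n hn
    simp only [hs, Finset.mem_filter] at hn ⊢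
    refine ⟨hn.1.1, hn.1.2.1, Nat.Coprime.mul_right hn.1.2.2 ?_⟩
    exact ((Nat.Prime.coprime_iff_not_dvd hp).2 hn.2).symm
  have h2 : ∑ n ∈ s.filter (fun n => p ∣ n), (1 / n : ℝ) ≤ 1 / p * sqs (H * p) Y := by
    have hsub : s.filter (fun n => p ∣ n) ⊆ t.image (fun n => p * n) := by
      intro n hn
      simp only [hs, Finset.mem_filter, Finset.mem_Icc] at hn
      obtain ⟨⟨⟨hn1, hn2⟩, hsqf, hcop⟩, m, rfl⟩ := hn
      refine Finset.mem_image.2 ⟨m, ?_, rfl⟩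
      have hm := Nat.squarefree_mul_iff.1 hsqf
      have hm0 : 1 ≤ m := Nat.pos_of_ne_zero (by rintro rfl; simp at hn1)
      simp only [ht, Finset.mem_filter, Finset.mem_Icc]
      refine ⟨⟨hm0, (Nat.le_mul_of_pos_left m hp.pos).trans hn2⟩, hm.2.2, ?_⟩
      exact Nat.Coprime.mul_right hcop.coprime_mul_left hm.1.symm
    refine (Finset.sum_le_sum_of_subset_of_nonneg hsub fun _ _ _ => by positivity).trans ?_
    rw [Finset.sum_image (fun a _ b _ h => Nat.eq_of_mul_eq_mul_left hp.pos h)]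
    unfold sqs
    rw [Finset.mul_sum]
    refine Finset.sum_le_sum fun n _ => ?_
    push_cast
    rw [one_div_mul_one_div]
  rw [hsplit]
  linarith

theorem sqs_lower (q r Y : ℕ) (hq : q.Prime) (hq5 : 5 ≤ q) (hr : r.Prime) (hr5 : 5 ≤ r) :
    Real.log (Y + 1) / 6 ≤ sqs (6 * q * r) Y := by
  have h0 := log_le_sqs Y
  have h1 := sqs_mul_prime 1 Y 2 Nat.prime_two
  have h2 := sqs_mul_prime (1 * 2) Y 3 Nat.prime_three
  have h3 := sqs_mul_prime (1 * 2 * 3) Y q hq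
  have h4 := sqs_mul_prime (1 * 2 * 3 * q) Y r hr
  have n : ∀ H, 0 ≤ sqs H Y := fun H => Finset.sum_nonneg fun _ _ => by positivity
  have hq' : (1 : ℝ) / q ≤ 1 / 5 := by
    apply one_div_le_one_div_of_le (by norm_num); exact_mod_cast hq5
  have hr' : (1 : ℝ) / r ≤ 1 / 5 := by
    apply one_div_le_one_div_of_le (by norm_num); exact_mod_cast hr5
  have e : 1 * 2 * 3 * q * r = 6 * q * r := by ring
  have h3' : sqs (1 * 2 * 3) Y ≤ 6 / 5 * sqs (1 * 2 * 3 * q) Y :=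
    h3.trans (mul_le_mul_of_nonneg_right (by linarith) (n _))
  have h4' : sqs (1 * 2 * 3 * q) Y ≤ 6 / 5 * sqs (1 * 2 * 3 * q * r) Y :=
    h4.trans (mul_le_mul_of_nonneg_right (by linarith) (n _))
  rw [e] at h4'
  push_cast at h1 h2
  have := n (6 * q * r)
  linarith

theorem card_class (p D : ℕ) (hp : p.Prime) (hD : ¬ p ∣ D) :
    ((Finset.range p).filter (fun m => p ∣ D * m + 1)).card = 1 := by
  have := Fact.mk hp
  rw [Finset.card_eq_one]
  refine ⟨(-(D : ZMod p)⁻¹).val, ?_⟩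
  have hD0 : (D : ZMod p) ≠ 0 := by rwa [Ne, ZMod.natCast_eq_zero_iff]
  ext m
  simp only [Finset.mem_filter, Finset.mem_range, Finset.mem_singleton]
  have key : p ∣ D * m + 1 ↔ (m : ZMod p) = -(D : ZMod p)⁻¹ := by
    rw [← ZMod.natCast_eq_zero_iff]
    push_cast
    constructor
    · intro h
      field_simp
      linear_combination h
    · intro h
      rw [h]
      field_simp
      ring
  rw [key]
  constructor
  · rintro ⟨h1, h2⟩
    rw [← h2, ZMod.val_natCast_of_lt h1]
  · rintro rfl
    exact ⟨ZMod.val_lt _, by simp⟩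

theorem card_bad (p D : ℕ) (hp : p.Prime) (hD : ¬ p ∣ D) (P : Prop) [Decidable P] :
    ((Finset.range p).filter (fun m => p ∣ D * m + 1 ∨ (P ∧ p ∣ m))).card = if P then 2 else 1 := by
  split_ifs with h
  · have e : (Finset.range p).filter (fun m => p ∣ D * m + 1 ∨ (P ∧ p ∣ m)) =
        (Finset.range p).filter (fun m => p ∣ D * m + 1) ∪ {0} := by
      ext m
      simp only [Finset.mem_filter, Finset.mem_range, Finset.mem_union, Finset.mem_singleton]
      constructor
      · rintro ⟨h1, h2 | h2⟩
        · exact Or.inl ⟨h1, h2⟩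
        · exact Or.inr (Nat.eq_zero_of_dvd_of_lt h2.2 h1)
      · rintro (h1 | rfl)
        · exact ⟨h1.1, Or.inl h1.2⟩
        · exact ⟨hp.pos, Or.inr ⟨h, dvd_zero _⟩⟩
    rw [e, Finset.card_union_of_disjoint, card_class p D hp hD]
    · simp
    · simp only [Finset.disjoint_singleton_right, Finset.mem_filter, mul_zero, zero_add,
        Nat.dvd_one, not_and]
      intro _
      exact hp.one_lt.ne'
  · simp only [h, false_and, or_false]
    exact card_class p D hp hD

theorem sieve_count (D q R M : ℕ) (I : Finset ℕ) (hq : q.Prime) (hq5 : 5 ≤ q)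
    (hD : ∀ p : ℕ, p.Prime → p ∣ D → p = 3 ∨ p = q) (hR : 1 ≤ R)
    (hI : ∀ r ∈ I, r.Prime ∧ 5 ≤ r ∧ r ≠ q ∧ r ^ 2 ≤ R) (hRM : R ^ 4 ≤ M)
    (hL1 : 1 ≤ (∑ r ∈ I, (1 / r : ℝ)) * Real.log R / 12) (S : Finset ℕ)
    (hS : ∀ m ∈ S, m < M ∧ (D * m + 1).Prime ∧ R < D * m + 1 ∧ ∀ r ∈ I, ¬ r ∣ m) :
    (S.card : ℝ) * ((∑ r ∈ I, (1 / r : ℝ)) * Real.log R / 12) ≤ 3 * M := by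
  classical
  set L0 := (∑ r ∈ I, (1 / r : ℝ)) * Real.log R / 12 with hL0
  set N := (Finset.Icc 1 R).filter (fun n => Squarefree n ∧ Nat.Coprime n (6 * q)) with hN
  set w : ℕ → ℝ := fun p => if p ∈ I then 2 else 1 with hw
  set g : ℕ → ℝ := fun p => w p / (p - w p) with hg
  set bad : ℕ → ℕ → Prop := fun p m => p ∣ D * m + 1 ∨ (p ∈ I ∧ p ∣ m) with hbad
  set u : ℕ → ℕ → ℝ := fun p m => if bad p m then -1 else g p with hu
  have hw2 : ∀ p, w p ≤ 2 ∧ 1 ≤ w p := by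
    intro p; simp only [hw]; split_ifs <;> norm_num
  have hpN : ∀ n ∈ N, ∀ p ∈ n.primeFactors, p.Prime ∧ 5 ≤ p ∧ p ≤ R ∧ ¬ p ∣ D := by
    intro n hn p hp
    simp only [hN, Finset.mem_filter, Finset.mem_Icc] at hn
    have hpp := Nat.prime_of_mem_primeFactors hp
    have hpd := Nat.dvd_of_mem_primeFactors hp
    have hc : Nat.Coprime p (6 * q) := Nat.Coprime.coprime_dvd_left hpd hn.2.2
    have hc6 : ¬ p ∣ 6 * q := (Nat.Prime.coprime_iff_not_dvd hpp).1 hc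
    have hne2 : p ≠ 2 := by rintro rfl; exact hc6 (Dvd.dvd.mul_right (by norm_num) _)
    have hne3 : p ≠ 3 := by rintro rfl; exact hc6 (Dvd.dvd.mul_right (by norm_num) _)
    have hneq : p ≠ q := by rintro rfl; exact hc6 (Dvd.intro_left _ rfl)
    have hne4 : p ≠ 4 := by rintro rfl; exact absurd hpp (by norm_num)
    refine ⟨hpp, by have := hpp.two_le; omega, (Nat.le_of_dvd (by omega) hpd).trans hn.1.2, ?_⟩
    intro h
    rcases hD p hpp h with h | h
    · exact hne3 h
    · exact hneq h
  have hgp : ∀ p : ℕ, 5 ≤ p → 0 < (p : ℝ) - w p ∧ w p / p ≤ g p ∧ 0 ≤ g p ∧ g p ≤ 1 := by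
    intro p hp
    have h5 : (5 : ℝ) ≤ p := by exact_mod_cast hp
    have := hw2 p
    have h0 : 0 < (p : ℝ) - w p := by linarith
    refine ⟨h0, ?_, ?_, ?_⟩
    · apply div_le_div_of_nonneg_left <;> linarith
    · apply div_nonneg <;> linarith
    · rw [hg, div_le_one h0]; linarith
  have hcardbad : ∀ p : ℕ, p.Prime → ¬ p ∣ D →
      (((Finset.range p).filter (bad p)).card : ℝ) = w p := by
    intro p hp hpD
    have := card_bad p D hp hpD (p ∈ I)
    have e : ((Finset.range p).filter (bad p)).card = if p ∈ I then 2 else 1 := by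
      rw [← this]
    rw [e]
    simp only [hw]
    split_ifs <;> simp
  have hcardgood : ∀ p : ℕ, p.Prime → ¬ p ∣ D →
      (((Finset.range p).filter (fun m => ¬ bad p m)).card : ℝ) = p - w p := by
    intro p hp hpD
    have := Finset.card_filter_add_card_filter_not (s := Finset.range p) (bad p)
    rw [Finset.card_range] at this
    rw [← hcardbad p hp hpD, eq_sub_iff_add_eq']
    exact_mod_cast this
  have hmain := sieve_abstract N R u g
    (by intro n hn
        simp only [hN, Finset.mem_filter, Finset.mem_Icc] at hn
        exact ⟨hn.2.1, hn.1.1, hn.1.2⟩)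
    (by intro n hn p hp m
        have : bad p (m % p) ↔ bad p m := by
          simp only [hbad]
          rw [Nat.dvd_mod_iff dvd_rfl]
          have : p ∣ D * (m % p) + 1 ↔ p ∣ D * m + 1 := by
            refine (Nat.ModEq.dvd_iff (m := p) ?_ dvd_rfl)
            exact Nat.ModEq.add_right _ (Nat.ModEq.mul_left _ (Nat.mod_modEq _ _))
          rw [this]
        simp only [hu, this])
    (by intro n hn p hp m
        have := hgp p (hpN n hn p hp).2.1
        simp only [hu]
        split_ifs
        · simp
        · rw [abs_le]; constructor <;> linarith)
    (by intro n hn p hp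
        obtain ⟨h1, h2, h3, h4⟩ := hpN n hn p hp
        simp only [hu]
        rw [Finset.sum_ite, Finset.sum_const, Finset.sum_const, nsmul_eq_mul, nsmul_eq_mul,
          hcardbad p h1 h4, hcardgood p h1 h4]
        have := (hgp p h2).1.ne'
        simp only [hg]
        field_simp
        ring)
    (by intro n hn p hp
        obtain ⟨h1, h2, h3, h4⟩ := hpN n hn p hp
        simp only [hu, ite_pow]
        rw [Finset.sum_ite, Finset.sum_const, Finset.sum_const, nsmul_eq_mul, nsmul_eq_mul,
          hcardbad p h1 h4, hcardgood p h1 h4]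
        have := (hgp p h2).1.ne'
        simp only [hg]
        field_simp
        ring)
    M S (fun m hm => Finset.mem_range.2 (hS m hm).1)
    (by intro m hm n hn p hp
        obtain ⟨h1, h2, h3, h4⟩ := hpN n hn p hp
        obtain ⟨s1, s2, s3, s4⟩ := hS m hm
        have : ¬ bad p m := by
          rintro (h | h)
          · have := (Nat.prime_dvd_prime_iff_eq h1 s2).1 h
            omega
          · exact s4 p h.1 h.2
        simp only [hu, if_neg this])
  set L := ∑ n ∈ N, ∏ p ∈ n.primeFactors, g p with hL
  -- lower bound for L
  have hLlow : L0 ≤ L := by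
    have h1 : ∀ n ∈ N, ∑ r ∈ I, (if r ∣ n then (1 / n : ℝ) else 0) ≤
        ∏ p ∈ n.primeFactors, g p := by
      intro n hn
      have hn' := hn
      simp only [hN, Finset.mem_filter, Finset.mem_Icc] at hn'
      have hprod : ∏ p ∈ n.primeFactors, (w p / p) ≤ ∏ p ∈ n.primeFactors, g p := by
        refine Finset.prod_le_prod ?_ ?_
        · intro p hp
          have := (hw2 p).2
          positivity
        · intro p hp
          exact (hgp p (hpN n hn p hp).2.1).2.1
      refine le_trans ?_ hprod
      rw [Finset.prod_div_distrib]
      have e1 : ∏ p ∈ n.primeFactors, (p : ℝ) = n := by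
        have := Nat.prod_primeFactors_of_squarefree hn'.2.1
        rw [← Nat.cast_prod, this]
      have e2 : ∏ p ∈ n.primeFactors, w p = 2 ^ (n.primeFactors ∩ I).card := by
        simp only [hw]
        rw [Finset.prod_ite_mem, Finset.prod_const]
      have e3 : ∑ r ∈ I, (if r ∣ n then (1 / n : ℝ) else 0) = (n.primeFactors ∩ I).card * (1 / n) := by
        rw [← Finset.sum_filter, Finset.sum_const, nsmul_eq_mul]
        congr 3
        ext r
        simp only [Finset.mem_filter, Finset.mem_inter, Nat.mem_primeFactors]
        constructor
        · rintro ⟨a, b⟩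
          exact ⟨⟨(hI r a).1, b, by omega⟩, a⟩
        · rintro ⟨a, b⟩
          exact ⟨b, a.2.1⟩
      rw [e1, e2, e3, mul_one_div]
      gcongr
      exact_mod_cast Nat.lt_two_pow_self.le
    have h2 : ∀ r ∈ I, (1 / r : ℝ) * (Real.log R / 12) ≤
        ∑ n ∈ N, (if r ∣ n then (1 / n : ℝ) else 0) := by
      intro r hr
      obtain ⟨hrp, hr5, hrq, hrR⟩ := hI r hr
      rw [← Finset.sum_filter]
      have h3 : (1 / r : ℝ) * sqs (6 * q * r) (R / r) ≤ ∑ n ∈ N.filter (fun n => r ∣ n), (1 / n : ℝ) := by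
        unfold sqs
        rw [Finset.mul_sum]
        simp only [one_div_mul_one_div, ← Nat.cast_mul]
        rw [← Finset.sum_image (s := (Finset.Icc 1 (R / r)).filter _) (g := fun n => r * n)
          (f := fun n : ℕ => (1 / n : ℝ)) (fun a _ b _ h => Nat.eq_of_mul_eq_mul_left hrp.pos h)]
        refine Finset.sum_le_sum_of_subset_of_nonneg ?_ fun _ _ _ => by positivity
        intro n hn
        obtain ⟨m, hm, rfl⟩ := Finset.mem_image.1 hn
        simp only [hN, Finset.mem_filter, Finset.mem_Icc] at hm ⊢
        obtain ⟨⟨m1, m2⟩, m3, m4⟩ := hm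
        refine ⟨⟨⟨Nat.mul_pos hrp.pos m1, ?_⟩, ?_, ?_⟩, Dvd.intro _ rfl⟩
        · rw [mul_comm]; exact (Nat.le_div_iff_mul_le hrp.pos).1 m2
        · exact Nat.squarefree_mul_iff.2 ⟨m4.coprime_mul_left_right.symm, hrp.squarefree, m3⟩
        · refine Nat.Coprime.mul_left ?_ m4.coprime_mul_right_right
          refine Nat.Coprime.mul_right ?_ ((Nat.coprime_primes hrp hq).2 hrq)
          rw [Nat.Prime.coprime_iff_not_dvd hrp]
          intro h
          have := Nat.le_of_dvd (by norm_num) h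
          interval_cases r
          · omega
          · exact absurd hrp (by norm_num)
      refine le_trans ?_ h3
      gcongr
      refine le_trans ?_ (sqs_lower q r (R / r) hq hq5 hrp hr5)
      have h4 : Real.log R / 2 ≤ Real.log ((R / r : ℕ) + 1) := by
        have hr0 : (0 : ℝ) < r := by exact_mod_cast hrp.pos
        have hRr : ((r : ℝ)) ^ 2 ≤ R := by exact_mod_cast hrR
        have hR0 : (0 : ℝ) < R := by exact_mod_cast hR
        have h5 : (R : ℝ) / r ≤ (R / r : ℕ) + 1 := by
          have := Nat.lt_floor_add_one ((R : ℝ) / r)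
          rw [Nat.floor_div_eq_div] at this
          exact this.le
        have h6 : Real.log (R / r) ≤ Real.log ((R / r : ℕ) + 1) :=
          Real.log_le_log (by positivity) h5
        rw [Real.log_div hR0.ne' hr0.ne'] at h6
        have h7 := Real.log_le_log (by positivity) hRr
        rw [Real.log_pow] at h7
        push_cast at h7
        linarith
      linarith
    calc L0 = ∑ r ∈ I, (1 / r : ℝ) * (Real.log R / 12) := by
          rw [hL0, ← Finset.sum_mul]; ring
      _ ≤ ∑ r ∈ I, ∑ n ∈ N, (if r ∣ n then (1 / n : ℝ) else 0) := Finset.sum_le_sum h2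
      _ = ∑ n ∈ N, ∑ r ∈ I, (if r ∣ n then (1 / n : ℝ) else 0) := Finset.sum_comm
      _ ≤ L := Finset.sum_le_sum h1
  have hLp : 1 ≤ L := hL1.trans hLlow
  have hRM' : (R : ℝ) ^ 4 ≤ M := by exact_mod_cast hRM
  have hM0 : (0 : ℝ) ≤ M := by positivity
  have hc0 : (0 : ℝ) ≤ S.card := by positivity
  have h1 : (S.card : ℝ) * L * L ≤ 3 * M * L := by nlinarith
  have h2 : (S.card : ℝ) * L ≤ 3 * M := le_of_mul_le_mul_right h1 (by linarith)
  nlinarith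

end PPF

namespace PPF

open Chebyshev

theorem theta_half {x : ℝ} (hx : 50 ^ 4 ≤ x) : x / 2 ≤ theta x := by
  have h := theta_ge' (x := x) (by linarith)
  have hx0 : 0 < x := by linarith
  set z := x ^ (1 / 4 : ℝ) with hz
  have hz4 : z ^ 4 = x := by
    rw [hz, ← Real.rpow_natCast, ← Real.rpow_mul hx0.le]; norm_num
  have hz0 : 0 < z := Real.rpow_pos_of_pos hx0 _
  have hz50 : 50 ≤ z := by
    by_contra hcon
    push Not at hcon
    have : z ^ 4 < 50 ^ 4 := by gcongr
    linarith
  have hlog : Real.log x ≤ 4 * z := by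
    rw [← hz4, Real.log_pow]
    have := Real.log_le_sub_one_of_pos hz0
    push_cast
    linarith
  have hsq : Real.sqrt x = z ^ 2 := by
    rw [← hz4, show z ^ 4 = (z ^ 2) ^ 2 by ring]
    exact Real.sqrt_sq (by positivity)
  have hlog2 : Real.log (x + 2) ≤ 4 * z + 1 := by
    have h1 : Real.log (x + 2) ≤ Real.log (x * 2) := Real.log_le_log (by linarith) (by linarith)
    rw [Real.log_mul hx0.ne' (by norm_num)] at h1
    have := Real.log_two_lt_d9
    linarith
  have hl2 := Real.log_two_gt_d9
  have hl2' := Real.log_two_lt_d9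
  have h3 : 2 * Real.sqrt x * Real.log x ≤ 8 * z ^ 3 := by
    rw [hsq]
    nlinarith [sq_nonneg z]
  have h4 : 50 * z ^ 3 ≤ z ^ 4 := by nlinarith [pow_pos hz0 3]
  have h5 : 2500 * z ≤ z ^ 3 := by nlinarith [mul_nonneg hz0.le (mul_nonneg (sub_nonneg.2 hz50) (by linarith : (0:ℝ) ≤ z + 50))]
  nlinarith

/-- Primes in a half open real interval. -/
noncomputable def primesIn (y z : ℝ) : Finset ℕ := (Finset.Ioc ⌊y⌋₊ ⌊z⌋₊).filter Nat.Prime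

theorem mem_primesIn {y z : ℝ} (hy : 0 ≤ y) (p : ℕ) :
    p ∈ primesIn y z ↔ p.Prime ∧ y < p ∧ (p : ℝ) ≤ z := by
  unfold primesIn
  rw [Finset.mem_filter, Finset.mem_Ioc, Nat.floor_lt hy]
  constructor
  · rintro ⟨⟨h1, h2⟩, h3⟩
    exact ⟨h3, h1, (Nat.le_floor_iff' h3.ne_zero).1 h2⟩
  · rintro ⟨h3, h1, h2⟩
    exact ⟨⟨h1, (Nat.le_floor_iff' h3.ne_zero).2 h2⟩, h3⟩

theorem theta_sub {y z : ℝ} (hyz : y ≤ z) :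
    theta z - theta y = ∑ p ∈ primesIn y z, Real.log p := by
  unfold theta primesIn
  have hf : ⌊y⌋₊ ≤ ⌊z⌋₊ := Nat.floor_le_floor hyz
  rw [← Finset.Ioc_union_Ioc_eq_Ioc (Nat.zero_le _) hf, Finset.filter_union,
    Finset.sum_union]
  · ring
  · apply Finset.disjoint_filter_filter
    exact Finset.Ioc_disjoint_Ioc_of_le le_rfl

theorem theta_block {y : ℝ} (hy : 50 ^ 4 ≤ y) : y ≤ ∑ p ∈ primesIn y (8 * y), Real.log p := by
  rw [← theta_sub (by linarith)]
  have h1 := theta_half (x := 8 * y) (by linarith)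
  have h2 := theta_le_log4_mul_x (x := y) (by linarith)
  have h3 : Real.log 4 ≤ 2 := by
    rw [show (4 : ℝ) = 2 ^ 2 by norm_num, Real.log_pow]
    have := Real.log_two_lt_d9
    push_cast
    linarith
  nlinarith

theorem prime_count {y : ℝ} (hy : 50 ^ 4 ≤ y) :
    y ≤ (primesIn y (8 * y)).card * Real.log (8 * y) := by
  refine (theta_block hy).trans ?_
  rw [← nsmul_eq_mul, ← Finset.sum_const]
  refine Finset.sum_le_sum fun p hp => ?_
  rw [mem_primesIn (by linarith)] at hp
  exact Real.log_le_log (by exact_mod_cast hp.1.pos) hp.2.2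

theorem recip_block {y : ℝ} (hy : 50 ^ 4 ≤ y) :
    1 / (8 * Real.log (8 * y)) ≤ ∑ p ∈ primesIn y (8 * y), (1 / p : ℝ) := by
  have hlog : 0 < Real.log (8 * y) := Real.log_pos (by linarith)
  have h := prime_count hy
  have h2 : (primesIn y (8 * y)).card * (1 / (8 * y)) ≤ ∑ p ∈ primesIn y (8 * y), (1 / p : ℝ) := by
    rw [← nsmul_eq_mul, ← Finset.sum_const]
    refine Finset.sum_le_sum fun p hp => ?_
    rw [mem_primesIn (by linarith)] at hp
    exact one_div_le_one_div_of_le (by exact_mod_cast hp.1.pos) hp.2.2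
  refine le_trans ?_ h2
  have hy0 : 0 < y := by linarith
  rw [mul_one_div, div_le_div_iff₀ (by positivity) (by positivity)]
  nlinarith

theorem primesIn_union {x y z : ℝ} (hxy : x ≤ y) (hyz : y ≤ z) (f : ℕ → ℝ) :
    ∑ p ∈ primesIn x z, f p = ∑ p ∈ primesIn x y, f p + ∑ p ∈ primesIn y z, f p := by
  unfold primesIn
  rw [← Finset.Ioc_union_Ioc_eq_Ioc (Nat.floor_le_floor hxy) (Nat.floor_le_floor hyz),
    Finset.filter_union, Finset.sum_union]
  apply Finset.disjoint_filter_filter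
  exact Finset.Ioc_disjoint_Ioc_of_le le_rfl

theorem primesIn_mono {x y z : ℝ} (hyz : y ≤ z) : primesIn x y ⊆ primesIn x z :=
  Finset.filter_subset_filter _ (Finset.Ioc_subset_Ioc_right (Nat.floor_le_floor hyz))

theorem recip_blocks {y : ℝ} (hy : 50 ^ 4 ≤ y) (j : ℕ) (hj : (8 : ℝ) ^ j ≤ y) :
    j / (16 * Real.log y) ≤ ∑ p ∈ primesIn y (8 ^ j * y), (1 / p : ℝ) := by
  induction j with
  | zero => simp; exact Finset.sum_nonneg fun _ _ => by positivity
  | succ j ih =>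
    have hle : (8 : ℝ) ^ j ≤ 8 ^ (j + 1) := by gcongr <;> norm_num
    have h1 := ih (hle.trans hj)
    have hy0 : 0 < y := by linarith
    have h8 : (1 : ℝ) ≤ 8 ^ j := one_le_pow₀ (by norm_num)
    have hyy : y ≤ 8 ^ j * y := by nlinarith
    have h2 := recip_block (hy.trans hyy)
    have e : 8 * (8 ^ j * y) = 8 ^ (j + 1) * y := by ring
    rw [e] at h2
    rw [primesIn_union (y := 8 ^ j * y) hyy (by gcongr <;> norm_num)]
    have h3 : Real.log (8 ^ (j + 1) * y) ≤ 2 * Real.log y := by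
      rw [Real.log_mul (by positivity) hy0.ne']
      have := Real.log_le_log (by positivity) hj
      linarith
    have hlog : 0 < Real.log (8 ^ (j + 1) * y) := by
      apply Real.log_pos
      have : (1 : ℝ) ≤ 8 ^ (j + 1) := one_le_pow₀ (by norm_num)
      nlinarith
    have h4 : 1 / (16 * Real.log y) ≤ 1 / (8 * Real.log (8 ^ (j + 1) * y)) := by
      apply one_div_le_one_div_of_le <;> linarith
    push_cast
    rw [add_div]
    linarith

theorem recip_sq {y : ℝ} (hy : 50 ^ 4 ≤ y) :
    1 / 100 ≤ ∑ p ∈ primesIn y (y ^ 2), (1 / p : ℝ) := by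
  have hy0 : 0 < y := by linarith
  have h2 := Real.log_two_lt_d9
  have h2' := Real.log_two_gt_d9
  have hlog8 : Real.log 8 = 3 * Real.log 2 := by
    rw [show (8 : ℝ) = 2 ^ 3 by norm_num, Real.log_pow]; norm_num
  have hlogy : 11 * Real.log 2 ≤ Real.log y := by
    have : Real.log (2 ^ 11) ≤ Real.log y := Real.log_le_log (by norm_num) (by linarith)
    rw [Real.log_pow] at this
    exact_mod_cast this
  set j := ⌊Real.log y / Real.log 8⌋₊ with hj
  have hl8 : 0 < Real.log 8 := by rw [hlog8]; linarith
  have hj1 : (j : ℝ) ≤ Real.log y / Real.log 8 := Nat.floor_le (by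
    apply div_nonneg <;> linarith)
  have hj2 : Real.log y / Real.log 8 < j + 1 := Nat.lt_floor_add_one _
  have h8j : (8 : ℝ) ^ j ≤ y := by
    rw [le_div_iff₀ hl8, ← Real.log_pow] at hj1
    exact (Real.log_le_log_iff (by positivity) hy0).1 hj1
  have h1 := recip_blocks hy j h8j
  have h3 : ∑ p ∈ primesIn y (8 ^ j * y), (1 / p : ℝ) ≤ ∑ p ∈ primesIn y (y ^ 2), (1 / p : ℝ) := by
    refine Finset.sum_le_sum_of_subset_of_nonneg (primesIn_mono ?_) fun _ _ _ => by positivity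
    rw [sq]; gcongr
  refine le_trans ?_ (h1.trans h3)
  rw [div_lt_iff₀ hl8, hlog8] at hj2
  rw [div_le_div_iff₀ (by norm_num) (by linarith)]
  nlinarith

theorem recip_pow {y : ℝ} (hy : 50 ^ 4 ≤ y) (j : ℕ) :
    j / 100 ≤ ∑ p ∈ primesIn y (y ^ (2 ^ j)), (1 / p : ℝ) := by
  induction j with
  | zero => simp; exact Finset.sum_nonneg fun _ _ => by positivity
  | succ j ih =>
    have h1 : y ≤ y ^ (2 ^ j) := le_self_pow₀ (by linarith) (by positivity)
    have h2 := recip_sq (hy.trans h1)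
    have e : (y ^ 2 ^ j) ^ 2 = y ^ (2 ^ (j + 1)) := by rw [← pow_mul, pow_succ]
    rw [e] at h2
    rw [primesIn_union h1 (by rw [← e]; exact le_self_pow₀ (by linarith) (by norm_num))]
    push_cast
    linarith

theorem psi_sub {y z : ℝ} (hyz : y ≤ z) :
    psi z - psi y = ∑ n ∈ Finset.Ioc ⌊y⌋₊ ⌊z⌋₊, ArithmeticFunction.vonMangoldt n := by
  unfold psi
  rw [← Finset.Ioc_union_Ioc_eq_Ioc (Nat.zero_le _) (Nat.floor_le_floor hyz),
    Finset.sum_union (Finset.Ioc_disjoint_Ioc_of_le le_rfl)]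
  ring

theorem psi_block {x : ℝ} (hx : 50 ^ 4 ≤ x) :
    2 * x ≤ ∑ n ∈ Finset.Ioc ⌊Real.exp (-2) * x⌋₊ ⌊Real.exp 2 * x⌋₊,
      ArithmeticFunction.vonMangoldt n := by
  have hx0 : 0 < x := by linarith
  have he := Real.exp_one_gt_d9
  have he2 : 7 ≤ Real.exp 2 := by
    rw [show (2 : ℝ) = 1 + 1 by norm_num, Real.exp_add]
    nlinarith
  have he3 : Real.exp (-2) ≤ 1 / 7 := by
    rw [Real.exp_neg, ← one_div]
    exact one_div_le_one_div_of_le (by norm_num) he2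
  have hep := Real.exp_pos (-2)
  rw [← psi_sub (by nlinarith)]
  have h1 := theta_half (x := Real.exp 2 * x) (by nlinarith)
  have h2 := theta_le_psi (Real.exp 2 * x)
  have h3 := psi_le_const_mul_self (x := Real.exp (-2) * x) (by positivity)
  have h4 : Real.log 4 ≤ 2 := by
    rw [show (4 : ℝ) = 2 ^ 2 by norm_num, Real.log_pow]
    have := Real.log_two_lt_d9
    push_cast
    linarith
  have h5 : (Real.log 4 + 4) * (Real.exp (-2) * x) ≤ 6 * (1 / 7 * x) := by
    have : 0 ≤ Real.log 4 := Real.log_nonneg (by norm_num)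
    gcongr
    linarith
  nlinarith

end PPF

namespace PPF

open MeasureTheory Complex

/-- Trigonometric polynomial. -/
noncomputable def trig (a : ℕ → ℂ) (N : ℕ) (t : ℝ) : ℂ :=
  ∑ n ∈ Finset.range N, a n * cexp (2 * Real.pi * I * n * t)

theorem trig_cont (a : ℕ → ℂ) (N : ℕ) : Continuous (trig a N) := by
  unfold trig; fun_prop

theorem trig_deriv (a : ℕ → ℂ) (N : ℕ) (t : ℝ) :
    HasDerivAt (trig a N) (trig (fun n => 2 * Real.pi * I * n * a n) N t) t := by
  unfold trig
  refine HasDerivAt.fun_sum fun n _ => ?_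
  have h1 : HasDerivAt (fun t : ℝ => 2 * Real.pi * I * n * (t : ℂ)) (2 * Real.pi * I * n) t := by
    simpa using (hasDerivAt_id (t : ℂ)).comp_ofReal.const_mul (2 * Real.pi * I * n)
  have := (h1.cexp).const_mul (a n)
  convert! this using 1
  ring

theorem integral_e (k : ℤ) :
    ∫ t : ℝ in (0 : ℝ)..1, cexp (2 * Real.pi * I * k * t) = if k = 0 then 1 else 0 := by
  split_ifs with h
  · simp [h]
  · have hc : (2 * Real.pi * I * k : ℂ) ≠ 0 := by
      have := Complex.two_pi_I_ne_zero
      exact mul_ne_zero this (by exact_mod_cast h)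
    rw [integral_exp_mul_complex hc]
    have : cexp (2 * Real.pi * I * k * ((1 : ℝ) : ℂ)) = 1 := by
      rw [Complex.exp_eq_one_iff]
      exact ⟨k, by push_cast; ring⟩
    rw [this]
    simp

theorem trig_normSq (a : ℕ → ℂ) (N : ℕ) (t : ℝ) :
    ((‖trig a N t‖ ^ 2 : ℝ) : ℂ) = ∑ n ∈ Finset.range N, ∑ m ∈ Finset.range N,
      a n * (starRingEnd ℂ) (a m) * cexp (2 * Real.pi * I * ((n : ℤ) - (m : ℤ) : ℤ) * t) := by
  rw [← Complex.normSq_eq_norm_sq, ← Complex.mul_conj]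
  unfold trig
  rw [map_sum, Finset.sum_mul_sum]
  refine Finset.sum_congr rfl fun n _ => Finset.sum_congr rfl fun m _ => ?_
  rw [map_mul, ← Complex.exp_conj]
  simp only [map_mul, Complex.conj_ofReal, Complex.conj_I, map_natCast, Complex.conj_ofNat]
  rw [mul_mul_mul_comm, ← Complex.exp_add]
  congr 2
  push_cast
  ring

theorem trig_parseval (a : ℕ → ℂ) (N : ℕ) :
    ∫ t : ℝ in (0 : ℝ)..1, ‖trig a N t‖ ^ 2 = ∑ n ∈ Finset.range N, ‖a n‖ ^ 2 := by
  have : ((∫ t : ℝ in (0 : ℝ)..1, ‖trig a N t‖ ^ 2 : ℝ) : ℂ) =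
      ((∑ n ∈ Finset.range N, ‖a n‖ ^ 2 : ℝ) : ℂ) := by
    rw [← intervalIntegral.integral_ofReal]
    simp only [trig_normSq]
    rw [intervalIntegral.integral_finsetSum]
    · rw [Complex.ofReal_sum]
      refine Finset.sum_congr rfl fun n hn => ?_
      rw [intervalIntegral.integral_finsetSum]
      · simp only [intervalIntegral.integral_const_mul]
        have e : ∀ m : ℕ, ∫ t : ℝ in (0 : ℝ)..1,
            cexp (2 * Real.pi * I * ((n : ℤ) - (m : ℤ) : ℤ) * t) = if n = m then 1 else 0 := by
          intro m
          rw [integral_e]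
          congr 1
          simp only [eq_iff_iff]
          omega
        simp only [e]
        simp only [mul_ite, mul_one, mul_zero, Finset.sum_ite_eq, hn, if_true]
        rw [Complex.mul_conj, Complex.normSq_eq_norm_sq]
      · intro m _
        apply Continuous.intervalIntegrable
        fun_prop
    · intro n _
      apply Continuous.intervalIntegrable
      fun_prop
  exact_mod_cast this

theorem gallagher (f f' : ℝ → ℝ) (hf : ∀ t, HasDerivAt f (f' t) t) (hc : Continuous f')
    (α δ : ℝ) (hδ : 0 < δ) (G : ℝ → ℝ) (hG : Continuous G) (hfG : ∀ t, f t / δ + |f' t| ≤ G t) :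
    f α ≤ ∫ t in α..(α + δ), G t := by
  have hfc : Continuous f := continuous_iff_continuousAt.2 fun t => (hf t).continuousAt
  set K := ∫ t in α..(α + δ), |f' t| with hK
  have h1 : ∀ t ∈ Set.Icc α (α + δ), f α - K ≤ f t := by
    intro t ht
    have e := intervalIntegral.integral_eq_sub_of_hasDerivAt (a := α) (b := t) (f := f) (f' := f')
      (fun x _ => hf x) (hc.intervalIntegrable _ _)
    have h2 : |∫ y in α..t, f' y| ≤ ∫ y in α..t, |f' y| :=
      intervalIntegral.abs_integral_le_integral_abs ht.1
    have h3 : ∫ y in α..t, |f' y| ≤ K := by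
      rw [hK]
      apply intervalIntegral.integral_mono_interval le_rfl ht.1 ht.2
      · exact Filter.Eventually.of_forall fun _ => abs_nonneg _
      · exact hc.abs.intervalIntegrable _ _
    have := (abs_le.1 (h2.trans h3)).1
    linarith
  have h2 : ∫ t in α..(α + δ), (f α - K) ≤ ∫ t in α..(α + δ), f t :=
    intervalIntegral.integral_mono_on (by linarith) (by simp) (hfc.intervalIntegrable _ _) h1
  rw [intervalIntegral.integral_const, smul_eq_mul] at h2
  have h3 : ∫ t in α..(α + δ), (f t / δ + |f' t|) ≤ ∫ t in α..(α + δ), G t :=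
    intervalIntegral.integral_mono_on (by linarith) (by apply Continuous.intervalIntegrable; fun_prop)
      (hG.intervalIntegrable _ _) fun t _ => hfG t
  rw [intervalIntegral.integral_add (by apply Continuous.intervalIntegrable; fun_prop)
    (hc.abs.intervalIntegrable _ _), intervalIntegral.integral_div] at h3
  refine le_trans ?_ h3
  rw [← hK]
  have : f α - K ≤ (∫ t in α..(α + δ), f t) / δ := by
    rw [le_div_iff₀ hδ]; linarith
  linarith

theorem large_sieve (a : ℕ → ℂ) (N : ℕ) (P : Finset ℝ) (δ : ℝ) (hδ : 0 < δ)
    (hP : ∀ α ∈ P, 0 ≤ α ∧ α + δ ≤ 1) (hsep : ∀ α ∈ P, ∀ β ∈ P, α < β → α + δ ≤ β) :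
    ∑ α ∈ P, ‖trig a N α‖ ^ 2 ≤ (1 / δ + 4 * Real.pi * N) * ∑ n ∈ Finset.range N, ‖a n‖ ^ 2 := by
  rcases Nat.eq_zero_or_pos N with h0 | hN
  · subst h0; simp [trig]
  have hN' : (0 : ℝ) < N := by exact_mod_cast hN
  set ε := 2 * Real.pi * N with hε
  have hε0 : 0 < ε := by positivity
  set b : ℕ → ℂ := fun n => 2 * Real.pi * I * n * a n with hb
  set G : ℝ → ℝ := fun t => (1 / δ + ε) * ‖trig a N t‖ ^ 2 + ε⁻¹ * ‖trig b N t‖ ^ 2 with hG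
  have hac := trig_cont a N
  have hbc := trig_cont b N
  have hGc : Continuous G := by fun_prop
  have hG0 : ∀ t, 0 ≤ G t := fun t => by positivity
  have h1 : ∀ α, ‖trig a N α‖ ^ 2 ≤ ∫ t in Set.Ioc α (α + δ), G t := by
    intro α
    rw [← intervalIntegral.integral_of_le (by linarith)]
    refine gallagher (fun t => ‖trig a N t‖ ^ 2) (fun t => 2 * inner ℝ (trig a N t) (trig b N t))
      (fun t => (trig_deriv a N t).norm_sq) (by fun_prop) α δ hδ G hGc ?_
    intro t
    have h2 : |inner ℝ (trig a N t) (trig b N t)| ≤ ‖trig a N t‖ * ‖trig b N t‖ :=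
      abs_real_inner_le_norm _ _
    rw [abs_mul, abs_two]
    have h3 : 2 * (‖trig a N t‖ * ‖trig b N t‖) ≤ ε * ‖trig a N t‖ ^ 2 + ε⁻¹ * ‖trig b N t‖ ^ 2 := by
      have h4 := sq_nonneg (ε * ‖trig a N t‖ - ‖trig b N t‖)
      have h5 : ε⁻¹ * (ε * ‖trig a N t‖ - ‖trig b N t‖) ^ 2 =
        ε * ‖trig a N t‖ ^ 2 + ε⁻¹ * ‖trig b N t‖ ^ 2 - 2 * (‖trig a N t‖ * ‖trig b N t‖) := by
        field_simp; ring
      have h6 : 0 ≤ ε⁻¹ * (ε * ‖trig a N t‖ - ‖trig b N t‖) ^ 2 := by positivity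
      linarith
    simp only [hG]
    have : ‖trig a N t‖ ^ 2 / δ = 1 / δ * ‖trig a N t‖ ^ 2 := by ring
    rw [this]
    linarith
  have h2 : ∑ α ∈ P, ∫ t in Set.Ioc α (α + δ), G t = ∫ t in ⋃ α ∈ P, Set.Ioc α (α + δ), G t := by
    rw [integral_biUnion_finset]
    · intro _ _; exact measurableSet_Ioc
    · intro α hα β hβ hne
      simp only [Function.onFun]
      rw [Set.Ioc_disjoint_Ioc]
      rcases lt_or_gt_of_ne hne with h | h
      · exact (min_le_left _ _).trans ((hsep α hα β hβ h).trans (le_max_right _ _))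
      · exact (min_le_right _ _).trans ((hsep β hβ α hα h).trans (le_max_left _ _))
    · intro α _
      exact (hGc.integrableOn_Icc).mono_set Set.Ioc_subset_Icc_self
  have h3 : ∫ t in ⋃ α ∈ P, Set.Ioc α (α + δ), G t ≤ ∫ t in Set.Ioc 0 1, G t := by
    apply setIntegral_mono_set
    · exact (hGc.integrableOn_Icc).mono_set Set.Ioc_subset_Icc_self
    · exact Filter.Eventually.of_forall fun t => hG0 t
    · apply Filter.Eventually.of_forall
      intro t ht
      have ht' : t ∈ ⋃ α ∈ P, Set.Ioc α (α + δ) := ht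
      simp only [Set.mem_iUnion] at ht'
      obtain ⟨α, hα, h⟩ := ht'
      have := hP α hα
      exact (⟨by linarith [h.1], by linarith [h.2]⟩ : t ∈ Set.Ioc (0 : ℝ) 1)
  have h4 : ∫ t in Set.Ioc (0 : ℝ) 1, G t = (1 / δ + ε) * ∑ n ∈ Finset.range N, ‖a n‖ ^ 2 +
      ε⁻¹ * ∑ n ∈ Finset.range N, ‖b n‖ ^ 2 := by
    rw [← intervalIntegral.integral_of_le zero_le_one, ← trig_parseval, ← trig_parseval,
      ← intervalIntegral.integral_const_mul, ← intervalIntegral.integral_const_mul,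
      ← intervalIntegral.integral_add]
    · apply Continuous.intervalIntegrable; fun_prop
    · apply Continuous.intervalIntegrable; fun_prop
  have h5 : ∑ n ∈ Finset.range N, ‖b n‖ ^ 2 ≤ ε ^ 2 * ∑ n ∈ Finset.range N, ‖a n‖ ^ 2 := by
    rw [Finset.mul_sum]
    refine Finset.sum_le_sum fun n hn => ?_
    have : ‖b n‖ = 2 * Real.pi * n * ‖a n‖ := by
      simp only [hb, norm_mul, Complex.norm_I, Complex.norm_natCast, Complex.norm_real, Real.norm_eq_abs,
        abs_of_pos Real.pi_pos, Complex.norm_ofNat, mul_one]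
    rw [this, mul_pow]
    have hn' : (n : ℝ) ≤ N := by exact_mod_cast (Finset.mem_range.1 hn).le
    rw [hε]
    gcongr
  calc ∑ α ∈ P, ‖trig a N α‖ ^ 2 ≤ ∑ α ∈ P, ∫ t in Set.Ioc α (α + δ), G t :=
        Finset.sum_le_sum fun α _ => h1 α
    _ ≤ (1 / δ + ε) * ∑ n ∈ Finset.range N, ‖a n‖ ^ 2 +
      ε⁻¹ * ∑ n ∈ Finset.range N, ‖b n‖ ^ 2 := by rw [h2, ← h4]; exact h3
    _ ≤ (1 / δ + ε) * ∑ n ∈ Finset.range N, ‖a n‖ ^ 2 +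
      ε⁻¹ * (ε ^ 2 * ∑ n ∈ Finset.range N, ‖a n‖ ^ 2) := by gcongr
    _ = _ := by rw [hε]; field_simp; ring

end PPF

namespace PPF

open MeasureTheory Complex

/-- Large sieve variance for a single modulus. -/
noncomputable def lsVar (a : ℕ → ℂ) (N q : ℕ) : ℝ :=
  (1 / q : ℝ) * ∑ b ∈ Finset.Ico 1 q, ‖trig a N ((b : ℝ) / q)‖ ^ 2

theorem finite_parseval (q : ℕ) [NeZero q] (c : ZMod q → ℂ) :
    ∑ b : ZMod q, ‖∑ h : ZMod q, c h * ZMod.stdAddChar (b * h)‖ ^ 2 = q * ∑ h, ‖c h‖ ^ 2 := by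
  have : ((∑ b : ZMod q, ‖∑ h : ZMod q, c h * ZMod.stdAddChar (b * h)‖ ^ 2 : ℝ) : ℂ) =
      ((q * ∑ h, ‖c h‖ ^ 2 : ℝ) : ℂ) := by
    have e : ∀ b : ZMod q, ((‖∑ h : ZMod q, c h * ZMod.stdAddChar (b * h)‖ ^ 2 : ℝ) : ℂ) =
        ∑ h, ∑ h', c h * (starRingEnd ℂ) (c h') * ZMod.stdAddChar (b * (h - h')) := by
      intro b
      rw [← Complex.normSq_eq_norm_sq, ← Complex.mul_conj, map_sum, Finset.sum_mul_sum]
      refine Finset.sum_congr rfl fun h _ => Finset.sum_congr rfl fun h' _ => ?_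
      rw [map_mul (starRingEnd ℂ), ← AddChar.map_neg_eq_conj, mul_mul_mul_comm, ← AddChar.map_add_eq_mul]
      congr 2
      ring
    rw [Complex.ofReal_sum]
    simp only [e]
    rw [Finset.sum_comm]
    push_cast
    rw [Finset.mul_sum]
    refine Finset.sum_congr rfl fun h _ => ?_
    rw [Finset.sum_comm]
    simp only [← Finset.mul_sum]
    simp only [AddChar.sum_mulShift _ (ZMod.isPrimitive_stdAddChar q), sub_eq_zero, ZMod.card]
    have : ∀ h' : ZMod q, ((if h = h' then q else 0 : ℕ) : ℂ) = if h = h' then (q : ℂ) else 0 := by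
      intro h'; split_ifs <;> simp
    simp only [this, mul_ite, mul_zero, Finset.sum_ite_eq, Finset.mem_univ, if_true]
    rw [Complex.mul_conj, Complex.normSq_eq_norm_sq]
    push_cast
    ring
  exact_mod_cast this

/-- Sum over a residue class. -/
noncomputable def res (a : ℕ → ℂ) (N q : ℕ) (h : ZMod q) : ℂ :=
  ∑ n ∈ Finset.range N, if (n : ZMod q) = h then a n else 0

theorem sum_res (a : ℕ → ℂ) (N q : ℕ) [NeZero q] (F : ZMod q → ℂ) :
    ∑ n ∈ Finset.range N, a n * F n = ∑ h, res a N q h * F h := by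
  unfold res
  simp only [Finset.sum_mul]
  rw [Finset.sum_comm]
  refine Finset.sum_congr rfl fun n _ => ?_
  simp [ite_mul]

theorem trig_eq_res (a : ℕ → ℂ) (N q : ℕ) [NeZero q] (b : ℕ) :
    trig a N ((b : ℝ) / q) = ∑ h, res a N q h * ZMod.stdAddChar ((b : ZMod q) * h) := by
  rw [← sum_res a N q (fun h => ZMod.stdAddChar ((b : ZMod q) * h))]
  unfold trig
  refine Finset.sum_congr rfl fun n _ => ?_
  have := ZMod.stdAddChar_coe (N := q) ((b : ℤ) * (n : ℤ))
  push_cast at this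
  rw [this]
  congr 2
  push_cast
  ring

theorem sum_Ico_zmod (q : ℕ) [NeZero q] (f : ZMod q → ℝ) :
    ∑ b ∈ Finset.Ico 1 q, f (b : ZMod q) = ∑ b ∈ (Finset.univ : Finset (ZMod q)).erase 0, f b := by
  refine Finset.sum_nbij' (fun b => (b : ZMod q)) (fun b => b.val) ?_ ?_ ?_ ?_ ?_
  · intro b hb
    rw [Finset.mem_Ico] at hb
    simp only [Finset.mem_erase, Finset.mem_univ, and_true]
    rw [Ne, ZMod.natCast_eq_zero_iff]
    intro h
    have := Nat.le_of_dvd (by omega) h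
    omega
  · intro b hb
    simp only [Finset.mem_erase, Finset.mem_univ, and_true] at hb
    rw [Finset.mem_Ico]
    exact ⟨Nat.pos_of_ne_zero (fun h => hb ((ZMod.val_eq_zero b).1 h)), ZMod.val_lt b⟩
  · intro b hb
    rw [Finset.mem_Ico] at hb
    exact ZMod.val_natCast_of_lt hb.2
  · intro b _
    simp
  · intro b _
    rfl

theorem lsVar_eq (a : ℕ → ℂ) (N q : ℕ) [NeZero q] :
    lsVar a N q = ∑ h : ZMod q, ‖res a N q h - (∑ n ∈ Finset.range N, a n) / q‖ ^ 2 := by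
  set S := ∑ n ∈ Finset.range N, a n with hS
  have hq : (q : ℂ) ≠ 0 := by exact_mod_cast NeZero.ne q
  have hq' : (q : ℝ) ≠ 0 := by exact_mod_cast NeZero.ne q
  have hp := finite_parseval q (fun h => res a N q h - S / q)
  have hSr : ∑ h, res a N q h = S := by
    have := sum_res a N q (fun _ => 1)
    simpa using this.symm
  have e : ∀ b : ZMod q, ∑ h : ZMod q, (res a N q h - S / q) * ZMod.stdAddChar (b * h) =
      if b = 0 then 0 else ∑ h : ZMod q, res a N q h * ZMod.stdAddChar (b * h) := by
    intro b
    simp only [sub_mul, Finset.sum_sub_distrib, ← Finset.mul_sum]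
    simp only [mul_comm b]
    rw [AddChar.sum_mulShift _ (ZMod.isPrimitive_stdAddChar q)]
    split_ifs with h
    · subst h
      simp [hSr, ZMod.card]
    · simp
  simp only [e] at hp
  have h1 : ∑ b : ZMod q, ‖(if b = 0 then 0 else ∑ h : ZMod q, res a N q h * ZMod.stdAddChar (b * h))‖ ^ 2 =
      ∑ b ∈ (Finset.univ : Finset (ZMod q)).erase 0,
        ‖∑ h : ZMod q, res a N q h * ZMod.stdAddChar (b * h)‖ ^ 2 := by
    rw [← Finset.add_sum_erase _ _ (Finset.mem_univ (0 : ZMod q))]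
    simp only [if_true, norm_zero]
    rw [zero_pow two_ne_zero, zero_add]
    refine Finset.sum_congr rfl fun b hb => ?_
    rw [if_neg (Finset.ne_of_mem_erase hb)]
  rw [h1] at hp
  unfold lsVar
  simp only [trig_eq_res]
  rw [sum_Ico_zmod q (fun b => ‖∑ h : ZMod q, res a N q h * ZMod.stdAddChar (b * h)‖ ^ 2), hp]
  rw [← mul_assoc, one_div, inv_mul_cancel₀ hq', one_mul]

/-- The large sieve, summed over prime moduli. -/
theorem sum_lsVar (a : ℕ → ℂ) (N : ℕ) (Qs : Finset ℕ) (Q X : ℝ) (hQ : 0 < Q)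
    (hp : ∀ q ∈ Qs, q.Prime ∧ Q ≤ q ∧ (q : ℝ) ≤ X) :
    ∑ q ∈ Qs, lsVar a N q ≤
      1 / Q * ((X ^ 2 + 4 * Real.pi * N) * ∑ n ∈ Finset.range N, ‖a n‖ ^ 2) := by
  classical
  by_cases hne : Qs = ∅
  · subst hne
    simp only [Finset.sum_empty]
    positivity
  have hX : 1 < X := by
    obtain ⟨q, hq⟩ := Finset.nonempty_iff_ne_empty.2 hne
    have h1 : (1 : ℝ) < q := by exact_mod_cast (hp q hq).1.one_lt
    linarith [(hp q hq).2.2]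
  set sg : Finset (Σ _ : ℕ, ℕ) := Qs.sigma (fun q => Finset.Ico 1 q) with hsg
  set pt : (Σ _ : ℕ, ℕ) → ℝ := fun z => (z.2 : ℝ) / z.1 with hpt
  have hmem : ∀ z ∈ sg, z.1.Prime ∧ (z.1 : ℝ) ≤ X ∧ 1 ≤ z.2 ∧ z.2 < z.1 := by
    intro z hz
    rw [hsg, Finset.mem_sigma, Finset.mem_Ico] at hz
    exact ⟨(hp _ hz.1).1, (hp _ hz.1).2.2, hz.2.1, hz.2.2⟩
  have hinv : ∀ z ∈ sg, 1 / X ≤ 1 / (z.1 : ℝ) := by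
    intro z hz
    have := hmem z hz
    exact one_div_le_one_div_of_le (by exact_mod_cast this.1.pos) this.2.1
  have hinj : Set.InjOn pt (sg : Set (Σ _ : ℕ, ℕ)) := by
    rintro ⟨q, b⟩ hz ⟨q', b'⟩ hz' h
    have h1 := hmem _ hz
    have h2 := hmem _ hz'
    simp only [hpt] at h h1 h2
    have hq0 : (q : ℝ) ≠ 0 := by exact_mod_cast h1.1.ne_zero
    have hq0' : (q' : ℝ) ≠ 0 := by exact_mod_cast h2.1.ne_zero
    rw [div_eq_div_iff hq0 hq0'] at h
    have h3 : b * q' = b' * q := by exact_mod_cast h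
    have hd : q ∣ b * q' := h3 ▸ Dvd.intro_left _ rfl
    have hnd : ¬ q ∣ b := fun hd => by
      have := Nat.le_of_dvd (by omega) hd
      omega
    have hqq : q = q' := by
      rcases (Nat.Prime.dvd_mul h1.1).1 hd with h | h
      · exact absurd h hnd
      · exact (Nat.prime_dvd_prime_iff_eq h1.1 h2.1).1 h
    subst hqq
    have := Nat.eq_of_mul_eq_mul_right h1.1.pos h3
    subst this
    rfl
  have hsep : ∀ z ∈ sg, ∀ z' ∈ sg, pt z < pt z' → pt z + 1 / X ^ 2 ≤ pt z' := by
    intro z hz z' hz' hlt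
    have h1 := hmem _ hz
    have h2 := hmem _ hz'
    have hq0 : (0 : ℝ) < z.1 := by exact_mod_cast h1.1.pos
    have hq0' : (0 : ℝ) < z'.1 := by exact_mod_cast h2.1.pos
    simp only [hpt] at hlt ⊢
    rw [div_lt_div_iff₀ hq0 hq0'] at hlt
    have h3 : z.2 * z'.1 + 1 ≤ z'.2 * z.1 := by
      have : z.2 * z'.1 < z'.2 * z.1 := by exact_mod_cast hlt
      omega
    have h4 : (z.2 : ℝ) * z'.1 + 1 ≤ z'.2 * z.1 := by exact_mod_cast h3
    have h5 : 1 / X ^ 2 ≤ 1 / ((z.1 : ℝ) * z'.1) := by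
      apply one_div_le_one_div_of_le (by positivity)
      rw [sq]
      exact mul_le_mul h1.2.1 h2.2.1 hq0'.le (by linarith)
    have h6 : (z.2 : ℝ) / z.1 + 1 / ((z.1 : ℝ) * z'.1) ≤ z'.2 / z'.1 := by
      have e : (z.2 : ℝ) / z.1 + 1 / ((z.1 : ℝ) * z'.1) = (z.2 * z'.1 + 1) / (z.1 * z'.1) := by
        field_simp
      have e2 : (z'.2 : ℝ) / z'.1 = z'.2 * z.1 / (z.1 * z'.1) := by field_simp
      rw [e, e2]
      gcongr
    linarith
  have hls := large_sieve a N (sg.image pt) (1 / X ^ 2) (by positivity)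
    (by
      intro α hα
      obtain ⟨z, hz, rfl⟩ := Finset.mem_image.1 hα
      have h1 := hmem _ hz
      have hq0 : (0 : ℝ) < z.1 := by exact_mod_cast h1.1.pos
      refine ⟨by positivity, ?_⟩
      have h2 : (z.2 : ℝ) + 1 ≤ z.1 := by exact_mod_cast h1.2.2.2
      have h3 : 1 / X ^ 2 ≤ 1 / (z.1 : ℝ) := by
        refine le_trans ?_ (hinv z hz)
        apply one_div_le_one_div_of_le (by positivity)
        nlinarith
      have h4 : (z.2 : ℝ) / z.1 + 1 / z.1 ≤ 1 := by
        rw [← add_div, div_le_one hq0]; exact h2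
      simp only [hpt]
      linarith)
    (by
      intro α hα β hβ h
      obtain ⟨z, hz, rfl⟩ := Finset.mem_image.1 hα
      obtain ⟨z', hz', rfl⟩ := Finset.mem_image.1 hβ
      exact hsep z hz z' hz' h)
  rw [Finset.sum_image hinj, hsg, Finset.sum_sigma] at hls
  have h1 : ∑ q ∈ Qs, lsVar a N q ≤
      1 / Q * ∑ q ∈ Qs, ∑ b ∈ Finset.Ico 1 q, ‖trig a N ((b : ℝ) / q)‖ ^ 2 := by
    rw [Finset.mul_sum]
    refine Finset.sum_le_sum fun q hq => ?_
    unfold lsVar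
    have := hp q hq
    gcongr
    exact this.2.1
  refine h1.trans ?_
  gcongr
  simpa using hls

/-- The balanced kernel. -/
noncomputable def kap (q n : ℕ) : ℝ :=
  (if (n : ZMod q) = 1 then 1 else 0) - (if (n : ZMod q) = 0 then 0 else 1 / ((q : ℝ) - 1))

theorem bilinear_one (q : ℕ) [Fact q.Prime] (α β : ℕ → ℂ) (M N : ℕ) (l : ℝ) (hl : 0 < l) :
    ‖∑ m ∈ Finset.range M, ∑ n ∈ Finset.range N, α m * β n * (kap q (m * n) : ℂ)‖ ≤
      l * lsVar α M q + l⁻¹ * lsVar β N q := by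
  have hq2 : (2 : ℝ) ≤ q := by exact_mod_cast (Fact.out : q.Prime).two_le
  set k : ZMod q → ℝ := fun z => (if z = 1 then 1 else 0) - (if z = 0 then 0 else 1 / ((q : ℝ) - 1)) with hk
  have hk0 : k 0 = 0 := by simp [hk]
  have hcard : ∑ z : ZMod q, (if z = 0 then 0 else 1 / ((q : ℝ) - 1)) = 1 := by
    have : ∀ z : ZMod q, (if z = 0 then 0 else 1 / ((q : ℝ) - 1)) =
        1 / ((q : ℝ) - 1) - if z = 0 then 1 / ((q : ℝ) - 1) else 0 := by
      intro z; split_ifs <;> simp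
    simp only [this, Finset.sum_sub_distrib, Finset.sum_ite_eq', Finset.mem_univ, if_true,
      Finset.sum_const, Finset.card_univ, ZMod.card, nsmul_eq_mul]
    have : (q : ℝ) - 1 ≠ 0 := by linarith
    field_simp
  have hsum : ∀ h : ZMod q, ∑ z, k (h * z) = 0 := by
    intro h
    by_cases h0 : h = 0
    · simp [h0, hk0]
    · rw [Fintype.sum_equiv (Equiv.mulLeft₀ h h0) (fun z => k (h * z)) k (fun z => by simp)]
      simp only [hk, Finset.sum_sub_distrib, hcard]
      simp
  have habs : ∀ h : ZMod q, ∑ z, |k (h * z)| ≤ 2 := by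
    intro h
    by_cases h0 : h = 0
    · simp [h0, hk0]
    · rw [Fintype.sum_equiv (Equiv.mulLeft₀ h h0) (fun z => |k (h * z)|) (fun z => |k z|)
        (fun z => by simp)]
      have : ∀ z : ZMod q, |k z| ≤ (if z = 1 then 1 else 0) + (if z = 0 then 0 else 1 / ((q : ℝ) - 1)) := by
        intro z
        refine (abs_sub _ _).trans (le_of_eq ?_)
        congr 1
        · split_ifs <;> simp
        · have : 0 ≤ 1 / ((q : ℝ) - 1) := by apply div_nonneg <;> linarith
          split_ifs
          · simp
          · exact abs_of_nonneg this
      refine (Finset.sum_le_sum fun z _ => this z).trans ?_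
      rw [Finset.sum_add_distrib, hcard]
      simp
      norm_num
  set cA := (∑ n ∈ Finset.range M, α n) / (q : ℂ)
  set cB := (∑ n ∈ Finset.range N, β n) / (q : ℂ)
  set A : ZMod q → ℂ := fun h => res α M q h - cA with hA
  set B : ZMod q → ℂ := fun h => res β N q h - cB with hB
  have e1 : ∑ m ∈ Finset.range M, ∑ n ∈ Finset.range N, α m * β n * (kap q (m * n) : ℂ) =
      ∑ h, ∑ h', A h * B h' * (k (h * h') : ℂ) := by
    have s1 : ∑ m ∈ Finset.range M, ∑ n ∈ Finset.range N, α m * β n * (kap q (m * n) : ℂ) =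
        ∑ m ∈ Finset.range M, α m * ∑ h', res β N q h' * (k (m * h') : ℂ) := by
      refine Finset.sum_congr rfl fun m _ => ?_
      rw [← sum_res β N q (fun h' => (k (m * h') : ℂ)), Finset.mul_sum]
      refine Finset.sum_congr rfl fun n _ => ?_
      rw [mul_assoc]
      congr 3
      simp only [kap, hk]
      push_cast
      rfl
    rw [s1, sum_res α M q (fun h => ∑ h', res β N q h' * (k (h * h') : ℂ))]
    have hsumC : ∀ h : ZMod q, ∑ z, (k (h * z) : ℂ) = 0 := by
      intro h; rw [← Complex.ofReal_sum, hsum h]; simp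
    have s2 : ∀ h, ∑ h', res β N q h' * (k (h * h') : ℂ) = ∑ h', B h' * (k (h * h') : ℂ) := by
      intro h
      simp only [hB, sub_mul, Finset.sum_sub_distrib, ← Finset.mul_sum, hsumC h]
      simp
    simp only [s2]
    have s3 : ∑ h, cA * ∑ h', B h' * (k (h * h') : ℂ) = 0 := by
      rw [← Finset.mul_sum, Finset.sum_comm]
      simp only [← Finset.mul_sum]
      have : ∀ h' : ZMod q, ∑ h, (k (h * h') : ℂ) = 0 := by
        intro h'; simp only [mul_comm _ h']; exact hsumC h'
      simp [this]
    have s4 : ∑ h, res α M q h * ∑ h', B h' * (k (h * h') : ℂ) =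
        ∑ h, A h * ∑ h', B h' * (k (h * h') : ℂ) := by
      simp only [hA, sub_mul, Finset.sum_sub_distrib]
      rw [s3, sub_zero]
    rw [s4]
    refine Finset.sum_congr rfl fun h _ => ?_
    rw [Finset.mul_sum]
    refine Finset.sum_congr rfl fun h' _ => ?_
    ring
  rw [e1, lsVar_eq, lsVar_eq]
  have hpt : ∀ h h' : ZMod q, ‖A h * B h' * (k (h * h') : ℂ)‖ ≤
      (l / 2 * ‖A h‖ ^ 2) * |k (h * h')| + (l⁻¹ / 2 * ‖B h'‖ ^ 2) * |k (h' * h)| := by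
    intro h h'
    rw [norm_mul, norm_mul, Complex.norm_real, Real.norm_eq_abs, mul_comm h' h, ← add_mul]
    gcongr
    have h5 : l⁻¹ / 2 * (l * ‖A h‖ - ‖B h'‖) ^ 2 =
        (l / 2 * ‖A h‖ ^ 2) + (l⁻¹ / 2 * ‖B h'‖ ^ 2) - ‖A h‖ * ‖B h'‖ := by
      field_simp; ring
    have h6 : 0 ≤ l⁻¹ / 2 * (l * ‖A h‖ - ‖B h'‖) ^ 2 := by positivity
    linarith
  have t1 : ∑ h, ∑ h', (l / 2 * ‖A h‖ ^ 2) * |k (h * h')| ≤ l * ∑ h, ‖A h‖ ^ 2 := by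
    rw [Finset.mul_sum]
    refine Finset.sum_le_sum fun h _ => ?_
    rw [← Finset.mul_sum]
    have := mul_le_mul_of_nonneg_left (habs h) (by positivity : 0 ≤ l / 2 * ‖A h‖ ^ 2)
    linarith
  have t2 : ∑ h, ∑ h', (l⁻¹ / 2 * ‖B h'‖ ^ 2) * |k (h' * h)| ≤ l⁻¹ * ∑ h, ‖B h‖ ^ 2 := by
    rw [Finset.sum_comm, Finset.mul_sum]
    refine Finset.sum_le_sum fun h _ => ?_
    rw [← Finset.mul_sum]
    have := mul_le_mul_of_nonneg_left (habs h) (by positivity : 0 ≤ l⁻¹ / 2 * ‖B h‖ ^ 2)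
    linarith
  calc _ ≤ ∑ h, ∑ h', ‖A h * B h' * (k (h * h') : ℂ)‖ :=
        (norm_sum_le _ _).trans (Finset.sum_le_sum fun h _ => norm_sum_le _ _)
    _ ≤ ∑ h, ∑ h', ((l / 2 * ‖A h‖ ^ 2) * |k (h * h')| + (l⁻¹ / 2 * ‖B h'‖ ^ 2) * |k (h' * h)|) :=
        Finset.sum_le_sum fun h _ => Finset.sum_le_sum fun h' _ => hpt h h'
    _ ≤ _ := by
        simp only [Finset.sum_add_distrib]
        exact add_le_add t1 t2

/-- The kernel with an auxiliary fixed modulus. -/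
noncomputable def kapW (W q n : ℕ) : ℝ := if (n : ZMod W) = 1 then kap q n else 0

theorem bilinear_sum (W : ℕ) [NeZero W] (α β : ℕ → ℂ) (M N : ℕ) (Qs : Finset ℕ) (Q X : ℝ)
    (hQ : 0 < Q) (hp : ∀ q ∈ Qs, q.Prime ∧ Q ≤ q ∧ (q : ℝ) ≤ X) (a0 b0 : ℝ) (ha : 0 < a0)
    (hb : 0 < b0) (hα : ∑ m ∈ Finset.range M, ‖α m‖ ^ 2 ≤ a0)
    (hβ : ∑ n ∈ Finset.range N, ‖β n‖ ^ 2 ≤ b0) (hX : 0 < X) :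
    ∑ q ∈ Qs, ‖∑ m ∈ Finset.range M, ∑ n ∈ Finset.range N, α m * β n * (kapW W q (m * n) : ℂ)‖ ≤
      2 / Q * Real.sqrt (((X ^ 2 + 4 * Real.pi * M) * a0) * ((X ^ 2 + 4 * Real.pi * N) * b0)) := by
  set Y := (X ^ 2 + 4 * Real.pi * M) * a0 with hY
  set Z := (X ^ 2 + 4 * Real.pi * N) * b0 with hZ
  have hY0 : 0 < Y := by positivity
  have hZ0 : 0 < Z := by positivity
  set l := Real.sqrt Z / Real.sqrt Y with hl
  have hsY : 0 < Real.sqrt Y := Real.sqrt_pos.2 hY0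
  have hsZ : 0 < Real.sqrt Z := Real.sqrt_pos.2 hZ0
  have hl0 : 0 < l := by positivity
  set αg : (ZMod W)ˣ → ℕ → ℂ := fun g m => if (m : ZMod W) = g then α m else 0 with hαg
  set βg : (ZMod W)ˣ → ℕ → ℂ := fun g n => if (n : ZMod W) = (g⁻¹ : (ZMod W)ˣ) then β n else 0 with hβg
  have key : ∀ q m n : ℕ, α m * β n * (kapW W q (m * n) : ℂ) =
      ∑ g, αg g m * βg g n * (kap q (m * n) : ℂ) := by
    intro q m n
    rw [← Finset.sum_mul]
    unfold kapW
    split_ifs with h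
    · congr 1
      push_cast at h
      set u : (ZMod W)ˣ := ⟨m, n, h, by rw [mul_comm]; exact h⟩ with hu
      rw [Finset.sum_eq_single u]
      · have e1 : αg u m = α m := by simp [hαg, hu]
        have e2 : βg u n = β n := by simp [hβg, hu]
        rw [e1, e2]
      · intro g _ hg
        have : (m : ZMod W) ≠ g := by
          intro h2
          apply hg
          ext
          rw [← h2]
        simp [hαg, this]
      · simp
    · have : ∑ g, αg g m * βg g n = 0 := by
        refine Finset.sum_eq_zero fun g _ => ?_
        by_cases h1 : (m : ZMod W) = g
        · by_cases h2 : (n : ZMod W) = (g⁻¹ : (ZMod W)ˣ)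
          · exfalso
            apply h
            push_cast
            rw [h1, h2]
            simp
          · simp [hβg, h2]
        · simp [hαg, h1]
      rw [this]
      simp
  have hαs : ∑ g, ∑ m ∈ Finset.range M, ‖αg g m‖ ^ 2 ≤ a0 := by
    refine le_trans ?_ hα
    rw [Finset.sum_comm]
    refine Finset.sum_le_sum fun m _ => ?_
    by_cases hu : IsUnit (m : ZMod W)
    · obtain ⟨u, hu⟩ := hu
      rw [Finset.sum_eq_single u]
      · simp [hαg, hu]
      · intro g _ hg
        have : (m : ZMod W) ≠ g := by
          intro h2; apply hg; ext; rw [← h2, hu]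
        simp [hαg, this]
      · simp
    · rw [Finset.sum_eq_zero]
      · positivity
      · intro g _
        have : (m : ZMod W) ≠ g := by
          intro h2; apply hu; rw [h2]; exact g.isUnit
        simp [hαg, this]
  have hβs : ∑ g, ∑ n ∈ Finset.range N, ‖βg g n‖ ^ 2 ≤ b0 := by
    refine le_trans ?_ hβ
    rw [Finset.sum_comm]
    refine Finset.sum_le_sum fun m _ => ?_
    by_cases hu : IsUnit (m : ZMod W)
    · obtain ⟨u, hu⟩ := hu
      rw [Finset.sum_eq_single u⁻¹]
      · simp [hβg, hu]
      · intro g _ hg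
        have : (m : ZMod W) ≠ (g⁻¹ : (ZMod W)ˣ) := by
          intro h2; apply hg
          rw [← hu] at h2
          have := Units.ext h2
          rw [this, inv_inv]
        simp [hβg, this]
      · simp
    · rw [Finset.sum_eq_zero]
      · positivity
      · intro g _
        have : (m : ZMod W) ≠ (g⁻¹ : (ZMod W)ˣ) := by
          intro h2; apply hu; rw [h2]; exact (g⁻¹).isUnit
        simp [hβg, this]
  calc _ ≤ ∑ q ∈ Qs, ∑ g, (l * lsVar (αg g) M q + l⁻¹ * lsVar (βg g) N q) := by
        refine Finset.sum_le_sum fun q hq => ?_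
        have := Fact.mk (hp q hq).1
        have e : ∑ m ∈ Finset.range M, ∑ n ∈ Finset.range N, α m * β n * (kapW W q (m * n) : ℂ) =
            ∑ g, ∑ m ∈ Finset.range M, ∑ n ∈ Finset.range N, αg g m * βg g n * (kap q (m * n) : ℂ) := by
          simp only [key]
          have s1 : ∀ m : ℕ, ∑ n ∈ Finset.range N, ∑ g, αg g m * βg g n * (kap q (m * n) : ℂ) =
              ∑ g, ∑ n ∈ Finset.range N, αg g m * βg g n * (kap q (m * n) : ℂ) :=
            fun m => Finset.sum_comm
          simp only [s1]
          exact Finset.sum_comm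
        rw [e]
        refine (norm_sum_le _ _).trans (Finset.sum_le_sum fun g _ => ?_)
        exact bilinear_one q (αg g) (βg g) M N l hl0
    _ = ∑ g, (l * ∑ q ∈ Qs, lsVar (αg g) M q + l⁻¹ * ∑ q ∈ Qs, lsVar (βg g) N q) := by
        rw [Finset.sum_comm]
        refine Finset.sum_congr rfl fun g _ => ?_
        rw [Finset.sum_add_distrib, Finset.mul_sum, Finset.mul_sum]
    _ ≤ ∑ g, (l * (1 / Q * ((X ^ 2 + 4 * Real.pi * M) * ∑ n ∈ Finset.range M, ‖αg g n‖ ^ 2)) +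
          l⁻¹ * (1 / Q * ((X ^ 2 + 4 * Real.pi * N) * ∑ n ∈ Finset.range N, ‖βg g n‖ ^ 2))) := by
        refine Finset.sum_le_sum fun g _ => ?_
        have h1 := sum_lsVar (αg g) M Qs Q X hQ hp
        have h2 := sum_lsVar (βg g) N Qs Q X hQ hp
        gcongr
    _ = l * (1 / Q * ((X ^ 2 + 4 * Real.pi * M) * ∑ g, ∑ n ∈ Finset.range M, ‖αg g n‖ ^ 2)) +
          l⁻¹ * (1 / Q * ((X ^ 2 + 4 * Real.pi * N) * ∑ g, ∑ n ∈ Finset.range N, ‖βg g n‖ ^ 2)) := by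
        rw [Finset.sum_add_distrib]
        simp only [← Finset.mul_sum]
    _ ≤ l * (1 / Q * Y) + l⁻¹ * (1 / Q * Z) := by
        rw [hY, hZ]
        gcongr
    _ = 2 / Q * Real.sqrt (Y * Z) := by
        rw [Real.sqrt_mul hY0.le, hl]
        have e1 : Y = Real.sqrt Y * Real.sqrt Y := (Real.mul_self_sqrt hY0.le).symm
        have e2 : Z = Real.sqrt Z * Real.sqrt Z := (Real.mul_self_sqrt hZ0.le).symm
        set y := Real.sqrt Y
        set z := Real.sqrt Z
        rw [e1, e2]
        field_simp
        ring

end PPF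

namespace PPF

open MeasureTheory Complex

theorem IsBump.integ0 {φ : ℝ → ℝ} {g : ℝ → ℂ} (hb : IsBump φ g) :
    Integrable (fun ξ => ‖g ξ‖) := by
  have := hb.integ 0
  simpa using this

theorem norm_cexp_real (ξ u : ℝ) : ‖cexp (2 * Real.pi * I * ξ * u)‖ = 1 := by
  have : (2 * Real.pi * I * ξ * u : ℂ) = ((2 * Real.pi * ξ * u : ℝ) : ℂ) * I := by
    push_cast; ring
  rw [this, Complex.norm_exp_ofReal_mul_I]

theorem bilinear_smooth {φ : ℝ → ℝ} {g : ℝ → ℂ} (hbump : IsBump φ g)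
    (W : ℕ) [NeZero W] (α β : ℕ → ℂ) (M N : ℕ) (Qs : Finset ℕ) (Q X : ℝ)
    (hQ : 0 < Q) (hp : ∀ q ∈ Qs, q.Prime ∧ Q ≤ q ∧ (q : ℝ) ≤ X) (a0 b0 : ℝ) (ha : 0 < a0)
    (hb : 0 < b0) (hα : ∑ m ∈ Finset.range M, ‖α m‖ ^ 2 ≤ a0)
    (hβ : ∑ n ∈ Finset.range N, ‖β n‖ ^ 2 ≤ b0) (hX : 0 < X) (hα0 : α 0 = 0) (hβ0 : β 0 = 0)
    (L : ℝ) :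
    ∑ q ∈ Qs, ‖∑ m ∈ Finset.range M, ∑ n ∈ Finset.range N,
        α m * β n * (φ (Real.log ((m * n : ℕ) : ℝ) - L) : ℂ) * (kapW W q (m * n) : ℂ)‖ ≤
      (∫ ξ, ‖g ξ‖) *
      (2 / Q * Real.sqrt (((X ^ 2 + 4 * Real.pi * M) * a0) * ((X ^ 2 + 4 * Real.pi * N) * b0))) := by
  set E := 2 / Q * Real.sqrt (((X ^ 2 + 4 * Real.pi * M) * a0) * ((X ^ 2 + 4 * Real.pi * N) * b0))
    with hE
  set e : ℝ → ℝ → ℂ := fun ξ u => cexp (2 * Real.pi * I * ξ * u) with he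
  have hee : ∀ ξ u, ‖e ξ u‖ = 1 := norm_cexp_real
  have hadd : ∀ ξ u v, e ξ (u + v) = e ξ u * e ξ v := by
    intro ξ u v
    simp only [he]
    rw [← Complex.exp_add]
    congr 1
    push_cast
    ring
  have hec : ∀ u, Continuous (fun ξ => e ξ u) := by
    intro u
    simp only [he]
    fun_prop
  have hg : AEStronglyMeasurable g := by
    by_contra hcon
    have h0 := hbump.inv 0
    have h1 : (∫ ξ : ℝ, g ξ * cexp (2 * Real.pi * I * ξ * (0 : ℝ))) = 0 := by
      simp only [ofReal_zero, mul_zero, Complex.exp_zero, mul_one]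
      exact integral_non_aestronglyMeasurable hcon
    rw [h1, hbump.eq_one 0 (by simp)] at h0
    simp at h0
  have hgi : Integrable g := (integrable_norm_iff hg).1 hbump.integ0
  have hintegr : ∀ u, Integrable (fun ξ => g ξ * e ξ u) := by
    intro u
    exact hgi.mul_bdd (hec u).aestronglyMeasurable (Filter.Eventually.of_forall fun ξ => (hee ξ u).le)
  set Bl : ℕ → ℝ → ℂ := fun q ξ => ∑ m ∈ Finset.range M, ∑ n ∈ Finset.range N,
    (α m * e ξ (Real.log m)) * (β n * e ξ (Real.log n)) * (kapW W q (m * n) : ℂ) with hBl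
  have key : ∀ q, ∑ m ∈ Finset.range M, ∑ n ∈ Finset.range N,
        α m * β n * (φ (Real.log ((m * n : ℕ) : ℝ) - L) : ℂ) * (kapW W q (m * n) : ℂ) =
      ∫ ξ, g ξ * e ξ (-L) * Bl q ξ := by
    intro q
    have e1 : ∀ ξ, g ξ * e ξ (-L) * Bl q ξ = ∑ m ∈ Finset.range M, ∑ n ∈ Finset.range N,
        (α m * β n * (kapW W q (m * n) : ℂ)) * (g ξ * e ξ (Real.log m + Real.log n + -L)) := by
      intro ξ
      simp only [hBl, Finset.mul_sum]
      refine Finset.sum_congr rfl fun m _ => Finset.sum_congr rfl fun n _ => ?_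
      rw [hadd, hadd]
      ring
    simp only [e1]
    rw [integral_finsetSum _ (fun m _ => integrable_finsetSum _ fun n _ => (hintegr _).const_mul _)]
    refine Finset.sum_congr rfl fun m _ => ?_
    rw [integral_finsetSum _ (fun n _ => (hintegr _).const_mul _)]
    refine Finset.sum_congr rfl fun n _ => ?_
    rw [integral_const_mul]
    by_cases hm : m = 0
    · simp [hm, hα0]
    by_cases hn : n = 0
    · simp [hn, hβ0]
    have hlog : Real.log ((m * n : ℕ) : ℝ) - L = Real.log m + Real.log n + -L := by
      push_cast
      rw [Real.log_mul (by exact_mod_cast hm) (by exact_mod_cast hn)]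
      ring
    rw [hlog, hbump.inv]
    simp only [he]
    ring
  have hBlc : ∀ q, Continuous (Bl q) := by
    intro q
    simp only [hBl, he]
    fun_prop
  have hBb : ∀ ξ, ∑ q ∈ Qs, ‖Bl q ξ‖ ≤ E := by
    intro ξ
    refine bilinear_sum W (fun m => α m * e ξ (Real.log m)) (fun n => β n * e ξ (Real.log n)) M N Qs Q X
      hQ hp a0 b0 ha hb ?_ ?_ hX
    · simpa [hee] using hα
    · simpa [hee] using hβ
  have hBi : ∀ q ∈ Qs, Integrable (fun ξ => ‖g ξ‖ * ‖Bl q ξ‖) := by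
    intro q hq
    refine hbump.integ0.mul_bdd (c := E) (hBlc q).norm.aestronglyMeasurable
      (Filter.Eventually.of_forall fun ξ => ?_)
    rw [norm_norm]
    refine le_trans ?_ (hBb ξ)
    exact Finset.single_le_sum (f := fun q => ‖Bl q ξ‖) (fun q _ => norm_nonneg _) hq
  calc _ = ∑ q ∈ Qs, ‖∫ ξ, g ξ * e ξ (-L) * Bl q ξ‖ := by simp only [key]
    _ ≤ ∑ q ∈ Qs, ∫ ξ, ‖g ξ‖ * ‖Bl q ξ‖ := by
        refine Finset.sum_le_sum fun q _ => ?_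
        refine (norm_integral_le_integral_norm _).trans (le_of_eq ?_)
        congr 1
        ext ξ
        rw [norm_mul, norm_mul, hee, mul_one]
    _ = ∫ ξ, ∑ q ∈ Qs, ‖g ξ‖ * ‖Bl q ξ‖ := (integral_finsetSum _ hBi).symm
    _ ≤ ∫ ξ, ‖g ξ‖ * E := by
        refine integral_mono (integrable_finsetSum _ hBi) (hbump.integ0.mul_const _) fun ξ => ?_
        simp only [← Finset.mul_sum]
        exact mul_le_mul_of_nonneg_left (hBb ξ) (norm_nonneg _)
    _ = _ := integral_mul_const _ _

theorem card_mul_le (N k : ℕ) (hk : 1 ≤ k) :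
    (((Finset.Ico 1 N).filter (fun n => k ∣ n)).card : ℝ) ≤ N / k := by
  have h : ((Finset.Ico 1 N).filter (fun n => k ∣ n)).card ≤ N / k := by
    rw [← Nat.card_multiples N k]
    refine (Finset.card_le_card_of_injOn (fun n => n - 1) ?_ ?_)
    · intro n hn
      simp only [Finset.coe_filter, Finset.mem_Ico, Set.mem_ofPred_eq, Finset.mem_range] at hn ⊢
      refine ⟨by omega, ?_⟩
      rw [Nat.sub_add_cancel hn.1.1]
      exact hn.2
    · intro n hn n' hn' h
      simp only [Finset.coe_filter, Finset.mem_Ico, Set.mem_ofPred_eq] at hn hn' h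
      omega
  calc _ ≤ ((N / k : ℕ) : ℝ) := by exact_mod_cast h
    _ ≤ _ := Nat.cast_div_le

theorem harm_le (N : ℕ) (hN : 1 ≤ N) : ∑ d ∈ Finset.Ico 1 N, (1 / d : ℝ) ≤ 1 + Real.log N := by
  have h := harmonic_le_one_add_log N
  refine le_trans ?_ h
  rw [harmonic_eq_sum_Icc]
  push_cast
  simp only [one_div]
  refine Finset.sum_le_sum_of_subset_of_nonneg ?_ (fun _ _ _ => by positivity)
  intro d hd
  simp only [Finset.mem_Ico, Finset.mem_Icc] at hd ⊢
  omega

theorem sum_divisors_sq (N : ℕ) (hN : 1 ≤ N) :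
    ∑ n ∈ Finset.Ico 1 N, ((n.divisors.card : ℝ)) ^ 2 ≤ N * (1 + Real.log N) ^ 3 := by
  set I := Finset.Ico 1 N with hI
  have h1 : ∀ n ∈ I, n.divisors.card ^ 2 ≤
      ∑ z ∈ I ×ˢ I ×ˢ I, if z.1 * z.2.1 * z.2.2 ∣ n then 1 else 0 := by
    intro n hn
    rw [hI, Finset.mem_Ico] at hn
    rw [← Finset.card_filter, sq, ← Finset.card_product]
    refine Finset.card_le_card_of_injOn
      (fun z => (Nat.gcd z.1 z.2, z.1 / Nat.gcd z.1 z.2, z.2 / Nat.gcd z.1 z.2)) ?_ ?_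
    · rintro ⟨d, e⟩ hz
      simp only [Finset.coe_product, Set.mem_prod, Finset.mem_coe, Nat.mem_divisors] at hz
      obtain ⟨⟨hd, hn0⟩, ⟨he, -⟩⟩ := hz
      have hd0 : 0 < d := Nat.pos_of_dvd_of_pos hd (by omega)
      have he0 : 0 < e := Nat.pos_of_dvd_of_pos he (by omega)
      have hg0 : 0 < Nat.gcd d e := Nat.gcd_pos_of_pos_left _ hd0
      have hdn := Nat.le_of_dvd (by omega) hd
      have hen := Nat.le_of_dvd (by omega) he
      have hgd := Nat.gcd_le_left e hd0
      have h1 : 0 < d / Nat.gcd d e := Nat.div_pos hgd hg0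
      have h2 : 0 < e / Nat.gcd d e := Nat.div_pos (Nat.gcd_le_right d he0) hg0
      have h3 := Nat.div_le_self d (Nat.gcd d e)
      have h4 := Nat.div_le_self e (Nat.gcd d e)
      simp only [Finset.coe_filter, Finset.mem_product, hI, Finset.mem_Ico, Set.mem_ofPred_eq]
      refine ⟨⟨by omega, by omega, by omega⟩, ?_⟩
      rw [Nat.mul_div_cancel' (Nat.gcd_dvd_left d e), ← Nat.mul_div_assoc _ (Nat.gcd_dvd_right d e)]
      exact Nat.lcm_dvd hd he
    · rintro ⟨d, e⟩ _ ⟨d', e'⟩ _ h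
      simp only [Prod.mk.injEq] at h
      obtain ⟨h1, h2, h3⟩ := h
      have a1 := Nat.mul_div_cancel' (Nat.gcd_dvd_left d e)
      have a2 := Nat.mul_div_cancel' (Nat.gcd_dvd_right d e)
      have b1 := Nat.mul_div_cancel' (Nat.gcd_dvd_left d' e')
      have b2 := Nat.mul_div_cancel' (Nat.gcd_dvd_right d' e')
      rw [h2, h1, b1] at a1
      rw [h3, h1, b2] at a2
      rw [a1, a2]
  have h2 : ∑ n ∈ I, ((n.divisors.card : ℝ)) ^ 2 ≤
      ∑ z ∈ I ×ˢ I ×ˢ I, (N : ℝ) / ((z.1 * z.2.1 * z.2.2 : ℕ) : ℝ) := by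
    calc _ ≤ ∑ n ∈ I, ∑ z ∈ I ×ˢ I ×ˢ I, (if z.1 * z.2.1 * z.2.2 ∣ n then (1 : ℝ) else 0) := by
          refine Finset.sum_le_sum fun n hn => ?_
          have := h1 n hn
          have h' : ((n.divisors.card ^ 2 : ℕ) : ℝ) ≤
            ((∑ z ∈ I ×ˢ I ×ˢ I, if z.1 * z.2.1 * z.2.2 ∣ n then 1 else 0 : ℕ) : ℝ) := by
            exact_mod_cast this
          push_cast at h'
          exact h'
      _ = ∑ z ∈ I ×ˢ I ×ˢ I, ((I.filter (fun n => z.1 * z.2.1 * z.2.2 ∣ n)).card : ℝ) := by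
          rw [Finset.sum_comm]
          refine Finset.sum_congr rfl fun z _ => ?_
          rw [Finset.card_filter]
          push_cast
          rfl
      _ ≤ _ := by
          refine Finset.sum_le_sum fun z hz => ?_
          simp only [Finset.mem_product, hI, Finset.mem_Ico] at hz
          exact card_mul_le N _ (Nat.mul_pos (Nat.mul_pos hz.1.1 hz.2.1.1) hz.2.2.1)
  refine h2.trans ?_
  have h3 : ∑ z ∈ I ×ˢ I ×ˢ I, (N : ℝ) / ((z.1 * z.2.1 * z.2.2 : ℕ) : ℝ) =
      N * (∑ d ∈ I, (1 / d : ℝ)) ^ 3 := by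
    rw [Finset.sum_product]
    simp only [Finset.sum_product]
    rw [pow_succ, sq, Finset.sum_mul_sum, Finset.sum_mul_sum, Finset.mul_sum]
    refine Finset.sum_congr rfl fun a _ => ?_
    rw [Finset.mul_sum, Finset.sum_comm]
    refine Finset.sum_congr rfl fun b _ => ?_
    rw [Finset.sum_mul, Finset.mul_sum]
    refine Finset.sum_congr rfl fun c _ => ?_
    push_cast
    ring
  rw [h3]
  have h4 := harm_le N hN
  have h5 : 0 ≤ ∑ d ∈ I, (1 / d : ℝ) := Finset.sum_nonneg fun _ _ => by positivity
  gcongr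

end PPF

namespace PPF

theorem count_bd (r v N : ℕ) (hr : 0 < r) :
    |(((Finset.range N).filter (fun n => n ≡ v [MOD r])).card : ℝ) - N / r| ≤ 1 := by
  rw [← Nat.count_eq_card_filter_range, Nat.count_modEq_card N hr v]
  have hr' : (0 : ℝ) < r := by exact_mod_cast hr
  have h1 : ((N / r : ℕ) : ℝ) ≤ N / r := Nat.cast_div_le
  have h2 : (N : ℝ) / r < ((N / r : ℕ) : ℝ) + 1 := by
    rw [div_lt_iff₀ hr']
    have := Nat.lt_div_mul_add hr (a := N)
    have h3 : N < (N / r + 1) * r := by nlinarith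
    exact_mod_cast h3
  rw [abs_le]
  push_cast
  split_ifs <;> constructor <;> simp <;> linarith

theorem exists_inv_class (r m : ℕ) (hr : 0 < r) (h : Nat.Coprime m r) :
    ∃ v, m * v ≡ 1 [MOD r] ∧ ∀ n, m * n ≡ 1 [MOD r] ↔ n ≡ v [MOD r] := by
  have hex : ∃ v, m * v ≡ 1 [MOD r] := by
    rcases Nat.lt_or_ge 1 r with h1 | h1
    · obtain ⟨v, -, hv⟩ := Nat.exists_mul_mod_eq_one_of_coprime h h1
      exact ⟨v, by rw [Nat.ModEq, hv, Nat.mod_eq_of_lt h1]⟩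
    · have : r = 1 := by omega
      subst this
      exact ⟨0, Nat.modEq_one⟩
  obtain ⟨v, hv⟩ := hex
  refine ⟨v, hv, fun n => ⟨fun hn => ?_, fun hn => (hn.mul_left m).trans hv⟩⟩
  exact Nat.ModEq.cancel_left_of_coprime (Nat.coprime_comm.1 h) (hn.trans hv.symm)

theorem kapW_sum_bd (W q m N : ℕ) (hW : 0 < W) (hq : q.Prime) (hc : Nat.Coprime W q) :
    |∑ n ∈ Finset.range N, kapW W q (m * n)| ≤ 3 := by
  by_cases hmW : Nat.Coprime m W
  swap
  · have : ∀ n, kapW W q (m * n) = 0 := by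
      intro n
      unfold kapW
      rw [if_neg]
      intro h
      apply hmW
      have h2 : ((m * n : ℕ) : ZMod W) = ((1 : ℕ) : ZMod W) := by rw [h]; simp
      rw [ZMod.natCast_eq_natCast_iff] at h2
      have h3 : Nat.Coprime (m * n) W := by
        rw [Nat.coprime_iff_gcd_eq_one, h2.gcd_eq]; simp
      exact Nat.Coprime.coprime_mul_right h3
    simp [this]
  by_cases hmq : q ∣ m
  · have : ∀ n, kapW W q (m * n) = 0 := by
      intro n
      have h0 : ((m * n : ℕ) : ZMod q) = 0 := by
        rw [ZMod.natCast_eq_zero_iff]; exact Dvd.dvd.mul_right hmq n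
      have := Fact.mk hq
      unfold kapW kap
      rw [h0]
      simp
    simp [this]
  have hmq' : Nat.Coprime m q := ((Nat.Prime.coprime_iff_not_dvd hq).2 hmq).symm
  have hmWq : Nat.Coprime m (W * q) := Nat.Coprime.mul_right hmW hmq'
  obtain ⟨v1, -, hv1⟩ := exists_inv_class W m hW hmW
  obtain ⟨v2, -, hv2⟩ := exists_inv_class (W * q) m (Nat.mul_pos hW hq.pos) hmWq
  obtain ⟨v3, hv3a, hv3b⟩ := Nat.chineseRemainder hc v1 0
  have hq2 : (2 : ℝ) ≤ q := by exact_mod_cast hq.two_le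
  have hpt : ∀ n, kapW W q (m * n) = (if n ≡ v2 [MOD W * q] then 1 else 0)
      - 1 / ((q : ℝ) - 1) * ((if n ≡ v1 [MOD W] then 1 else 0) -
        (if n ≡ v3 [MOD W * q] then 1 else 0)) := by
    intro n
    have e1 : ((m * n : ℕ) : ZMod W) = 1 ↔ n ≡ v1 [MOD W] := by
      rw [← hv1, ← ZMod.natCast_eq_natCast_iff]; simp
    have e2 : (((m * n : ℕ) : ZMod W) = 1 ∧ ((m * n : ℕ) : ZMod q) = 1) ↔ n ≡ v2 [MOD W * q] := by
      rw [← hv2, ← Nat.modEq_and_modEq_iff_modEq_mul hc, ← ZMod.natCast_eq_natCast_iff,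
        ← ZMod.natCast_eq_natCast_iff]; simp
    have e3 : (((m * n : ℕ) : ZMod W) = 1 ∧ ((m * n : ℕ) : ZMod q) = 0) ↔ n ≡ v3 [MOD W * q] := by
      rw [e1, ZMod.natCast_eq_zero_iff, ← Nat.modEq_and_modEq_iff_modEq_mul hc, hmq'.symm.dvd_mul_left,
        ← Nat.modEq_zero_iff_dvd]
      exact ⟨fun h => ⟨h.1.trans hv3a.symm, h.2.trans hv3b.symm⟩,
        fun h => ⟨h.1.trans hv3a, h.2.trans hv3b⟩⟩
    unfold kapW kap
    by_cases h1 : ((m * n : ℕ) : ZMod W) = 1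
    · by_cases h2 : ((m * n : ℕ) : ZMod q) = 0
      · have h3 : ¬ ((m * n : ℕ) : ZMod q) = 1 := by
          have := Fact.mk hq
          rw [h2]; exact zero_ne_one
        have a1 := e1.1 h1
        have a2 : ¬ n ≡ v2 [MOD W * q] := fun h => h3 (e2.2 h).2
        have a3 := e3.1 ⟨h1, h2⟩
        rw [if_pos h1, if_neg h3, if_pos h2, if_neg a2, if_pos a1, if_pos a3]
        ring
      · have a1 := e1.1 h1
        have a3 : ¬ n ≡ v3 [MOD W * q] := fun h => h2 (e3.2 h).2
        by_cases h3 : ((m * n : ℕ) : ZMod q) = 1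
        · have a2 := e2.1 ⟨h1, h3⟩
          rw [if_pos h1, if_pos h3, if_neg h2, if_pos a2, if_pos a1, if_neg a3]
          ring
        · have a2 : ¬ n ≡ v2 [MOD W * q] := fun h => h3 (e2.2 h).2
          rw [if_pos h1, if_neg h3, if_neg h2, if_neg a2, if_pos a1, if_neg a3]
          ring
    · have a1 : ¬ n ≡ v1 [MOD W] := fun h => h1 (e1.2 h)
      have a2 : ¬ n ≡ v2 [MOD W * q] := fun h => h1 (e2.2 h).1
      have a3 : ¬ n ≡ v3 [MOD W * q] := fun h => h1 (e3.2 h).1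
      rw [if_neg h1, if_neg a1, if_neg a2, if_neg a3]
      ring
  have hcf : ∀ r v : ℕ, ∑ n ∈ Finset.range N, (if n ≡ v [MOD r] then (1 : ℝ) else 0) =
      (((Finset.range N).filter (fun n => n ≡ v [MOD r])).card : ℝ) := by
    intro r v
    rw [Finset.card_filter]; push_cast; rfl
  simp only [hpt, Finset.sum_sub_distrib, ← Finset.mul_sum, hcf]
  have b1 := count_bd W v1 N hW
  have b2 := count_bd (W * q) v2 N (Nat.mul_pos hW hq.pos)
  have b3 := count_bd (W * q) v3 N (Nat.mul_pos hW hq.pos)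
  set c1 := (((Finset.range N).filter (fun n => n ≡ v1 [MOD W])).card : ℝ)
  set c2 := (((Finset.range N).filter (fun n => n ≡ v2 [MOD W * q])).card : ℝ)
  set c3 := (((Finset.range N).filter (fun n => n ≡ v3 [MOD W * q])).card : ℝ)
  have hW' : (0 : ℝ) < W := by exact_mod_cast hW
  have hq1 : (0 : ℝ) < (q : ℝ) - 1 := by linarith
  have e : c2 - 1 / ((q : ℝ) - 1) * (c1 - c3) = (c2 - N / ((W * q : ℕ) : ℝ))
      - 1 / ((q : ℝ) - 1) * ((c1 - N / W) - (c3 - N / ((W * q : ℕ) : ℝ))) := by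
    push_cast
    field_simp
    ring
  rw [e]
  have h3 : 1 / ((q : ℝ) - 1) ≤ 1 := by rw [div_le_one hq1]; linarith
  have h4 : |(c1 - N / W) - (c3 - N / ((W * q : ℕ) : ℝ))| ≤ 2 := by
    refine (abs_sub _ _).trans ?_; linarith
  refine (abs_sub _ _).trans ?_
  rw [abs_mul, abs_of_pos (by positivity : 0 < 1 / ((q : ℝ) - 1))]
  have h5 : 1 / ((q : ℝ) - 1) * |(c1 - N / W) - (c3 - N / ((W * q : ℕ) : ℝ))| ≤ 1 * 2 := by
    gcongr
  linarith

theorem abel_bd (f s : ℕ → ℝ) (K : ℝ) (hs : ∀ k, |∑ n ∈ Finset.range k, s n| ≤ K) (N : ℕ) :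
    |∑ n ∈ Finset.range N, f n * s n| ≤
      K * (|f N| + ∑ n ∈ Finset.range N, |f (n + 1) - f n|) := by
  have e : ∑ n ∈ Finset.range N, f n * s n = f N * ∑ n ∈ Finset.range N, s n -
      ∑ n ∈ Finset.range N, (f (n + 1) - f n) * ∑ k ∈ Finset.range (n + 1), s k := by
    induction N with
    | zero => simp
    | succ N ih =>
      rw [Finset.sum_range_succ, ih, Finset.sum_range_succ _ N, Finset.sum_range_succ _ N]
      simp only [Finset.sum_range_succ]
      ring
  rw [e, mul_add, Finset.mul_sum (f := fun n => |f (n + 1) - f n|)]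
  refine (abs_sub _ _).trans (add_le_add ?_ ?_)
  · rw [abs_mul, mul_comm]
    exact mul_le_mul_of_nonneg_right (hs N) (abs_nonneg _)
  · refine (Finset.abs_sum_le_sum_abs _ _).trans (Finset.sum_le_sum fun n _ => ?_)
    rw [abs_mul, mul_comm]
    exact mul_le_mul_of_nonneg_right (hs _) (abs_nonneg _)

theorem typeI_bd {φ : ℝ → ℝ} {g : ℝ → ℂ} (hb : IsBump φ g) :
    ∃ K : ℝ, 0 < K ∧ ∀ (W q m N : ℕ) (L : ℝ), 0 < W → q.Prime → Nat.Coprime W q → 0 < m → 1 ≤ N →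
      |∑ n ∈ Finset.range N, φ (Real.log ((m * n : ℕ) : ℝ) - L) * kapW W q (m * n)| ≤
        K * (1 + Real.log N) ^ 2 ∧
      |∑ n ∈ Finset.range N, (Real.log n * φ (Real.log ((m * n : ℕ) : ℝ) - L)) * kapW W q (m * n)| ≤
        K * (1 + Real.log N) ^ 2 := by
  obtain ⟨C, hC0, hC⟩ := hb.lip
  refine ⟨9 * (1 + C), by positivity, ?_⟩
  intro W q m N L hW hq hc hm hN
  have hs := fun k => kapW_sum_bd W q m k hW hq hc
  set f : ℕ → ℝ := fun n => φ (Real.log ((m * n : ℕ) : ℝ) - L) with hf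
  have hl0 : 0 ≤ Real.log N := Real.log_natCast_nonneg N
  have hlmono : ∀ n : ℕ, Real.log n ≤ Real.log ((n + 1 : ℕ) : ℝ) := by
    intro n
    rcases Nat.eq_zero_or_pos n with rfl | h
    · simp
    · exact Real.log_le_log (by exact_mod_cast h) (by push_cast; linarith)
  have hf1 : ∀ n, |f n| ≤ 1 := fun n => by
    rw [abs_of_nonneg (hb.nonneg _)]; exact hb.le_one _
  have hfd : ∀ n, |f (n + 1) - f n| ≤ (if n = 0 then 1 else 0) +
      C * (Real.log ((n + 1 : ℕ) : ℝ) - Real.log n) := by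
    intro n
    rcases Nat.eq_zero_or_pos n with rfl | h
    · simp only [if_true]
      have h0 := hb.nonneg (Real.log ((m * (0 + 1) : ℕ) : ℝ) - L)
      have h1 := hb.le_one (Real.log ((m * (0 + 1) : ℕ) : ℝ) - L)
      have h2 := hb.nonneg (Real.log ((m * 0 : ℕ) : ℝ) - L)
      have h3 := hb.le_one (Real.log ((m * 0 : ℕ) : ℝ) - L)
      have : |f (0 + 1) - f 0| ≤ 1 := by
        rw [abs_le]; simp only [hf]; constructor <;> linarith
      simpa using this
    · rw [if_neg (by omega), zero_add]
      have hm' : (m : ℝ) ≠ 0 := by exact_mod_cast hm.ne'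
      have hn' : (n : ℝ) ≠ 0 := by exact_mod_cast h.ne'
      have hn'' : ((n + 1 : ℕ) : ℝ) ≠ 0 := by exact_mod_cast (Nat.succ_ne_zero n)
      refine (hC _ _).trans (le_of_eq ?_)
      congr 1
      rw [Nat.cast_mul, Nat.cast_mul, Real.log_mul hm' hn', Real.log_mul hm' hn'']
      rw [show Real.log m + Real.log ((n + 1 : ℕ) : ℝ) - L - (Real.log m + Real.log n - L) =
        Real.log ((n + 1 : ℕ) : ℝ) - Real.log n by ring]
      exact abs_of_nonneg (by linarith [hlmono n])
  have htel : ∑ n ∈ Finset.range N, (Real.log ((n + 1 : ℕ) : ℝ) - Real.log n) = Real.log N := by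
    rw [Finset.sum_range_sub (fun n : ℕ => Real.log n)]; simp
  have htv : ∑ n ∈ Finset.range N, |f (n + 1) - f n| ≤ 1 + C * Real.log N := by
    refine (Finset.sum_le_sum fun n _ => hfd n).trans ?_
    rw [Finset.sum_add_distrib, ← Finset.mul_sum, htel]
    gcongr
    rw [Finset.sum_ite_eq']
    split_ifs <;> simp
  have htv2 : ∑ n ∈ Finset.range N, |Real.log ((n + 1 : ℕ) : ℝ) * f (n + 1) - Real.log n * f n| ≤
      Real.log N * (1 + C * Real.log N) + Real.log N := by
    calc _ ≤ ∑ n ∈ Finset.range N, (Real.log N * |f (n + 1) - f n| +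
          (Real.log ((n + 1 : ℕ) : ℝ) - Real.log n)) := by
          refine Finset.sum_le_sum fun n hn => ?_
          have e : Real.log ((n + 1 : ℕ) : ℝ) * f (n + 1) - Real.log n * f n =
            Real.log ((n + 1 : ℕ) : ℝ) * (f (n + 1) - f n) +
            (Real.log ((n + 1 : ℕ) : ℝ) - Real.log n) * f n := by ring
          rw [e]
          refine (abs_add_le _ _).trans (add_le_add ?_ ?_)
          · rw [abs_mul, abs_of_nonneg (Real.log_natCast_nonneg _)]
            gcongr
            have := Finset.mem_range.1 hn
            omega
          · rw [abs_mul, abs_of_nonneg (by linarith [hlmono n])]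
            exact mul_le_of_le_one_right (by linarith [hlmono n]) (hf1 n)
      _ ≤ _ := by
          rw [Finset.sum_add_distrib, ← Finset.mul_sum, htel]
          gcongr
  constructor
  · refine (abel_bd f (fun n => kapW W q (m * n)) 3 hs N).trans ?_
    have h1 := hf1 N
    nlinarith [mul_nonneg hC0 hl0, mul_nonneg hC0 (sq_nonneg (Real.log N)), sq_nonneg (Real.log N)]
  · refine (abel_bd (fun n => Real.log n * f n) (fun n => kapW W q (m * n)) 3 hs N).trans ?_
    have h1 : |Real.log N * f N| ≤ Real.log N := by
      rw [abs_mul, abs_of_nonneg hl0]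
      exact mul_le_of_le_one_right hl0 (hf1 N)
    nlinarith [mul_nonneg hC0 hl0, mul_nonneg hC0 (sq_nonneg (Real.log N)), sq_nonneg (Real.log N)]

end PPF

namespace PPF

open ArithmeticFunction

theorem conv_sum (f g : ArithmeticFunction ℝ) (F : ℕ → ℝ) (N : ℕ) (hF : ∀ n, N ≤ n → F n = 0) :
    ∑ n ∈ Finset.range N, (f * g) n * F n =
      ∑ m ∈ Finset.range N, ∑ n ∈ Finset.range N, f m * g n * F (m * n) := by
  have h1 : ∀ m n, f m * g n * F (m * n) =
      ∑ k ∈ Finset.range N, if m * n = k then f m * g n * F k else 0 := by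
    intro m n
    rw [Finset.sum_ite_eq]
    split_ifs with h
    · rfl
    · rw [hF _ (by simpa using h), mul_zero]
  have h2 : ∑ m ∈ Finset.range N, ∑ n ∈ Finset.range N, f m * g n * F (m * n) =
      ∑ k ∈ Finset.range N, ∑ z ∈ Finset.range N ×ˢ Finset.range N,
        if z.1 * z.2 = k then f z.1 * g z.2 * F k else 0 := by
    rw [Finset.sum_comm (s := Finset.range N) (t := Finset.range N ×ˢ Finset.range N),
      Finset.sum_product]
    refine Finset.sum_congr rfl fun m _ => Finset.sum_congr rfl fun n _ => ?_
    exact h1 m n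
  rw [h2]
  refine Finset.sum_congr rfl fun k hk => ?_
  rw [Finset.mem_range] at hk
  rw [← Finset.sum_filter, ArithmeticFunction.mul_apply, Finset.sum_mul]
  rcases Nat.eq_zero_or_pos k with rfl | hk0
  · symm
    simp only [Nat.divisorsAntidiagonal_zero, Finset.sum_empty]
    refine Finset.sum_eq_zero fun z hz => ?_
    rw [Finset.mem_filter] at hz
    rcases Nat.mul_eq_zero.1 hz.2 with h | h <;> simp [h]
  · refine Finset.sum_congr ?_ fun _ _ => rfl
    ext ⟨d, e⟩
    simp only [Nat.mem_divisorsAntidiagonal, Finset.mem_filter, Finset.mem_product, Finset.mem_range]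
    constructor
    · rintro ⟨rfl, h⟩
      have hd : 0 < d := Nat.pos_of_mul_pos_right hk0
      have he : 0 < e := Nat.pos_of_mul_pos_left hk0
      refine ⟨⟨?_, ?_⟩, rfl⟩ <;> nlinarith
    · rintro ⟨-, h⟩
      exact ⟨h, by omega⟩

/-- Truncation of an arithmetic function. -/
noncomputable def trunc (f : ArithmeticFunction ℝ) (U : ℕ) : ArithmeticFunction ℝ :=
  ⟨fun n => if n ≤ U then f n else 0, by simp⟩

theorem trunc_apply (f : ArithmeticFunction ℝ) (U n : ℕ) :
    trunc f U n = if n ≤ U then f n else 0 := rfl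

/-- truncated Moebius -/
noncomputable def muT (U : ℕ) : ArithmeticFunction ℝ := trunc (moebius : ArithmeticFunction ℝ) U

/-- the Vaughan cofactor -/
noncomputable def cof (U : ℕ) : ArithmeticFunction ℝ := 1 - muT U * (zeta : ArithmeticFunction ℝ)

theorem vaughan (U : ℕ) :
    vonMangoldt = muT U * log + trunc vonMangoldt U
      - trunc vonMangoldt U * muT U * (zeta : ArithmeticFunction ℝ)
      + (vonMangoldt - trunc vonMangoldt U) * cof U := by
  rw [← vonMangoldt_mul_zeta, cof]
  ring

theorem muT_abs (U n : ℕ) : |muT U n| ≤ 1 := by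
  unfold muT
  rw [trunc_apply]
  split_ifs
  · rw [intCoe_apply]
    have := abs_moebius_le_one (n := n)
    exact_mod_cast this
  · simp

theorem cof_eq_zero (U n : ℕ) (hn : n ≤ U) : cof U n = 0 := by
  rcases Nat.eq_zero_or_pos n with rfl | h0
  · simp
  have h1 : (muT U * (zeta : ArithmeticFunction ℝ)) n =
      ((moebius : ArithmeticFunction ℝ) * (zeta : ArithmeticFunction ℝ)) n := by
    rw [coe_mul_zeta_apply, coe_mul_zeta_apply]
    refine Finset.sum_congr rfl fun d hd => ?_
    unfold muT
    rw [trunc_apply, if_pos]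
    exact (Nat.divisor_le hd).trans hn
  rw [coe_moebius_mul_coe_zeta] at h1
  have : cof U n = (1 : ArithmeticFunction ℝ) n - (muT U * (zeta : ArithmeticFunction ℝ)) n := rfl
  rw [this, h1, sub_self]

theorem cof_abs (U n : ℕ) (hn : 1 ≤ n) : |cof U n| ≤ 2 * n.divisors.card := by
  have e : cof U n = (1 : ArithmeticFunction ℝ) n - (muT U * (zeta : ArithmeticFunction ℝ)) n := rfl
  rw [e, coe_mul_zeta_apply]
  have h1 : |∑ d ∈ n.divisors, muT U d| ≤ n.divisors.card := by
    refine (Finset.abs_sum_le_sum_abs _ _).trans ?_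
    refine (Finset.sum_le_sum fun d _ => muT_abs U d).trans ?_
    simp
  have h2 : |(1 : ArithmeticFunction ℝ) n| ≤ 1 := by
    rw [one_apply]; split_ifs <;> simp
  have h3 : (1 : ℝ) ≤ n.divisors.card := by
    have : 0 < n.divisors.card := Finset.card_pos.2 ⟨1, by simp; omega⟩
    exact_mod_cast this
  refine (abs_sub _ _).trans ?_
  linarith

theorem ad_abs (U m : ℕ) : |(trunc vonMangoldt U * muT U) m| ≤ Real.log m := by
  rw [ArithmeticFunction.mul_apply, ← vonMangoldt_sum, ← Nat.map_div_right_divisors,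
    Finset.sum_map]
  refine (Finset.abs_sum_le_sum_abs _ _).trans (Finset.sum_le_sum fun d _ => ?_)
  change |trunc vonMangoldt U d * muT U (m / d)| ≤ _
  rw [abs_mul]
  have h1 : |trunc vonMangoldt U d| ≤ vonMangoldt d := by
    rw [trunc_apply]
    split_ifs
    · rw [abs_of_nonneg vonMangoldt_nonneg]
    · simp
  calc _ ≤ vonMangoldt d * 1 := by
        gcongr
        exact muT_abs _ _
    _ = _ := mul_one _

theorem ad_zero (U m : ℕ) (h : U ^ 2 < m) : (trunc vonMangoldt U * muT U) m = 0 := by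
  rw [ArithmeticFunction.mul_apply]
  refine Finset.sum_eq_zero fun z hz => ?_
  rw [Nat.mem_divisorsAntidiagonal] at hz
  unfold muT
  rw [trunc_apply, trunc_apply]
  split_ifs with h1 h2
  · exfalso
    have : z.1 * z.2 ≤ U * U := Nat.mul_le_mul h1 h2
    rw [hz.1] at this
    nlinarith
  all_goals simp

/-- Generic bound for a type I sum. -/
theorem typeI_sum (f : ArithmeticFunction ℝ) (G : ℕ → ℝ) (N V : ℕ) (B E : ℝ) (hB : 0 ≤ B) (hE : 0 ≤ E)
    (hf : ∀ m, m < N → |f m| ≤ B) (hV : ∀ m, V < m → f m = 0) (hG : ∀ m, 0 < m → |G m| ≤ E) :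
    |∑ m ∈ Finset.range N, f m * G m| ≤ V * (B * E) := by
  have h1 : ∀ m ∈ Finset.range N, |f m * G m| ≤ if m ∈ Finset.Icc 1 V then B * E else 0 := by
    intro m hm
    rw [Finset.mem_range] at hm
    split_ifs with h
    · rw [Finset.mem_Icc] at h
      rw [abs_mul]
      exact mul_le_mul (hf m hm) (hG m h.1) (abs_nonneg _) hB
    · rw [Finset.mem_Icc] at h
      rcases Nat.eq_zero_or_pos m with rfl | h0
      · simp
      · rw [hV m (by omega)]; simp
  refine (Finset.abs_sum_le_sum_abs _ _).trans ((Finset.sum_le_sum h1).trans ?_)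
  rw [← Finset.sum_filter, Finset.sum_const, nsmul_eq_mul]
  gcongr
  calc _ ≤ (Finset.Icc 1 V).card := by
        apply Finset.card_le_card
        intro m hm
        exact (Finset.mem_filter.1 hm).2
    _ = V := by simp

end PPF

namespace PPF

open ArithmeticFunction

theorem sum_range_support (h : ℕ → ℝ) (N M : ℕ) (hN : ∀ m, N ≤ m → h m = 0)
    (hM : ∀ m, M ≤ m → h m = 0) : ∑ m ∈ Finset.range N, h m = ∑ m ∈ Finset.range M, h m := by
  rcases le_total N M with hle | hle
  · refine Finset.sum_subset (Finset.range_mono hle) fun m _ hm => hN m (by simpa using hm)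
  · symm
    refine Finset.sum_subset (Finset.range_mono hle) fun m _ hm => hM m (by simpa using hm)

/-- Elementary numeric bound used in the type II estimate. -/
theorem typeII_numeric (Q l M N' N U : ℝ) (hQ : 1 ≤ Q) (hl : 1 ≤ l) (hM0 : 0 ≤ M) (hN0 : 0 ≤ N')
    (hN : 0 ≤ N) (hU : 0 < U) (h1 : M * N' ≤ 4 * N) (h2 : M + N' ≤ 6 * (N / U)) :
    2 / Q * Real.sqrt ((((8 * Q) ^ 2 + 4 * Real.pi * M) * (M * l ^ 2)) *
      (((8 * Q) ^ 2 + 4 * Real.pi * N') * (4 * (N' * l ^ 3)))) ≤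
    2000 * l ^ 3 * (Q * Real.sqrt N + N / Real.sqrt U + N / Q) := by
  set n := Real.sqrt N with hn
  set u := Real.sqrt U with hu
  have hu0 : 0 < u := Real.sqrt_pos.2 hU
  have hn0 : 0 ≤ n := Real.sqrt_nonneg _
  have hnn : N = n ^ 2 := (Real.sq_sqrt hN).symm
  have huu : U = u ^ 2 := (Real.sq_sqrt hU.le).symm
  have hpi := Real.pi_lt_d2
  have hpi0 := Real.pi_pos
  have hQ0 : 0 < Q := by linarith
  have hl0 : 0 < l := by linarith
  set p := n / u with hp
  have hp0 : 0 ≤ p := by positivity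
  have hpp : N / U = p ^ 2 := by rw [hnn, huu, hp, div_pow]
  have hA : ((8 * Q) ^ 2 + 4 * Real.pi * M) * ((8 * Q) ^ 2 + 4 * Real.pi * N') ≤
      (64 * Q ^ 2 + 71 * Q * p + 26 * n) ^ 2 := by
    have e : ((8 * Q) ^ 2 + 4 * Real.pi * M) * ((8 * Q) ^ 2 + 4 * Real.pi * N') =
      (64 * Q ^ 2) ^ 2 + 256 * Q ^ 2 * (Real.pi * (M + N')) + 16 * (Real.pi ^ 2 * (M * N')) := by ring
    have a1 : Real.pi * (M + N') ≤ 3.15 * (6 * p ^ 2) := by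
      rw [← hpp]; gcongr
    have a2 : Real.pi ^ 2 * (M * N') ≤ 3.15 ^ 2 * (4 * n ^ 2) := by
      rw [← hnn]; gcongr
    have a3 : 256 * Q ^ 2 * (Real.pi * (M + N')) ≤ 256 * Q ^ 2 * (3.15 * (6 * p ^ 2)) := by gcongr
    rw [e]
    have b1 : 0 ≤ Q ^ 2 * (Q * p) := by positivity
    have b2 : 0 ≤ Q ^ 2 * n := by positivity
    have b3 : 0 ≤ Q * p * n := by positivity
    have b4 : 0 ≤ Q ^ 2 * p ^ 2 := by positivity
    have b5 : 0 ≤ n ^ 2 := by positivity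
    nlinarith
  have hB : (M * l ^ 2) * (4 * (N' * l ^ 3)) ≤ (4 * n * l ^ 3) ^ 2 := by
    have e : (M * l ^ 2) * (4 * (N' * l ^ 3)) = 4 * (M * N') * l ^ 5 := by ring
    rw [e]
    have h1' : M * N' ≤ 4 * n ^ 2 := by rw [← hnn]; exact h1
    have : l ^ 5 ≤ l ^ 6 := pow_le_pow_right₀ hl (by norm_num)
    calc 4 * (M * N') * l ^ 5 ≤ 4 * (4 * n ^ 2) * l ^ 6 := by gcongr
      _ = _ := by ring
  have hs : Real.sqrt ((((8 * Q) ^ 2 + 4 * Real.pi * M) * (M * l ^ 2)) *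
      (((8 * Q) ^ 2 + 4 * Real.pi * N') * (4 * (N' * l ^ 3)))) ≤
      (64 * Q ^ 2 + 71 * Q * p + 26 * n) * (4 * n * l ^ 3) := by
    rw [Real.sqrt_le_left (by positivity)]
    calc _ = (((8 * Q) ^ 2 + 4 * Real.pi * M) * ((8 * Q) ^ 2 + 4 * Real.pi * N')) *
          ((M * l ^ 2) * (4 * (N' * l ^ 3))) := by ring
      _ ≤ _ := mul_le_mul hA hB (by positivity) (by positivity)
      _ = _ := (mul_pow _ _ _).symm
  calc _ ≤ 2 / Q * ((64 * Q ^ 2 + 71 * Q * p + 26 * n) * (4 * n * l ^ 3)) := by gcongr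
    _ = l ^ 3 * (512 * (Q * n) + 568 * (n * p) + 208 * (n ^ 2 / Q)) := by
        field_simp
        ring
    _ ≤ l ^ 3 * (2000 * (Q * n) + 2000 * (n * p) + 2000 * (n ^ 2 / Q)) := by
        have b1 : 0 ≤ Q * n := by positivity
        have b2 : 0 ≤ n * p := by positivity
        have b3 : 0 ≤ n ^ 2 / Q := by positivity
        gcongr <;> norm_num
    _ = _ := by
        rw [hnn, hp]
        ring

theorem typeII_block {φ : ℝ → ℝ} {g : ℝ → ℂ} (hbump : IsBump φ g)
    (W : ℕ) (hW : 0 < W) (N U : ℕ) (hU : 2 ≤ U) (Qs : Finset ℕ) (Q l L : ℝ) (hQ : 1 ≤ Q)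
    (hp : ∀ q ∈ Qs, q.Prime ∧ Q ≤ q ∧ (q : ℝ) ≤ 8 * Q) (hN : 1 ≤ N) (hl : 1 + Real.log N ≤ l)
    (hl5 : 1 ≤ l) (i : ℕ) (hi : 2 ^ i ≤ N) (f : ℕ → ℝ)
    (hf : ∀ m, |f m| ≤ vonMangoldt m) (hfU : ∀ m, m ≤ U → f m = 0) (hfi : ∀ m, 2 ^ (i + 1) ≤ m → f m = 0)
    (hfN : ∀ m, N ≤ m → f m = 0) :
    ∑ q ∈ Qs, |∑ m ∈ Finset.range (2 ^ (i + 1)), ∑ n ∈ Finset.range (N / 2 ^ i + 1),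
        f m * cof U n * (φ (Real.log ((m * n : ℕ) : ℝ) - L) * kapW W q (m * n))| ≤
      (∫ ξ, ‖g ξ‖) * (2000 * l ^ 3 * (Q * Real.sqrt N + N / Real.sqrt U + N / Q)) := by
  have hG : 0 ≤ ∫ ξ, ‖g ξ‖ := MeasureTheory.integral_nonneg fun _ => norm_nonneg _
  have hR : 0 ≤ (∫ ξ, ‖g ξ‖) * (2000 * l ^ 3 * (Q * Real.sqrt N + N / Real.sqrt U + N / Q)) := by
    positivity
  by_cases h1 : 2 ^ (i + 1) ≤ U
  · have : ∀ m, f m = 0 := by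
      intro m
      rcases le_total m U with h | h
      · exact hfU m h
      · exact hfi m (h1.trans h)
    simpa [this] using hR
  by_cases h2 : N / 2 ^ i ≤ U
  · have : ∀ q ∈ Qs, |∑ m ∈ Finset.range (2 ^ (i + 1)), ∑ n ∈ Finset.range (N / 2 ^ i + 1),
        f m * cof U n * (φ (Real.log ((m * n : ℕ) : ℝ) - L) * kapW W q (m * n))| = 0 := by
      intro q _
      rw [abs_eq_zero]
      refine Finset.sum_eq_zero fun m _ => Finset.sum_eq_zero fun n hn => ?_
      rw [Finset.mem_range] at hn
      rw [cof_eq_zero U n (by omega)]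
      ring
    rw [Finset.sum_congr rfl this]
    simpa using hR
  push Not at h1 h2
  have := NeZero.of_pos hW
  set M := 2 ^ (i + 1) with hM
  set N' := N / 2 ^ i + 1 with hN'
  have h2i : 0 < 2 ^ i := by positivity
  have hN1 : 2 ^ i * (N / 2 ^ i) ≤ N := Nat.mul_div_le N (2 ^ i)
  have hNle : N' ≤ N + 1 := by
    rw [hN']; have := Nat.div_le_self N (2 ^ i); omega
  have hMN : M * N' ≤ 4 * N := by
    rw [hM, hN', pow_succ]; nlinarith
  have hM1 : M * U ≤ 2 * N := by
    rw [hM, pow_succ]; nlinarith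
  have hNU : N' * U ≤ 4 * N := by nlinarith
  have hlogN : 0 ≤ Real.log N := Real.log_natCast_nonneg N
  -- norms
  have ha : ∑ m ∈ Finset.range M, ‖((f m : ℝ) : ℂ)‖ ^ 2 ≤ M * l ^ 2 := by
    calc _ ≤ ∑ m ∈ Finset.range M, l ^ 2 := by
          refine Finset.sum_le_sum fun m _ => ?_
          rw [Complex.norm_real, Real.norm_eq_abs]
          gcongr
          rcases Nat.lt_or_ge m N with h | h
          · refine (hf m).trans (vonMangoldt_le_log.trans ?_)
            rcases Nat.eq_zero_or_pos m with rfl | h0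
            · simp; linarith
            · have : Real.log m ≤ Real.log N :=
                Real.log_le_log (by exact_mod_cast h0) (by exact_mod_cast h.le)
              linarith
          · rw [hfN m h]; simp; linarith
      _ = _ := by simp
  have hb : ∑ n ∈ Finset.range N', ‖((cof U n : ℝ) : ℂ)‖ ^ 2 ≤ 4 * (N' * l ^ 3) := by
    have hN'1 : 1 ≤ N' := by omega
    have hs := sum_divisors_sq N' hN'1
    rw [Finset.range_eq_Ico, Finset.sum_eq_sum_Ico_succ_bot (by omega)]
    simp only [ArithmeticFunction.map_zero, Complex.ofReal_zero, norm_zero]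
    rw [zero_pow two_ne_zero, zero_add]
    calc _ ≤ ∑ n ∈ Finset.Ico 1 N', 4 * (n.divisors.card : ℝ) ^ 2 := by
          refine Finset.sum_le_sum fun n hn => ?_
          rw [Finset.mem_Ico] at hn
          rw [Complex.norm_real, Real.norm_eq_abs]
          have := cof_abs U n hn.1
          calc _ ≤ (2 * (n.divisors.card : ℝ)) ^ 2 := by gcongr
            _ = _ := by ring
      _ ≤ 4 * (N' * (1 + Real.log N') ^ 3) := by
          rw [← Finset.mul_sum]; gcongr
      _ ≤ _ := by
          have hNN : N' ≤ N := by
            have hi1 : 1 ≤ i := by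
              by_contra hcon
              have : i = 0 := by omega
              subst this
              simp at hM
              omega
            have h4 : 2 ≤ 2 ^ i := by
              calc 2 = 2 ^ 1 := by norm_num
                _ ≤ 2 ^ i := Nat.pow_le_pow_right (by norm_num) hi1
            nlinarith
          have : Real.log N' ≤ Real.log N :=
            Real.log_le_log (by exact_mod_cast hN'1) (by exact_mod_cast hNN)
          have h0 : 0 ≤ Real.log N' := Real.log_natCast_nonneg _
          gcongr
          linarith
  have hN'0 : (0 : ℝ) < N' := by exact_mod_cast (by omega : 0 < N')
  have hM0 : (0 : ℝ) < M := by exact_mod_cast (by omega : 0 < M)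
  have key := bilinear_smooth hbump W (fun m => ((f m : ℝ) : ℂ)) (fun n => ((cof U n : ℝ) : ℂ)) M N' Qs Q
    (8 * Q) (by linarith) hp (M * l ^ 2) (4 * (N' * l ^ 3)) (by positivity) (by positivity) ha hb
    (by linarith) (by simp [hfU 0 (Nat.zero_le _)]) (by simp) L
  have hU0 : (0 : ℝ) < U := by exact_mod_cast (by omega : 0 < U)
  have hnum := typeII_numeric Q l M N' N U hQ hl5 hM0.le hN'0.le (by positivity) hU0
    (by exact_mod_cast hMN) (by
      have a1 : (M : ℝ) ≤ 2 * (N / U) := by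
        rw [← mul_div_assoc, le_div_iff₀ hU0]; exact_mod_cast hM1
      have a2 : (N' : ℝ) ≤ 4 * (N / U) := by
        rw [← mul_div_assoc, le_div_iff₀ hU0]; exact_mod_cast hNU
      linarith)
  refine le_trans (le_of_eq ?_) (key.trans (mul_le_mul_of_nonneg_left hnum hG))
  refine Finset.sum_congr rfl fun q _ => ?_
  rw [← Real.norm_eq_abs, ← Complex.norm_real]
  congr 1
  push_cast
  refine Finset.sum_congr rfl fun m _ => Finset.sum_congr rfl fun n _ => ?_
  ring

end PPF

namespace PPF

open ArithmeticFunction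

theorem typeII_sum {φ : ℝ → ℝ} {g : ℝ → ℂ} (hbump : IsBump φ g)
    (W : ℕ) (hW : 0 < W) (N U : ℕ) (hU : 2 ≤ U) (Qs : Finset ℕ) (Q l L : ℝ) (hQ : 1 ≤ Q)
    (hp : ∀ q ∈ Qs, q.Prime ∧ Q ≤ q ∧ (q : ℝ) ≤ 8 * Q) (hN : 1 ≤ N) (hl : 1 + Real.log N ≤ l)
    (hl5 : 1 ≤ l) (hF : ∀ n : ℕ, N ≤ n → φ (Real.log n - L) = 0) :
    ∑ q ∈ Qs, |∑ m ∈ Finset.range N, ∑ n ∈ Finset.range N,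
        (vonMangoldt - trunc vonMangoldt U) m * cof U n *
          (φ (Real.log ((m * n : ℕ) : ℝ) - L) * kapW W q (m * n))| ≤
      (2 * l) * ((∫ ξ, ‖g ξ‖) * (2000 * l ^ 3 * (Q * Real.sqrt N + N / Real.sqrt U + N / Q))) := by
  set b : ℕ → ℝ := fun m => (vonMangoldt - trunc vonMangoldt U) m with hb
  have hbv : ∀ m, b m = if m ≤ U then 0 else vonMangoldt m := by
    intro m
    have : b m = vonMangoldt m - trunc vonMangoldt U m := rfl
    rw [this, trunc_apply]
    split_ifs <;> simp
  set T := Nat.log 2 N + 1 with hT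
  set f : ℕ → ℕ → ℝ := fun i m => if Nat.log 2 m = i ∧ m < N then b m else 0 with hf
  have hsplit : ∀ m, m < N → b m = ∑ i ∈ Finset.range T, f i m := by
    intro m hm
    simp only [hf, hm, and_true]
    rw [Finset.sum_ite_eq, if_pos]
    rw [Finset.mem_range, hT]
    have := Nat.log_mono_right (b := 2) hm.le
    omega
  have hblock : ∀ q i, ∑ m ∈ Finset.range N, ∑ n ∈ Finset.range N,
        f i m * cof U n * (φ (Real.log ((m * n : ℕ) : ℝ) - L) * kapW W q (m * n)) =
      ∑ m ∈ Finset.range (2 ^ (i + 1)), ∑ n ∈ Finset.range (N / 2 ^ i + 1),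
        f i m * cof U n * (φ (Real.log ((m * n : ℕ) : ℝ) - L) * kapW W q (m * n)) := by
    intro q i
    have h1 : ∀ m, ∑ n ∈ Finset.range N,
        f i m * cof U n * (φ (Real.log ((m * n : ℕ) : ℝ) - L) * kapW W q (m * n)) =
        ∑ n ∈ Finset.range (N / 2 ^ i + 1),
        f i m * cof U n * (φ (Real.log ((m * n : ℕ) : ℝ) - L) * kapW W q (m * n)) := by
      intro m
      by_cases hm : Nat.log 2 m = i ∧ m < N
      swap
      · simp [hf, hm]
      rcases Nat.eq_zero_or_pos m with rfl | hm0
      · simp [hf, hb]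
      have hm2 : 2 ^ i ≤ m := by rw [← hm.1]; exact Nat.pow_log_le_self 2 hm0.ne'
      apply sum_range_support
      · intro n hn
        rw [hF (m * n) (by nlinarith)]
        ring
      · intro n hn
        rw [hF (m * n) ?_]
        · ring
        · have h3 := Nat.lt_mul_div_succ N (by positivity : 0 < 2 ^ i)
          calc N ≤ 2 ^ i * (N / 2 ^ i + 1) := h3.le
            _ ≤ m * n := Nat.mul_le_mul hm2 hn
    simp only [h1]
    apply sum_range_support
    · intro m hm
      have : f i m = 0 := by
        simp only [hf]; rw [if_neg]; omega
      simp [this]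
    · intro m hm
      have : f i m = 0 := by
        simp only [hf]; rw [if_neg]
        rintro ⟨h, -⟩
        have hm0 : m ≠ 0 := by
          intro h0; subst h0
          have : 0 < 2 ^ (i + 1) := by positivity
          omega
        have := Nat.lt_pow_succ_log_self (b := 2) (by norm_num) m
        rw [h] at this
        omega
      simp [this]
  have hE : 0 ≤ ((∫ ξ, ‖g ξ‖) * (2000 * l ^ 3 * (Q * Real.sqrt N + N / Real.sqrt U + N / Q))) := by
    have hG : 0 ≤ ∫ ξ, ‖g ξ‖ := MeasureTheory.integral_nonneg fun _ => norm_nonneg _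
    positivity
  have hTl : (T : ℝ) ≤ 2 * l := by
    have h1 : 2 ^ (Nat.log 2 N) ≤ N := Nat.pow_log_le_self 2 (by omega)
    have h2 : ((2 : ℝ) ^ (Nat.log 2 N)) ≤ N := by exact_mod_cast h1
    have h3 := Real.log_le_log (by positivity) h2
    rw [Real.log_pow] at h3
    have h4 := Real.log_two_gt_d9
    have h5 : (0 : ℝ) ≤ (Nat.log 2 N : ℝ) := by positivity
    rw [hT]
    push_cast
    nlinarith
  calc _ = ∑ q ∈ Qs, |∑ i ∈ Finset.range T, ∑ m ∈ Finset.range N, ∑ n ∈ Finset.range N,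
        f i m * cof U n * (φ (Real.log ((m * n : ℕ) : ℝ) - L) * kapW W q (m * n))| := by
        refine Finset.sum_congr rfl fun q _ => ?_
        congr 1
        rw [Finset.sum_comm (s := Finset.range T) (t := Finset.range N)]
        refine Finset.sum_congr rfl fun m hm => ?_
        rw [Finset.sum_comm (s := Finset.range T) (t := Finset.range N)]
        refine Finset.sum_congr rfl fun n _ => ?_
        rw [← Finset.sum_mul, ← Finset.sum_mul, ← hsplit m (Finset.mem_range.1 hm)]
    _ ≤ ∑ q ∈ Qs, ∑ i ∈ Finset.range T, |∑ m ∈ Finset.range (2 ^ (i + 1)),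
          ∑ n ∈ Finset.range (N / 2 ^ i + 1),
        f i m * cof U n * (φ (Real.log ((m * n : ℕ) : ℝ) - L) * kapW W q (m * n))| := by
        refine Finset.sum_le_sum fun q _ => ?_
        refine (Finset.abs_sum_le_sum_abs _ _).trans (Finset.sum_le_sum fun i _ => ?_)
        rw [hblock]
    _ = ∑ i ∈ Finset.range T, ∑ q ∈ Qs, |∑ m ∈ Finset.range (2 ^ (i + 1)),
          ∑ n ∈ Finset.range (N / 2 ^ i + 1),
        f i m * cof U n * (φ (Real.log ((m * n : ℕ) : ℝ) - L) * kapW W q (m * n))| := Finset.sum_comm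
    _ ≤ ∑ i ∈ Finset.range T,
          ((∫ ξ, ‖g ξ‖) * (2000 * l ^ 3 * (Q * Real.sqrt N + N / Real.sqrt U + N / Q))) := by
        refine Finset.sum_le_sum fun i hi => ?_
        rw [Finset.mem_range] at hi
        refine typeII_block hbump W hW N U hU Qs Q l L hQ hp hN hl hl5 i ?_ (f i) ?_ ?_ ?_ ?_
        · calc 2 ^ i ≤ 2 ^ (Nat.log 2 N) := Nat.pow_le_pow_right (by norm_num) (by omega)
            _ ≤ N := Nat.pow_log_le_self 2 (by omega)
        · intro m
          simp only [hf, hbv]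
          split_ifs
          · simp
          · rw [abs_of_nonneg vonMangoldt_nonneg]
          · simp
        · intro m hm
          simp only [hf, hbv, if_pos hm]
          simp
        · intro m hm
          simp only [hf]; rw [if_neg]
          rintro ⟨h, -⟩
          have hm0 : m ≠ 0 := by
            intro h0; subst h0
            have : 0 < 2 ^ (i + 1) := by positivity
            omega
          have := Nat.lt_pow_succ_log_self (b := 2) (by norm_num) m
          rw [h] at this
          omega
        · intro m hm
          simp only [hf]; rw [if_neg]; omega
    _ = T * ((∫ ξ, ‖g ξ‖) * (2000 * l ^ 3 * (Q * Real.sqrt N + N / Real.sqrt U + N / Q))) := by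
        simp
    _ ≤ _ := mul_le_mul_of_nonneg_right hTl hE

theorem bv_core {φ : ℝ → ℝ} {g : ℝ → ℂ} (hbump : IsBump φ g) :
    ∃ K : ℝ, 0 < K ∧ ∀ (W : ℕ), 0 < W → ∀ (N U : ℕ), 2 ≤ U → 1 ≤ N →
    ∀ (Qs : Finset ℕ) (Q l L : ℝ), 1 ≤ Q →
    (∀ q ∈ Qs, q.Prime ∧ Q ≤ q ∧ (q : ℝ) ≤ 8 * Q ∧ Nat.Coprime W q) → 1 + Real.log N ≤ l →
    (∀ n : ℕ, N ≤ n → φ (Real.log n - L) = 0) → (∀ n : ℕ, n ≤ U → φ (Real.log n - L) = 0) →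
    ∑ q ∈ Qs, |∑ n ∈ Finset.range N, vonMangoldt n * (φ (Real.log n - L) * kapW W q n)| ≤
      K * l ^ 4 * (Q * Real.sqrt N + N / Real.sqrt U + N / Q + Q * U ^ 2) := by
  obtain ⟨K, hK, hI⟩ := typeI_bd hbump
  have hG : 0 ≤ ∫ ξ, ‖g ξ‖ := MeasureTheory.integral_nonneg fun _ => norm_nonneg _
  refine ⟨18 * K + 4000 * (∫ ξ, ‖g ξ‖), by positivity, ?_⟩
  intro W hW N U hU hN Qs Q l L hQ hp hl hF hFU
  have hlogN : 0 ≤ Real.log N := Real.log_natCast_nonneg N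
  have hl1 : 1 ≤ l := by linarith
  set H : ℕ → ℕ → ℝ := fun q n => φ (Real.log n - L) * kapW W q n with hH
  have hHN : ∀ q n, N ≤ n → H q n = 0 := fun q n hn => by simp [hH, hF n hn]
  have hH0 : ∀ q, H q 0 = 0 := fun q => by
    have := hFU 0 (Nat.zero_le _)
    simp only [hH, this, zero_mul]
  have hdec : ∀ q, ∑ n ∈ Finset.range N, vonMangoldt n * H q n =
      (∑ m ∈ Finset.range N, muT U m * ∑ n ∈ Finset.range N, Real.log n * H q (m * n)) -
      (∑ m ∈ Finset.range N, (trunc vonMangoldt U * muT U) m * ∑ n ∈ Finset.range N, H q (m * n)) +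
      ∑ m ∈ Finset.range N, ∑ n ∈ Finset.range N,
        (vonMangoldt - trunc vonMangoldt U) m * cof U n * H q (m * n) := by
    intro q
    rw [← conv_sum (vonMangoldt - trunc vonMangoldt U) (cof U) (H q) N (hHN q)]
    have e1 : ∑ m ∈ Finset.range N, muT U m * ∑ n ∈ Finset.range N, Real.log n * H q (m * n) =
        ∑ n ∈ Finset.range N, (muT U * log) n * H q n := by
      rw [conv_sum _ _ (H q) N (hHN q)]
      refine Finset.sum_congr rfl fun m _ => ?_
      rw [Finset.mul_sum]
      refine Finset.sum_congr rfl fun n _ => ?_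
      rw [log_apply]; ring
    have e2 : ∑ m ∈ Finset.range N, (trunc vonMangoldt U * muT U) m * ∑ n ∈ Finset.range N, H q (m * n) =
        ∑ n ∈ Finset.range N, (trunc vonMangoldt U * muT U * (zeta : ArithmeticFunction ℝ)) n * H q n := by
      rw [conv_sum _ _ (H q) N (hHN q)]
      refine Finset.sum_congr rfl fun m _ => ?_
      rw [Finset.mul_sum]
      refine Finset.sum_congr rfl fun n _ => ?_
      rcases Nat.eq_zero_or_pos n with rfl | hn
      · rw [mul_zero, hH0]; simp
      · rw [natCoe_apply, zeta_apply_ne hn.ne']; simp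
    rw [e1, e2, ← Finset.sum_sub_distrib, ← Finset.sum_add_distrib]
    refine Finset.sum_congr rfl fun n _ => ?_
    have hz : trunc vonMangoldt U n * H q n = 0 := by
      rw [trunc_apply]
      split_ifs with h
      · have := hFU n h
        simp only [hH, this]; ring
      · simp
    have hv := congrArg (fun f : ArithmeticFunction ℝ => f n) (vaughan U)
    have hv' : vonMangoldt n = (muT U * log) n + trunc vonMangoldt U n
      - (trunc vonMangoldt U * muT U * (zeta : ArithmeticFunction ℝ)) n
      + ((vonMangoldt - trunc vonMangoldt U) * cof U) n := hv
    rw [hv']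
    linear_combination hz
  have hT1 : ∀ q ∈ Qs, |∑ m ∈ Finset.range N, muT U m * ∑ n ∈ Finset.range N, Real.log n * H q (m * n)|
      ≤ U * (1 * (K * l ^ 2)) := by
    intro q hq
    refine typeI_sum (muT U) _ N U 1 _ zero_le_one (by positivity) (fun m _ => muT_abs U m) ?_ ?_
    · intro m hm
      unfold muT
      rw [trunc_apply, if_neg (by omega)]
    · intro m hm
      have := (hI W q m N L hW (hp q hq).1 (hp q hq).2.2.2 hm hN).2
      simp only [hH, ← mul_assoc]
      refine this.trans ?_
      gcongr
  have hT2 : ∀ q ∈ Qs, |∑ m ∈ Finset.range N, (trunc vonMangoldt U * muT U) m *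
      ∑ n ∈ Finset.range N, H q (m * n)| ≤ (U ^ 2 : ℕ) * (l * (K * l ^ 2)) := by
    intro q hq
    refine typeI_sum _ _ N (U ^ 2) l _ (by linarith) (by positivity) ?_ ?_ ?_
    · intro m hm
      refine (ad_abs U m).trans ?_
      rcases Nat.eq_zero_or_pos m with rfl | h0
      · simp; linarith
      · have : Real.log m ≤ Real.log N :=
          Real.log_le_log (by exact_mod_cast h0) (by exact_mod_cast hm.le)
        linarith
    · intro m hm
      exact ad_zero U m hm
    · intro m hm
      have := (hI W q m N L hW (hp q hq).1 (hp q hq).2.2.2 hm hN).1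
      refine this.trans ?_
      gcongr
  have hT3 := typeII_sum hbump W hW N U hU Qs Q l L hQ
    (fun q hq => ⟨(hp q hq).1, (hp q hq).2.1, (hp q hq).2.2.1⟩) hN hl hl1 hF
  have hcard : (Qs.card : ℝ) ≤ 9 * Q := by
    have h1 : Qs ⊆ Finset.Icc 1 ⌊8 * Q⌋₊ := by
      intro q hq
      rw [Finset.mem_Icc]
      exact ⟨(hp q hq).1.one_le, Nat.le_floor (hp q hq).2.2.1⟩
    have h2 := Finset.card_le_card h1
    rw [Nat.card_Icc, Nat.add_sub_cancel] at h2
    have h3 : (Qs.card : ℝ) ≤ (⌊8 * Q⌋₊ : ℝ) := by exact_mod_cast h2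
    have h4 := Nat.floor_le (by linarith : 0 ≤ 8 * Q)
    linarith
  have hUU : (U : ℝ) ≤ (U : ℝ) ^ 2 := by
    have : (1 : ℝ) ≤ U := by exact_mod_cast (by omega : 1 ≤ U)
    nlinarith
  calc _ ≤ ∑ q ∈ Qs, (U * (1 * (K * l ^ 2)) + (U ^ 2 : ℕ) * (l * (K * l ^ 2)) +
        |∑ m ∈ Finset.range N, ∑ n ∈ Finset.range N,
        (vonMangoldt - trunc vonMangoldt U) m * cof U n * H q (m * n)|) := by
        refine Finset.sum_le_sum fun q hq => ?_
        have h0 := hdec q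
        simp only [hH] at h0
        rw [h0]
        refine (abs_add_le _ _).trans ?_
        gcongr
        refine (abs_sub _ _).trans ?_
        exact add_le_add (hT1 q hq) (hT2 q hq)
    _ = Qs.card * (U * (1 * (K * l ^ 2)) + (U ^ 2 : ℕ) * (l * (K * l ^ 2))) +
        ∑ q ∈ Qs, |∑ m ∈ Finset.range N, ∑ n ∈ Finset.range N,
        (vonMangoldt - trunc vonMangoldt U) m * cof U n * H q (m * n)| := by
        rw [Finset.sum_add_distrib, Finset.sum_const, nsmul_eq_mul]
    _ ≤ (9 * Q) * (U ^ 2 * (1 * (K * l ^ 4)) + U ^ 2 * (K * l ^ 4)) +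
        (2 * l) * ((∫ ξ, ‖g ξ‖) * (2000 * l ^ 3 * (Q * Real.sqrt N + N / Real.sqrt U + N / Q))) := by
        have p1 : l ^ 2 ≤ l ^ 4 := pow_le_pow_right₀ hl1 (by norm_num)
        have p2 : l * (K * l ^ 2) ≤ K * l ^ 4 := by
          have : l ^ 3 ≤ l ^ 4 := pow_le_pow_right₀ hl1 (by norm_num)
          calc l * (K * l ^ 2) = K * l ^ 3 := by ring
            _ ≤ _ := by gcongr
        refine add_le_add ?_ hT3
        push_cast
        gcongr
    _ = l ^ 4 * (18 * K * (Q * U ^ 2) + 4000 * (∫ ξ, ‖g ξ‖) *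
          (Q * Real.sqrt N + N / Real.sqrt U + N / Q)) := by ring
    _ ≤ l ^ 4 * ((18 * K + 4000 * (∫ ξ, ‖g ξ‖)) * (Q * U ^ 2) + (18 * K + 4000 * (∫ ξ, ‖g ξ‖)) *
          (Q * Real.sqrt N + N / Real.sqrt U + N / Q)) := by
        gcongr
        · linarith
        · linarith
    _ = _ := by ring

end PPF

namespace PPF

open ArithmeticFunction

/-- Cut-off length. -/
noncomputable def Nx (x : ℝ) : ℕ := ⌊Real.exp 4 * x⌋₊ + 1

theorem exp_four_lt : Real.exp 4 < 55 := by
  have h := Real.exp_one_lt_d9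
  have e : Real.exp 4 = Real.exp 1 ^ 4 := by rw [← Real.exp_nat_mul]; norm_num
  rw [e]
  calc Real.exp 1 ^ 4 ≤ 2.7182818286 ^ 4 := by gcongr
    _ < 55 := by norm_num

theorem Nx_le (x : ℝ) (hx : 1 ≤ x) : (Nx x : ℝ) ≤ 56 * x := by
  unfold Nx
  push_cast
  have := Nat.floor_le (by positivity : 0 ≤ Real.exp 4 * x)
  nlinarith [exp_four_lt]

theorem phi_zero_of_ge {φ : ℝ → ℝ} {g : ℝ → ℂ} (hb : IsBump φ g) (x : ℝ) (hx : 1 ≤ x) (n : ℕ)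
    (hn : Nx x ≤ n) : φ (Real.log n - Real.log x) = 0 := by
  apply hb.eq_zero
  have h1 : Real.exp 4 * x < n := by
    have := Nat.lt_floor_add_one (Real.exp 4 * x)
    have h2 : ((⌊Real.exp 4 * x⌋₊ + 1 : ℕ) : ℝ) ≤ n := by exact_mod_cast hn
    push_cast at h2
    linarith
  have h2 := Real.log_le_log (by positivity) h1.le
  rw [Real.log_mul (by positivity) (by positivity), Real.log_exp] at h2
  rw [le_abs]; left; linarith

theorem bv {φ : ℝ → ℝ} {g : ℝ → ℂ} (hbump : IsBump φ g) :
    ∃ K : ℝ, 0 < K ∧ ∀ x : ℝ, Real.exp 20 ≤ x → ∀ (W : ℕ), 0 < W →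
    ∀ (Qs : Finset ℕ) (Q : ℝ), 1 ≤ Q →
    (∀ q ∈ Qs, q.Prime ∧ Q ≤ q ∧ (q : ℝ) ≤ 8 * Q ∧ Nat.Coprime W q) →
    ∑ q ∈ Qs, |∑ n ∈ Finset.range (Nx x),
        vonMangoldt n * (φ (Real.log n - Real.log x) * kapW W q n)| ≤
      K * Real.log x ^ 4 * (Q * Real.sqrt x + x / x ^ (1 / 8 : ℝ) + x / Q) := by
  obtain ⟨K, hK, h⟩ := bv_core hbump
  refine ⟨K * 16 * 112, by positivity, ?_⟩
  intro x hx W hW Qs Q hQ hp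
  have hx1 : 1 ≤ x := le_trans (Real.one_le_exp (by norm_num)) hx
  have hx0 : 0 < x := by linarith
  have hlx : 20 ≤ Real.log x := by
    rw [Real.le_log_iff_exp_le hx0]; exact hx
  set y := x ^ (1 / 8 : ℝ) with hy
  have hy0 : 0 < y := by positivity
  have hy8 : y ^ 8 = x := by
    rw [hy, ← Real.rpow_natCast, ← Real.rpow_mul hx0.le]; norm_num
  have hsx : Real.sqrt x = y ^ 4 := by
    rw [← hy8, show y ^ 8 = (y ^ 4) ^ 2 by ring, Real.sqrt_sq (by positivity)]
  have hylog : Real.log x = 8 * Real.log y := by rw [← hy8, Real.log_pow]; norm_num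
  have hy2 : 2 ≤ y := by
    have : 1 ≤ Real.log y := by linarith
    have h3 := (Real.le_log_iff_exp_le hy0).1 this
    have := Real.add_one_le_exp 1
    linarith
  set U := ⌊y ^ 2⌋₊ with hU
  have hUle : (U : ℝ) ≤ y ^ 2 := Nat.floor_le (by positivity)
  have hUge : y ^ 2 / 4 ≤ (U : ℝ) := by
    have := Nat.lt_floor_add_one (y ^ 2)
    nlinarith
  have hU2 : 2 ≤ U := by
    apply Nat.le_floor
    push_cast
    nlinarith
  have hN1 : 1 ≤ Nx x := by unfold Nx; omega
  have hNle := Nx_le x hx1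
  have hl : 1 + Real.log (Nx x) ≤ 2 * Real.log x := by
    have h1 : Real.log (Nx x) ≤ Real.log (56 * x) :=
      Real.log_le_log (by exact_mod_cast hN1) hNle
    rw [Real.log_mul (by norm_num) hx0.ne'] at h1
    have h2 : Real.log 56 ≤ 6 := by
      rw [Real.log_le_iff_le_exp (by norm_num)]
      have e : Real.exp 6 = Real.exp 1 ^ 6 := by rw [← Real.exp_nat_mul]; norm_num
      rw [e]
      calc (56 : ℝ) ≤ 2 ^ 6 := by norm_num
        _ ≤ _ := by
          gcongr
          have := Real.add_one_le_exp 1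
          linarith
    linarith
  have key := h W hW (Nx x) U hU2 hN1 Qs Q (2 * Real.log x) (Real.log x) hQ hp hl
    (fun n hn => phi_zero_of_ge hbump x hx1 n hn) (by
      intro n hn
      apply hbump.eq_zero
      rw [le_abs]; right
      rcases Nat.eq_zero_or_pos n with rfl | h0
      · simp; linarith
      have h1 : (n : ℝ) ≤ y ^ 2 := le_trans (by exact_mod_cast hn) hUle
      have h2 := Real.log_le_log (by exact_mod_cast h0) h1
      rw [Real.log_pow] at h2
      push_cast at h2
      linarith)
  refine key.trans ?_
  have hsN : Real.sqrt (Nx x) ≤ 8 * y ^ 4 := by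
    rw [Real.sqrt_le_left (by positivity)]
    calc (Nx x : ℝ) ≤ 56 * y ^ 8 := by rw [hy8]; exact hNle
      _ ≤ (8 * y ^ 4) ^ 2 := by ring_nf; gcongr; norm_num
  have hsU : y / 2 ≤ Real.sqrt U := by
    apply Real.le_sqrt_of_sq_le
    calc (y / 2) ^ 2 = y ^ 2 / 4 := by ring
      _ ≤ (U : ℝ) := hUge
  have t2 : (Nx x : ℝ) / Real.sqrt U ≤ 112 * (x / y) := by
    calc (Nx x : ℝ) / Real.sqrt U ≤ (56 * x) / (y / 2) := by gcongr
      _ = _ := by field_simp; ring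
  have t3 : (Nx x : ℝ) / Q ≤ 56 * (x / Q) := by
    rw [← mul_div_assoc]; gcongr
  have t4 : Q * (U : ℝ) ^ 2 ≤ Q * y ^ 4 := by
    have : (U : ℝ) ^ 2 ≤ (y ^ 2) ^ 2 := by gcongr
    calc Q * (U : ℝ) ^ 2 ≤ Q * (y ^ 2) ^ 2 := by gcongr
      _ = _ := by ring
  have t1 : Q * Real.sqrt (Nx x) ≤ 8 * (Q * y ^ 4) := by
    calc Q * Real.sqrt (Nx x) ≤ Q * (8 * y ^ 4) := by gcongr
      _ = _ := by ring
  have p1 : 0 ≤ Q * y ^ 4 := by positivity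
  have p2 : 0 ≤ x / y := by positivity
  have p3 : 0 ≤ x / Q := by positivity
  rw [hsx]
  calc _ ≤ K * (2 * Real.log x) ^ 4 * (112 * (Q * y ^ 4 + x / y + x / Q)) := by
        gcongr
        linarith
    _ = _ := by ring

end PPF

namespace PPF

open MeasureTheory Complex

theorem norm_LSeries_bd (f : ℕ → ℂ) (c C r : ℝ) (hc : 0 ≤ c) (hC : 0 ≤ C) (hr0 : 0 ≤ r) (hr : r < 1)
    (s : ℂ) (hs : 1 < s.re) (hS : LSeriesSummable f s)
    (hb : ∀ t : ℝ, 1 ≤ t → ‖(∑ n ∈ Finset.Icc 1 ⌊t⌋₊, f n) - c * t‖ ≤ C * t ^ r) :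
    ‖LSeries f s‖ ≤ ‖s‖ * (c / ‖s - 1‖ + C / (1 - r)) := by
  have hO : (fun n : ℕ ↦ ∑ k ∈ Finset.Icc 1 n, f k) =O[Filter.atTop] fun n ↦ (n : ℝ) ^ (1:ℝ) := by
    refine Asymptotics.IsBigO.of_bound (c + C) ?_
    filter_upwards [Filter.eventually_ge_atTop 1] with n hn
    have hn1 : (1:ℝ) ≤ n := by exact_mod_cast hn
    have h1 := hb n hn1
    rw [Nat.floor_natCast] at h1
    have h2 : (n:ℝ) ^ r ≤ n := by
      calc (n:ℝ) ^ r ≤ (n:ℝ) ^ (1:ℝ) := Real.rpow_le_rpow_of_exponent_le hn1 hr.le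
        _ = n := Real.rpow_one _
    rw [Real.rpow_one, Real.norm_of_nonneg (by positivity)]
    have h3 : ‖((c:ℂ) * (n:ℝ))‖ = c * n := by
      rw [norm_mul, Complex.norm_real, Complex.norm_real, Real.norm_of_nonneg hc,
        Real.norm_of_nonneg (by positivity)]
    have h4 := norm_add_le ((∑ k ∈ Finset.Icc 1 n, f k) - c * (n:ℝ)) ((c:ℂ) * (n:ℝ))
    rw [sub_add_cancel, h3] at h4
    nlinarith
  rw [LSeries_eq_mul_integral f (zero_le_one) hs hS hO, norm_mul]
  refine mul_le_mul_of_nonneg_left ?_ (norm_nonneg _)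
  have hmeas : Measurable (fun t : ℝ => ∑ n ∈ Finset.Icc 1 ⌊t⌋₊, f n) :=
    (measurable_of_countable (fun m : ℕ => ∑ n ∈ Finset.Icc 1 m, f n)).comp Nat.measurable_floor
  have hcp : ∀ a : ℂ, AEStronglyMeasurable (fun t : ℝ => (t : ℂ) ^ a)
      (volume.restrict (Set.Ioi (1:ℝ))) := by
    intro a
    refine ContinuousOn.aestronglyMeasurable (fun t ht ↦ ?_) measurableSet_Ioi
    exact (Complex.continuousAt_ofReal_cpow_const _ _
      (Or.inr (zero_lt_one.trans ht).ne')).continuousWithinAt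
  have hI0 : IntegrableOn (fun t : ℝ => C * t ^ (r - 2)) (Set.Ioi 1) :=
    (integrableOn_Ioi_rpow_of_lt (by linarith) one_pos).const_mul C
  have hpt : ∀ t ∈ Set.Ioi (1:ℝ),
      ‖((∑ n ∈ Finset.Icc 1 ⌊t⌋₊, f n) - c * t) * (t:ℂ) ^ (-(s + 1))‖ ≤ C * t ^ (r - 2) := by
    intro t ht
    have ht1 : (1:ℝ) < t := ht
    have ht0 : 0 < t := by linarith
    rw [norm_mul, Complex.norm_cpow_eq_rpow_re_of_pos ht0]
    have h2 : t ^ (-(s + 1)).re ≤ t ^ (-2:ℝ) := by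
      apply Real.rpow_le_rpow_of_exponent_le ht1.le
      simp; linarith
    calc _ ≤ (C * t ^ r) * t ^ (-2:ℝ) :=
          mul_le_mul (hb t ht1.le) h2 (Real.rpow_nonneg ht0.le _) (by positivity)
      _ = C * t ^ (r - 2) := by
          rw [mul_assoc, ← Real.rpow_add ht0]; rfl
  have hI1 : IntegrableOn (fun t : ℝ => ((∑ n ∈ Finset.Icc 1 ⌊t⌋₊, f n) - c * t)
      * (t:ℂ) ^ (-(s + 1))) (Set.Ioi 1) := by
    refine Integrable.mono' hI0 ?_ ?_
    · refine AEStronglyMeasurable.mul ?_ (hcp _)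
      refine (Measurable.aestronglyMeasurable ?_)
      exact hmeas.sub (by fun_prop)
    · exact (ae_restrict_iff' measurableSet_Ioi).2 (Filter.Eventually.of_forall hpt)
  have hI2 : IntegrableOn (fun t : ℝ => (c:ℂ) * (t:ℂ) ^ (-s)) (Set.Ioi 1) :=
    (integrableOn_Ioi_cpow_of_lt (by simpa using hs) one_pos).const_mul _
  have hsplit : ∫ t in Set.Ioi (1:ℝ), (∑ n ∈ Finset.Icc 1 ⌊t⌋₊, f n) * (t:ℂ) ^ (-(s + 1))
      = (∫ t in Set.Ioi (1:ℝ), ((∑ n ∈ Finset.Icc 1 ⌊t⌋₊, f n) - c * t) * (t:ℂ) ^ (-(s + 1)))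
        + ∫ t in Set.Ioi (1:ℝ), (c:ℂ) * (t:ℂ) ^ (-s) := by
    rw [← integral_add hI1 hI2]
    refine setIntegral_congr_fun measurableSet_Ioi fun t ht ↦ ?_
    have ht0 : (t:ℂ) ≠ 0 := by
      have : (1:ℝ) < t := ht
      exact_mod_cast (by linarith : t ≠ 0)
    have : (t:ℂ) ^ (-s) = t * (t:ℂ) ^ (-(s+1)) := by
      rw [show -s = 1 + (-(s+1)) by ring, Complex.cpow_add _ _ ht0, Complex.cpow_one]
    simp only [this]
    ring
  rw [hsplit]
  have hA : ‖∫ t in Set.Ioi (1:ℝ), ((∑ n ∈ Finset.Icc 1 ⌊t⌋₊, f n) - c * t) * (t:ℂ) ^ (-(s + 1))‖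
      ≤ C / (1 - r) := by
    calc _ ≤ ∫ t in Set.Ioi (1:ℝ), C * t ^ (r - 2) := by
          refine norm_integral_le_of_norm_le hI0 ?_
          exact (ae_restrict_iff' measurableSet_Ioi).2 (Filter.Eventually.of_forall hpt)
      _ = C / (1 - r) := by
          rw [integral_const_mul, integral_Ioi_rpow_of_lt (by linarith) one_pos, Real.one_rpow]
          have : r - 2 + 1 ≠ 0 := by linarith
          have : 1 - r ≠ 0 := by linarith
          rw [show r - 2 + 1 = -(1 - r) by ring, neg_div_neg_eq]
          ring
  have hB : ‖∫ t in Set.Ioi (1:ℝ), (c:ℂ) * (t:ℂ) ^ (-s)‖ = c / ‖s - 1‖ := by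
    rw [integral_const_mul, integral_Ioi_cpow_of_lt (by simpa using hs) one_pos, Complex.ofReal_one,
      Complex.one_cpow, norm_mul, Complex.norm_real, Real.norm_of_nonneg hc, norm_div, norm_neg,
      norm_one, show -s + 1 = -(s - 1) by ring, norm_neg]
    ring
  calc _ ≤ _ := norm_add_le _ _
    _ ≤ _ := by rw [hB]; linarith

theorem abel_mono (f : ℕ → ℝ) (s : ℕ → ℂ) (hf : Monotone f) (hf0 : 0 ≤ f 0) (K : ℝ)
    (hs : ∀ k, ‖∑ n ∈ Finset.range k, s n‖ ≤ K) (N : ℕ) :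
    ‖∑ n ∈ Finset.range (N + 1), (f n : ℂ) * s n‖ ≤ 2 * K * f N := by
  have key : ∀ N : ℕ, ∑ n ∈ Finset.range (N + 1), (f n : ℂ) * s n
      = f N * (∑ n ∈ Finset.range (N+1), s n)
        - ∑ i ∈ Finset.range N, ((f (i+1) - f i : ℝ) : ℂ) * ∑ n ∈ Finset.range (i+1), s n := by
    intro N
    induction N with
    | zero => simp
    | succ N ih =>
      rw [Finset.sum_range_succ, ih, Finset.sum_range_succ _ (N+1),
        Finset.sum_range_succ (n := N) (f := fun i => ((f (i+1) - f i : ℝ) : ℂ) * _)]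
      push_cast
      ring
  have hK : 0 ≤ K := (norm_nonneg _).trans (hs 0)
  rw [key N]
  have h1 : ‖(f N : ℂ) * (∑ n ∈ Finset.range (N+1), s n)‖ ≤ f N * K := by
    rw [norm_mul, Complex.norm_real, Real.norm_of_nonneg (hf0.trans (hf (Nat.zero_le _)))]
    exact mul_le_mul_of_nonneg_left (hs _) (hf0.trans (hf (Nat.zero_le _)))
  have h2 : ‖∑ i ∈ Finset.range N, ((f (i+1) - f i : ℝ) : ℂ) * ∑ n ∈ Finset.range (i+1), s n‖
      ≤ (f N - f 0) * K := by
    calc _ ≤ ∑ i ∈ Finset.range N, (f (i+1) - f i) * K := by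
          refine norm_sum_le_of_le _ fun i _ => ?_
          have h0 : 0 ≤ f (i+1) - f i := sub_nonneg.2 (hf (Nat.le_succ i))
          rw [norm_mul, Complex.norm_real, Real.norm_of_nonneg h0]
          exact mul_le_mul_of_nonneg_left (hs _) h0
      _ = _ := by rw [← Finset.sum_mul, Finset.sum_range_sub]
  have h3 := norm_sub_le ((f N : ℂ) * (∑ n ∈ Finset.range (N+1), s n))
    (∑ i ∈ Finset.range N, ((f (i+1) - f i : ℝ) : ℂ) * ∑ n ∈ Finset.range (i+1), s n)
  nlinarith [mul_nonneg hf0 hK]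

theorem char_sum_bd (W : ℕ) [NeZero W] (χ : DirichletCharacter ℂ W) (hχ : χ ≠ 1) (N : ℕ) :
    ‖∑ n ∈ Finset.range N, χ n‖ ≤ W := by
  have hper : ∀ m : ℕ, ∑ n ∈ Finset.range (W * m), χ (n : ZMod W) = 0 := by
    intro m
    induction m with
    | zero => simp
    | succ m ih =>
      rw [Nat.mul_succ, Finset.sum_range_add, ih, zero_add]
      have h1 : ∀ i ∈ Finset.range W, χ (((W * m + i : ℕ) : ZMod W)) = χ (i : ZMod W) := by
        intro i _; simp
      rw [Finset.sum_congr rfl h1]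
      rw [← MulChar.sum_eq_zero_of_ne_one hχ]
      refine Finset.sum_nbij' (fun b => (b : ZMod W)) (fun b => b.val) ?_ ?_ ?_ ?_ ?_
      · simp
      · intro b _; rw [Finset.mem_range]; exact ZMod.val_lt b
      · intro b hb; exact ZMod.val_natCast_of_lt (Finset.mem_range.1 hb)
      · intro b _; simp
      · intro b _; rfl
  have hN : N = W * (N / W) + N % W := (Nat.div_add_mod N W).symm
  rw [hN, Finset.sum_range_add, hper, zero_add]
  calc _ ≤ ∑ i ∈ Finset.range (N % W), (1:ℝ) :=
        norm_sum_le_of_le _ fun i _ => DirichletCharacter.norm_le_one _ _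
    _ ≤ W := by
        simp only [Finset.sum_const, Finset.card_range, nsmul_eq_mul, mul_one]
        exact_mod_cast (Nat.mod_lt _ (Nat.pos_of_ne_zero (NeZero.ne W))).le

/-- Coefficients twisted by powers of log. -/
noncomputable def lg (j : ℕ) (f : ℕ → ℂ) (n : ℕ) : ℂ := ((Real.log n ^ j : ℝ) : ℂ) * f n

theorem lg_eq (j : ℕ) (f : ℕ → ℂ) : LSeries.logMul^[j] f = lg j f := by
  induction j with
  | zero => ext n; simp [lg]
  | succ j ih =>
    rw [Function.iterate_succ_apply', ih]
    ext n
    simp only [LSeries.logMul, lg]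
    rw [← Complex.natCast_log]
    push_cast
    ring

theorem lg_partial (k j : ℕ) (hk : 1 ≤ k) (χ : DirichletCharacter ℂ (3 ^ k)) (hχ : χ ≠ 1)
    (n : ℕ) (hn : 1 ≤ n) :
    ‖∑ m ∈ Finset.Icc 1 n, lg j (fun i => χ i) m‖
      ≤ 6 * j.factorial * (2 * k) ^ j * (n:ℝ) ^ (1 - 1 / (2 * k : ℝ)) := by
  have : NeZero (3 ^ k) := ⟨by positivity⟩
  have hn1 : (1:ℝ) ≤ n := by exact_mod_cast hn
  have hn0 : (0:ℝ) < n := by linarith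
  have hk1 : (1:ℝ) ≤ k := by exact_mod_cast hk
  have hmono : Monotone (fun n : ℕ => Real.log n ^ j) := by
    intro a b hab
    have : Real.log a ≤ Real.log b := by
      rcases Nat.eq_zero_or_pos a with rfl | ha
      · simp [Real.log_natCast_nonneg]
      · exact Real.log_le_log (by exact_mod_cast ha) (by exact_mod_cast hab)
    exact pow_le_pow_left₀ (Real.log_natCast_nonneg _) this j
  have h0 : ∑ m ∈ Finset.Icc 1 n, lg j (fun i => χ i) m
      = ∑ m ∈ Finset.range (n+1), ((Real.log m ^ j : ℝ) : ℂ) * χ m := by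
    have hz : χ ((0:ℕ) : ZMod (3^k)) = 0 := by
      have : Nontrivial (ZMod (3^k)) := ZMod.nontrivial_iff.2 (by
        have : 3 ^ 1 ≤ 3 ^ k := Nat.pow_le_pow_right (by norm_num) hk
        omega)
      rw [Nat.cast_zero]; exact MulChar.map_zero χ
    rw [Finset.sum_range_succ', hz, mul_zero, add_zero, Finset.range_eq_Ico,
      Finset.sum_Ico_add' (fun m : ℕ => ((Real.log m ^ j : ℝ) : ℂ) * χ m) 0 n 1]
    rfl
  have h1 : ‖∑ m ∈ Finset.Icc 1 n, lg j (fun i => χ i) m‖ ≤ 2 * (3:ℝ) ^ k * Real.log n ^ j := by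
    rw [h0]
    have := abel_mono (fun n : ℕ => Real.log n ^ j) (fun n => χ n) hmono
      (by simp only [Nat.cast_zero, Real.log_zero]; positivity) (3 ^ k : ℕ)
      (char_sum_bd _ χ hχ) n
    push_cast at this ⊢
    exact this
  have h2 : ‖∑ m ∈ Finset.Icc 1 n, lg j (fun i => χ i) m‖ ≤ n * Real.log n ^ j := by
    calc _ ≤ ∑ m ∈ Finset.Icc 1 n, Real.log n ^ j := by
          refine norm_sum_le_of_le _ fun m hm => ?_
          rw [lg, norm_mul, Complex.norm_real,
            Real.norm_of_nonneg (pow_nonneg (Real.log_natCast_nonneg _) _)]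
          calc _ ≤ Real.log m ^ j * 1 := mul_le_mul_of_nonneg_left
                (DirichletCharacter.norm_le_one _ _) (pow_nonneg (Real.log_natCast_nonneg _) _)
            _ ≤ _ := by rw [mul_one]; exact hmono (Finset.mem_Icc.1 hm).2
      _ = _ := by simp
  have hlogn : 0 ≤ Real.log n := Real.log_natCast_nonneg n
  have h3 : ‖∑ m ∈ Finset.Icc 1 n, lg j (fun i => χ i) m‖
      ≤ 6 * (n:ℝ) ^ (1 - 1 / (k:ℝ)) * Real.log n ^ j := by
    refine le_trans (le_min h2 h1) ?_
    rw [← min_mul_of_nonneg _ _ (pow_nonneg hlogn j)]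
    refine mul_le_mul_of_nonneg_right ?_ (pow_nonneg hlogn j)
    set u : ℝ := min (n:ℝ) (2 * 3 ^ k) with hu
    have hu0 : 0 < u := lt_min hn0 (by positivity)
    have hkk : 1 / (k:ℝ) ≤ 1 := by rw [div_le_one (by linarith)]; exact hk1
    have : u = u ^ (1 - 1/(k:ℝ)) * u ^ (1/(k:ℝ)) := by
      rw [← Real.rpow_add hu0]; simp
    rw [this]
    have e1 : u ^ (1 - 1/(k:ℝ)) ≤ (n:ℝ) ^ (1 - 1/(k:ℝ)) :=
      Real.rpow_le_rpow hu0.le (min_le_left _ _) (by linarith)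
    have e2 : u ^ (1/(k:ℝ)) ≤ 6 := by
      calc u ^ (1/(k:ℝ)) ≤ ((6:ℝ)^k) ^ (1/(k:ℝ)) := by
            refine Real.rpow_le_rpow hu0.le ((min_le_right _ _).trans ?_) (by positivity)
            calc (2:ℝ) * 3 ^ k ≤ 2 ^ k * 3 ^ k := by
                  refine mul_le_mul_of_nonneg_right ?_ (by positivity)
                  calc (2:ℝ) = 2 ^ 1 := by norm_num
                    _ ≤ 2 ^ k := pow_le_pow_right₀ (by norm_num) hk
              _ = 6 ^ k := by rw [← mul_pow]; norm_num
        _ = 6 := by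
            rw [one_div, Real.pow_rpow_inv_natCast (by norm_num) (by omega)]
    calc _ ≤ (n:ℝ) ^ (1 - 1/(k:ℝ)) * 6 := mul_le_mul e1 e2 (by positivity) (by positivity)
      _ = _ := by ring
  have h4 : Real.log n ^ j ≤ j.factorial * (2 * k) ^ j * (n:ℝ) ^ (1 / (2 * k : ℝ)) := by
    have := Real.pow_div_factorial_le_exp (Real.log n / (2 * k)) (by positivity) j
    have hexp : Real.exp (Real.log n / (2 * k)) = (n:ℝ) ^ (1 / (2 * k : ℝ)) := by
      rw [Real.rpow_def_of_pos hn0]; ring_nf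
    rw [hexp, div_pow, div_div, div_le_iff₀ (by positivity)] at this
    calc _ ≤ _ := this
      _ = _ := by ring
  calc _ ≤ _ := h3
    _ ≤ 6 * (n:ℝ) ^ (1 - 1 / (k:ℝ)) * (j.factorial * (2 * k) ^ j * (n:ℝ) ^ (1 / (2 * k : ℝ))) :=
        mul_le_mul_of_nonneg_left h4 (by positivity)
    _ = 6 * j.factorial * (2 * k) ^ j * ((n:ℝ) ^ (1 - 1 / (k:ℝ)) * (n:ℝ) ^ (1 / (2 * k : ℝ))) := by
        ring
    _ = _ := by
        rw [← Real.rpow_add hn0]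
        congr 2
        field_simp
        ring

theorem lg_summable (W : ℕ) (hW : W ≠ 0) (j : ℕ) (χ : DirichletCharacter ℂ W) (s : ℂ)
    (hs : 1 < s.re) : LSeriesSummable (lg j (fun n => χ n)) s := by
  rw [← lg_eq]
  refine LSeriesSummable_of_abscissaOfAbsConv_lt_re ?_
  rw [LSeries.absicssaOfAbsConv_logPowMul, DirichletCharacter.absicssaOfAbsConv_eq_one hW]
  exact_mod_cast hs

theorem lg_bound (k j : ℕ) (hk : 1 ≤ k) (χ : DirichletCharacter ℂ (3 ^ k)) (hχ : χ ≠ 1)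
    (s : ℂ) (hs : 1 < s.re) :
    ‖LSeries (lg j (fun n => χ n)) s‖ ≤ 6 * j.factorial * (2 * k) ^ (j + 1) * ‖s‖ := by
  have hk1 : (1:ℝ) ≤ k := by exact_mod_cast hk
  have hkk : 1 / (2 * k : ℝ) ≤ 1 / 2 := by
    rw [div_le_div_iff₀ (by positivity) (by norm_num)]; linarith
  have := norm_LSeries_bd (lg j (fun n => χ n)) 0 (6 * j.factorial * (2 * k) ^ j)
    (1 - 1 / (2 * k : ℝ)) le_rfl (by positivity) (by linarith)
    (by have : 0 < 1 / (2 * k : ℝ) := by positivity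
        linarith) s hs (lg_summable _ (by positivity) j χ s hs) ?_
  · calc _ ≤ _ := this
      _ = _ := by rw [sub_sub_cancel]; field_simp; ring
  · intro t ht
    have hf : 1 ≤ ⌊t⌋₊ := Nat.one_le_floor_iff _ |>.2 ht
    rw [Complex.ofReal_zero, zero_mul, sub_zero]
    refine (lg_partial k j hk χ hχ _ hf).trans ?_
    refine mul_le_mul_of_nonneg_left ?_ (by positivity)
    exact Real.rpow_le_rpow (by positivity) (Nat.floor_le (by linarith)) (by linarith)

theorem triv_partial (k : ℕ) (hk : 1 ≤ k) (n : ℕ) :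
    ∑ m ∈ Finset.Icc 1 n, (1 : DirichletCharacter ℂ (3 ^ k)) m = (n : ℂ) - ((n / 3 : ℕ) : ℂ) := by
  induction n with
  | zero => simp
  | succ n ih =>
    rw [Finset.sum_Icc_succ_top (by omega), ih, Nat.succ_div]
    have hco : IsUnit ((n + 1 : ℕ) : ZMod (3 ^ k)) ↔ ¬ 3 ∣ n + 1 := by
      rw [ZMod.isUnit_iff_coprime, Nat.coprime_pow_right_iff (by omega), Nat.coprime_comm,
        Nat.Prime.coprime_iff_not_dvd Nat.prime_three]
    by_cases h : 3 ∣ n + 1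
    · rw [MulChar.map_nonunit _ (by rw [hco]; simpa using h), if_pos h]
      push_cast; ring
    · rw [MulChar.one_apply (hco.2 h), if_neg h]
      push_cast; ring

theorem triv_bound (k : ℕ) (hk : 1 ≤ k) (s : ℂ) (hs : 1 < s.re) :
    ‖LSeries (fun n => (1 : DirichletCharacter ℂ (3 ^ k)) n) s‖ ≤ ‖s‖ * (1 / ‖s - 1‖ + 2) := by
  have := norm_LSeries_bd (fun n => (1 : DirichletCharacter ℂ (3 ^ k)) n) (2/3) 2 0 (by norm_num)
    (by norm_num) le_rfl one_pos s hs
    (DirichletCharacter.LSeriesSummable_of_one_lt_re _ hs) ?_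
  · refine this.trans (mul_le_mul_of_nonneg_left ?_ (norm_nonneg _))
    have : (2/3:ℝ) / ‖s-1‖ ≤ 1 / ‖s - 1‖ :=
      div_le_div_of_nonneg_right (by norm_num) (norm_nonneg _)
    linarith
  · intro t ht
    rw [triv_partial k hk, Real.rpow_zero, mul_one]
    set n := ⌊t⌋₊
    have h1 : (n:ℝ) ≤ t := Nat.floor_le (by linarith)
    have h2 : t < n + 1 := Nat.lt_floor_add_one t
    have h3 : ((n:ℂ) - ((n/3:ℕ):ℂ) - ((2/3:ℝ):ℂ) * t) = (((n:ℝ) - ((n/3:ℕ):ℝ) - 2/3 * t : ℝ) : ℂ) := by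
      push_cast; ring
    rw [h3, Complex.norm_real, Real.norm_eq_abs, abs_le]
    have h4 : 3 * (n / 3) ≤ n := Nat.mul_div_le n 3
    have h5 : n ≤ 3 * (n / 3) + 2 := by omega
    have h4' : (3:ℝ) * ((n/3:ℕ):ℝ) ≤ n := by exact_mod_cast h4
    have h5' : (n:ℝ) ≤ 3 * ((n/3:ℕ):ℝ) + 2 := by exact_mod_cast h5
    constructor <;> linarith

end PPF

namespace PPF

open Complex

theorem lower_abs (l l' : ℝ → ℂ) (M : ℝ) (hM : 1 ≤ M)
    (hd : ∀ x ∈ Set.Ioc (0:ℝ) 1, HasDerivAt l (l' x) x)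
    (hl' : ∀ x ∈ Set.Ioc (0:ℝ) 1, ‖l' x‖ ≤ M)
    (h : ∀ x ∈ Set.Ioc (0:ℝ) 1, 1 ≤ (8 / x) ^ 3 * ‖l x‖ ^ 4 * M)
    (x : ℝ) (hx : x ∈ Set.Ioc (0:ℝ) 1) : 1 / (8192 * M ^ 4) ≤ ‖l x‖ := by
  have hM0 : 0 < M := by linarith
  set θ : ℝ := 1 / (8192 * M ^ 5) with hθ
  have hθ0 : 0 < θ := by positivity
  have hM5 : 1 ≤ M ^ 5 := one_le_pow₀ hM
  have hθ1 : θ ≤ 1 := by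
    rw [hθ, div_le_one (by positivity)]; linarith
  have hθM : θ * (8192 * M ^ 5) = 1 := by rw [hθ]; field_simp
  have hgoal : 1 / (8192 * M ^ 4) = θ * M := by rw [hθ]; field_simp
  have hbig : ∀ z ∈ Set.Ioc (0:ℝ) 1, θ ≤ z → 2 * θ * M ≤ ‖l z‖ := by
    intro z hz hzθ
    have h1 := h z hz
    have hz0 : 0 < z := hz.1
    have h2 : z ^ 3 ≤ 512 * ‖l z‖ ^ 4 * M := by
      have : (8 / z) ^ 3 * ‖l z‖ ^ 4 * M = (512 * ‖l z‖ ^ 4 * M) / z ^ 3 := by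
        field_simp; ring
      rw [this, le_div_iff₀ (by positivity)] at h1
      linarith
    have h3 : θ ^ 3 ≤ 512 * ‖l z‖ ^ 4 * M := (pow_le_pow_left₀ hθ0.le hzθ 3).trans h2
    have h4 : (2 * θ * M) ^ 4 ≤ ‖l z‖ ^ 4 := by
      have : (2 * θ * M) ^ 4 * (512 * M) = θ ^ 3 * (θ * (8192 * M ^ 5)) := by ring
      rw [hθM, mul_one] at this
      have h5 : (2 * θ * M) ^ 4 * (512 * M) ≤ ‖l z‖ ^ 4 * (512 * M) := by rw [this]; linarith
      exact le_of_mul_le_mul_right h5 (by positivity)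
    exact le_of_pow_le_pow_left₀ (by norm_num) (norm_nonneg _) h4
  rw [hgoal]
  have hpos : 0 < θ * M := by positivity
  rcases le_total θ x with hc | hc
  · have := hbig x hx hc
    linarith
  · have h1 := hbig θ ⟨hθ0, hθ1⟩ le_rfl
    have h2 : ‖l θ - l x‖ ≤ M * ‖θ - x‖ :=
      Convex.norm_image_sub_le_of_norm_hasDerivWithin_le
        (fun z hz => (hd z hz).hasDerivWithinAt) hl' (convex_Ioc 0 1) hx ⟨hθ0, hθ1⟩
    have h3 : ‖θ - x‖ ≤ θ := by
      rw [Real.norm_eq_abs, abs_le]; constructor <;> linarith [hx.1]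
    have h4 : ‖l θ‖ ≤ ‖l θ - l x‖ + ‖l x‖ := by
      have := norm_add_le (l θ - l x) (l x)
      rwa [sub_add_cancel] at this
    nlinarith

theorem quad_val (W k : ℕ) (hW : W = 3 ^ k) (hk : 1 ≤ k) (χ : DirichletCharacter ℂ W) (hχ : χ ≠ 1)
    (hχ2 : χ ^ 2 = 1) (n : ℕ) :
    χ (n : ZMod W) = if n % 3 = 1 then 1 else if n % 3 = 2 then -1 else 0 := by
  have hunit : ∀ n : ℕ, IsUnit ((n : ℕ) : ZMod W) ↔ ¬ 3 ∣ n := by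
    intro n
    rw [ZMod.isUnit_iff_coprime, hW, Nat.coprime_pow_right_iff (by omega), Nat.coprime_comm,
        Nat.Prime.coprime_iff_not_dvd Nat.prime_three]
  have hsq : ∀ n : ℕ, ¬ 3 ∣ n → χ (n : ZMod W) ^ 2 = 1 := by
    intro n hn
    rw [← MulChar.pow_apply' χ (by norm_num), hχ2, MulChar.one_apply ((hunit n).2 hn)]
  have hone : ∀ n : ℕ, n % 3 = 1 → χ (n : ZMod W) = 1 := by
    intro n hn
    have h3 : ∀ m : ℕ, ((n : ℤ) ^ (3 ^ m)) ≡ 1 [ZMOD 3 ^ (m + 1)] := by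
      intro m
      induction m with
      | zero =>
        simp only [pow_zero, pow_one, zero_add]
        have : ((n % 3 : ℕ) : ℤ) = 1 := by rw [hn]; rfl
        push_cast at this
        exact this
      | succ m ih =>
        obtain ⟨c, hc⟩ := (Int.modEq_iff_dvd.1 ih.symm)
        have e : (n:ℤ) ^ 3 ^ m = 1 + 3 ^ (m+1) * c := by linarith
        rw [pow_succ 3 m, pow_mul, e]
        refine (Int.modEq_iff_dvd.2 ?_).symm
        refine ⟨c + 3 ^ (m+1) * c ^ 2 + (3:ℤ) ^ (2*m+1) * c ^ 3, ?_⟩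
        rw [show 2*m+1 = m + m + 1 by ring]
        ring
    have h4 : ((n : ZMod W)) ^ (3 ^ (k-1)) = 1 := by
      have := h3 (k-1)
      rw [Nat.sub_add_cancel hk] at this
      have h5 : (((n:ℤ) ^ (3^(k-1)) : ℤ) : ZMod W) = ((1:ℤ) : ZMod W) := by
        rw [ZMod.intCast_eq_intCast_iff, hW]
        exact_mod_cast this
      push_cast at h5
      exact h5
    have h5 : χ (n : ZMod W) ^ (3 ^ (k-1)) = 1 := by rw [← map_pow, h4, map_one]
    have hodd : Odd (3 ^ (k-1)) := Odd.pow (by decide)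
    obtain ⟨c, hc⟩ := hodd
    have h6 := hsq n (by omega)
    rw [hc, pow_succ, pow_mul, h6, one_pow, one_mul] at h5
    exact h5
  have hmul : ∀ n : ℕ, n % 3 = 2 → χ (n : ZMod W) * χ ((2:ℕ) : ZMod W) = 1 := by
    intro n hn
    rw [← map_mul, ← Nat.cast_mul]
    exact hone _ (by omega)
  have h22 := hsq 2 (by norm_num)
  have h2 : χ ((2:ℕ) : ZMod W) = -1 := by
    rcases sq_eq_one_iff.1 h22 with h | h
    · exfalso
      apply hχ
      have : NeZero W := ⟨by rw [hW]; positivity⟩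
      ext a
      obtain ⟨u, hu⟩ : ∃ u : ℕ, (u : ZMod W) = (a : ZMod W) := ⟨(a : ZMod W).val, by simp⟩
      have hu3 : ¬ 3 ∣ u := (hunit u).1 (by rw [hu]; exact a.isUnit)
      rw [← hu, MulChar.one_apply ((hunit u).2 hu3)]
      rcases (by omega : u % 3 = 1 ∨ u % 3 = 2) with h1 | h1
      · exact hone u h1
      · have := hmul u h1
        rwa [h, mul_one] at this
    · exact h
  split_ifs with h1 h3
  · exact hone n h1
  · have := hmul n h3
    rw [h2] at this
    linear_combination -this
  · exact MulChar.map_nonunit _ (by rw [hunit]; omega)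

theorem quad_lower : ∃ c : ℝ, 0 < c ∧ ∀ k : ℕ, 1 ≤ k → ∀ χ : DirichletCharacter ℂ (3 ^ k), χ ≠ 1 →
    χ ^ 2 = 1 → ∀ s : ℂ, 1 < s.re → s.re ≤ 2 → |s.im| ≤ 1 →
    c ≤ ‖LSeries (fun n => χ n) s‖ := by
  have : Fact (Nat.Prime 3) := ⟨Nat.prime_three⟩
  set ψ : DirichletCharacter ℂ 3 := (quadraticChar (ZMod 3)).ringHomComp (Int.castRingHom ℂ) with hψ
  have hψ1 : ψ ≠ 1 := by
    rw [hψ]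
    refine (MulChar.ringHomComp_ne_one_iff Int.cast_injective).2 (quadraticChar_ne_one ?_)
    rw [ZMod.ringChar_zmod_n]; norm_num
  have hψ2 : ψ ^ 2 = 1 := by
    rw [hψ, MulChar.ringHomComp_pow, (quadraticChar_isQuadratic (ZMod 3)).sq_eq_one,
      MulChar.ringHomComp_one]
  have hcont : Continuous (DirichletCharacter.LFunction ψ) :=
    (DirichletCharacter.differentiable_LFunction hψ1).continuous
  have hcomp : IsCompact ((Set.Icc (1:ℝ) 2) ×ℂ (Set.Icc (-1:ℝ) 1)) :=
    isCompact_Icc.reProdIm isCompact_Icc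
  have hne : ((Set.Icc (1:ℝ) 2) ×ℂ (Set.Icc (-1:ℝ) 1)).Nonempty :=
    ⟨1, by simp [Complex.mem_reProdIm]⟩
  obtain ⟨z, hz, hmin⟩ := hcomp.exists_isMinOn hne hcont.norm.continuousOn
  refine ⟨‖DirichletCharacter.LFunction ψ z‖, ?_, ?_⟩
  · rw [norm_pos_iff]
    exact DirichletCharacter.LFunction_ne_zero_of_one_le_re ψ (Or.inl hψ1) hz.1.1
  · intro k hk χ hχ hχ2 s hs1 hs2 hs3
    have e : (fun n : ℕ => χ (n : ZMod (3^k))) = (fun n : ℕ => ψ (n : ZMod 3)) := by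
      funext n
      rw [quad_val _ k rfl hk χ hχ hχ2, quad_val 3 1 (by norm_num) le_rfl ψ hψ1 hψ2]
    rw [e, ← DirichletCharacter.LFunction_eq_LSeries ψ hs1]
    exact hmin (show s ∈ _ from ⟨⟨hs1.le, hs2⟩, abs_le.1 hs3⟩)

theorem L_lower : ∃ c : ℝ, 0 < c ∧ ∀ k : ℕ, 1 ≤ k → ∀ χ : DirichletCharacter ℂ (3 ^ k), χ ≠ 1 →
    ∀ s : ℂ, 1 < s.re → s.re ≤ 2 →
    c / (k * (1 + |s.im|)) ^ 8 ≤ ‖LSeries (fun n => χ n) s‖ := by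
  obtain ⟨c, hc, hq⟩ := quad_lower
  refine ⟨min c (1 / (8192 * 48 ^ 4)), lt_min hc (by norm_num), ?_⟩
  intro k hk χ hχ s hs1 hs2
  have hk1 : (1:ℝ) ≤ k := by exact_mod_cast hk
  set y := s.im with hy
  set X : ℝ := k * (1 + |y|) with hX
  have hy0 := abs_nonneg y
  have hX1 : 1 ≤ X := by rw [hX]; nlinarith
  by_cases hcase : χ ^ 2 = 1 ∧ |y| ≤ 1
  · refine le_trans ?_ (hq k hk χ hχ hcase.1 s hs1 hs2 hcase.2)
    calc _ ≤ min c (1 / (8192 * 48 ^ 4)) := div_le_self (by positivity) (one_le_pow₀ hX1)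
      _ ≤ c := min_le_left _ _
  · set M : ℝ := 48 * X ^ 2 with hMd
    have hXX : X ≤ X ^ 2 := by nlinarith
    have hM1 : 1 ≤ M := by rw [hMd]; nlinarith
    set f : ℕ → ℂ := fun n => χ n with hf
    have hnorm : ∀ x ∈ Set.Ioc (0:ℝ) 1, ∀ u : ℝ, ‖(1 + x + I * u : ℂ)‖ ≤ 2 + |u| := by
      intro x hx u
      have : (1 + x + I * u : ℂ) = ((1 + x : ℝ) : ℂ) + I * u := by push_cast; ring
      rw [this]
      refine (norm_add_le _ _).trans ?_
      rw [norm_mul, Complex.norm_I, Complex.norm_real, Complex.norm_real, one_mul,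
        Real.norm_eq_abs, Real.norm_eq_abs, abs_of_pos (by linarith [hx.1])]
      linarith [hx.2]
    have hre : ∀ x ∈ Set.Ioc (0:ℝ) 1, ∀ u : ℝ, 1 < (1 + x + I * u : ℂ).re := by
      intro x hx u; simp [hx.1]
    have key := lower_abs (fun x : ℝ => LSeries f (1 + x + I * y))
      (fun x : ℝ => -LSeries (LSeries.logMul f) (1 + x + I * y)) M hM1 ?_ ?_ ?_ (s.re - 1)
      ⟨by linarith, by linarith⟩
    · have hs : (1 + ((s.re - 1 : ℝ) : ℂ) + I * (y:ℂ)) = s := by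
        apply Complex.ext <;> simp [hy]
      simp only [hs] at key
      refine le_trans ?_ key
      calc _ ≤ (1 / (8192 * 48 ^ 4)) / X ^ 8 :=
            div_le_div_of_nonneg_right (min_le_right _ _) (by positivity)
        _ = _ := by rw [hMd]; field_simp
    · intro x hx
      have h1 : HasDerivAt (LSeries f) (-LSeries (LSeries.logMul f) (1 + x + I * y))
          (1 + (x:ℂ) + I * y) := by
        refine LSeries_hasDerivAt ?_
        rw [hf, DirichletCharacter.absicssaOfAbsConv_eq_one (by positivity)]
        exact_mod_cast hre x hx y
      have h2 : HasDerivAt (fun z : ℂ => 1 + z + I * y) 1 (x:ℂ) :=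
        ((hasDerivAt_id (x:ℂ)).const_add 1).add_const (I * (y:ℂ))
      have h3 := (HasDerivAt.comp (x:ℂ) h1 h2).comp_ofReal
      simpa using h3
    · intro x hx
      have h1 := lg_bound k 1 hk χ hχ (1 + x + I * y) (hre x hx y)
      rw [← lg_eq, Function.iterate_one] at h1
      rw [norm_neg]
      refine h1.trans ?_
      have h2 := hnorm x hx y
      have h3 : 6 * ((1:ℕ).factorial:ℝ) * (2 * (k:ℝ)) ^ (1+1) * ‖(1 + x + I * y : ℂ)‖
          ≤ 24 * k ^ 2 * (2 * (1 + |y|)) := by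
        rw [Nat.factorial_one]
        calc _ = 24 * (k:ℝ) ^ 2 * ‖(1 + x + I * y : ℂ)‖ := by push_cast; ring
          _ ≤ _ := by
              refine mul_le_mul_of_nonneg_left (by linarith) (by positivity)
      refine h3.trans ?_
      rw [hMd, hX, mul_pow]
      have : 1 + |y| ≤ (1 + |y|) ^ 2 := by nlinarith
      calc _ = 48 * ((k:ℝ)^2 * (1 + |y|)) := by ring
        _ ≤ _ := by gcongr
    · intro x hx
      have h1 := DirichletCharacter.norm_LSeries_product_ge_one χ hx.1 y
      rw [norm_mul, norm_mul, norm_pow, norm_pow] at h1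
      have hx0 := hx.1
      have hx1 := hx.2
      have e1 : ‖LSeries (fun n => (1 : DirichletCharacter ℂ (3 ^ k)) n) (1 + x)‖ ≤ 8 / x := by
        have h2 := triv_bound k hk (1 + x) (by simp [hx.1])
        have h3 := hnorm x hx 0
        have h4 : ‖(1 + (x:ℂ)) - 1‖ = x := by
          rw [add_sub_cancel_left, Complex.norm_real, Real.norm_of_nonneg hx.1.le]
        rw [h4] at h2
        simp only [Complex.ofReal_zero, mul_zero, add_zero, abs_zero] at h3
        refine h2.trans ?_
        calc _ ≤ 2 * (1 / x + 2) := mul_le_mul_of_nonneg_right h3 (by positivity)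
          _ ≤ 8 / x := by
              rw [le_div_iff₀ hx0]
              have : 2 * (1 / x + 2) * x = 2 + 4 * x := by field_simp; ring
              rw [this]; linarith
      have e2 : ‖LSeries (fun n => (χ ^ 2 : DirichletCharacter ℂ (3^k)) n) (1 + x + 2 * I * y)‖ ≤ M := by
        have hss : (1 + x + 2 * I * y : ℂ) = 1 + x + I * ((2 * y : ℝ) : ℂ) := by push_cast; ring
        rw [hss]
        have h2 := hnorm x hx (2 * y)
        rw [abs_mul, abs_two] at h2
        by_cases hc2 : χ ^ 2 = 1
        · have hy1 : 1 < |y| := by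
            by_contra hcon
            exact hcase ⟨hc2, not_lt.1 hcon⟩
          rw [hc2]
          have h3 := triv_bound k hk (1 + x + I * ((2 * y : ℝ) : ℂ)) (hre x hx _)
          have h4 : 1 ≤ ‖(1 + x + I * ((2 * y : ℝ) : ℂ)) - 1‖ := by
            refine le_trans ?_ (Complex.abs_im_le_norm _)
            simp only [Complex.sub_im, Complex.add_im, Complex.one_im, Complex.ofReal_im,
              Complex.mul_im, Complex.I_re, Complex.I_im, Complex.ofReal_re]
            rw [show (0 + 0 + (0 * 0 + 1 * (2 * y)) - 0 : ℝ) = 2 * y by ring, abs_mul, abs_two]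
            linarith
          have h5 : 1 / ‖(1 + x + I * ((2 * y : ℝ) : ℂ)) - 1‖ ≤ 1 := by
            rw [div_le_one (by linarith)]; exact h4
          refine h3.trans ?_
          calc _ ≤ (2 + 2 * |y|) * (1 + 2) :=
                mul_le_mul h2 (by linarith) (by positivity) (by positivity)
            _ ≤ 48 * X := by rw [hX]; nlinarith
            _ ≤ M := by rw [hMd]; linarith
        · have h3 := lg_bound k 0 hk (χ^2) hc2 (1 + x + I * ((2 * y : ℝ) : ℂ)) (hre x hx _)
          rw [← lg_eq, Function.iterate_zero, id] at h3
          refine h3.trans ?_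
          rw [Nat.factorial_zero]
          calc _ = 12 * (k:ℝ) * ‖(1 + x + I * ((2 * y : ℝ) : ℂ))‖ := by push_cast; ring
            _ ≤ 12 * (k:ℝ) * (2 + 2 * |y|) := mul_le_mul_of_nonneg_left h2 (by positivity)
            _ ≤ 48 * X := by rw [hX]; nlinarith
            _ ≤ M := by rw [hMd]; linarith
      calc (1:ℝ) ≤ _ := h1
        _ ≤ _ := by
            refine mul_le_mul (mul_le_mul_of_nonneg_right ?_ (by positivity)) e2 (norm_nonneg _)
              (by positivity)
            exact pow_le_pow_left₀ (norm_nonneg _) e1 3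

end PPF

namespace PPF

open Complex MeasureTheory ArithmeticFunction

/-- Twisted von Mangoldt coefficients. -/
noncomputable def vm {W : ℕ} (χ : DirichletCharacter ℂ W) (n : ℕ) : ℂ := χ n * (vonMangoldt n : ℂ)

theorem vm_absc {W : ℕ} (χ : DirichletCharacter ℂ W) (s : ℂ) (hs : 1 < s.re) :
    LSeries.abscissaOfAbsConv (vm χ) < s.re := by
  have h : LSeries.abscissaOfAbsConv (vm χ) ≤ (1:ℝ) := by
    refine LSeries.abscissaOfAbsConv_le_of_forall_lt_LSeriesSummable fun y hy => ?_
    exact DirichletCharacter.LSeriesSummable_twist_vonMangoldt χ (by simpa using hy)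
  exact lt_of_le_of_lt h (by exact_mod_cast hs)

theorem vm_lg_summable {W : ℕ} (χ : DirichletCharacter ℂ W) (j : ℕ) (s : ℂ) (hs : 1 < s.re) :
    LSeriesSummable (lg j (vm χ)) s := by
  rw [← lg_eq]
  refine LSeriesSummable_of_abscissaOfAbsConv_lt_re ?_
  rw [LSeries.absicssaOfAbsConv_logPowMul]
  exact vm_absc χ s hs

theorem recur {W : ℕ} (hW : W ≠ 0) (χ : DirichletCharacter ℂ W) (j : ℕ) (s : ℂ) (hs : 1 < s.re) :
    LSeries (lg (j+1) (fun n => χ n)) s = ∑ i ∈ Finset.range (j+1),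
      (j.choose i : ℂ) * LSeries (lg i (vm χ)) s * LSeries (lg (j - i) (fun n => χ n)) s := by
  have ha : ∀ z : ℂ, 1 < z.re → LSeries.abscissaOfAbsConv (fun n : ℕ => χ n) < z.re := by
    intro z hz
    rw [DirichletCharacter.absicssaOfAbsConv_eq_one hW]
    exact_mod_cast hz
  have hopen : {z : ℂ | 1 < z.re} ∈ nhds s :=
    (isOpen_lt continuous_const Complex.continuous_re).mem_nhds hs
  have h1 : deriv (LSeries (fun n : ℕ => χ n)) =ᶠ[nhds s]
      fun z => -((LSeries (vm χ) * LSeries (fun n : ℕ => χ n)) z) := by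
    filter_upwards [hopen] with z hz
    have hz1 : 1 < z.re := hz
    have h2 := DirichletCharacter.LSeries_twist_vonMangoldt_eq χ hz1
    have h3 := DirichletCharacter.LSeries_ne_zero_of_one_lt_re χ hz1
    rw [eq_div_iff h3] at h2
    have h4 : LSeries (vm χ) z * LSeries (fun n : ℕ => χ n) z
      = -deriv (LSeries (fun n : ℕ => χ n)) z := h2
    rw [Pi.mul_apply, h4, neg_neg]
  have hcd : ∀ f : ℕ → ℂ, LSeries.abscissaOfAbsConv f < s.re → ContDiffAt ℂ j (LSeries f) s := by
    intro f hf
    exact (LSeries_analyticOnNhd f s hf).contDiffAt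
  have h5 := LSeries_iteratedDeriv (j+1) (ha s hs)
  rw [iteratedDeriv_succ', Filter.EventuallyEq.iteratedDeriv_eq j h1] at h5
  rw [iteratedDeriv_fun_neg, iteratedDeriv_mul (hcd _ (vm_absc χ s hs)) (hcd _ (ha s hs)), lg_eq] at h5
  have h6 : ∀ i ∈ Finset.range (j+1), (j.choose i : ℂ) * iteratedDeriv i (LSeries (vm χ)) s
      * iteratedDeriv (j - i) (LSeries (fun n : ℕ => χ n)) s
      = (-1) ^ j * ((j.choose i : ℂ) * LSeries (lg i (vm χ)) s
        * LSeries (lg (j - i) (fun n => χ n)) s) := by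
    intro i hi
    have hij : i ≤ j := by have := Finset.mem_range.1 hi; omega
    rw [LSeries_iteratedDeriv _ (vm_absc χ s hs), LSeries_iteratedDeriv _ (ha s hs), lg_eq, lg_eq]
    have : ((-1:ℂ)) ^ j = (-1) ^ i * (-1) ^ (j - i) := by rw [← pow_add]; congr 1; omega
    rw [this]; ring
  rw [Finset.sum_congr rfl h6, ← Finset.mul_sum] at h5
  have h7 : ((-1:ℂ)) ^ j ≠ 0 := pow_ne_zero _ (by norm_num)
  rw [pow_succ] at h5
  have : (-1:ℂ)^j * (∑ i ∈ Finset.range (j+1),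
      (j.choose i : ℂ) * LSeries (lg i (vm χ)) s * LSeries (lg (j - i) (fun n => χ n)) s)
      = (-1)^j * LSeries (lg (j+1) (fun n => χ n)) s := by linear_combination -h5
  exact (mul_left_cancel₀ h7 this).symm

theorem F_bound (J : ℕ) : ∃ C : ℝ, 0 ≤ C ∧ ∃ e : ℕ, ∀ i ≤ J, ∀ k : ℕ, 1 ≤ k →
    ∀ χ : DirichletCharacter ℂ (3 ^ k), χ ≠ 1 → ∀ s : ℂ, 1 < s.re → s.re ≤ 2 →
    ‖LSeries (lg i (vm χ)) s‖ ≤ C * (k * (1 + |s.im|)) ^ e := by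
  obtain ⟨c, hc, hlow⟩ := L_lower
  have hup : ∀ j k : ℕ, 1 ≤ k → ∀ χ : DirichletCharacter ℂ (3 ^ k), χ ≠ 1 → ∀ s : ℂ, 1 < s.re →
      s.re ≤ 2 → ∀ J : ℕ, j ≤ J → ‖LSeries (lg j (fun n => χ n)) s‖
        ≤ 12 * J.factorial * 2 ^ (J+1) * (k * (1 + |s.im|)) ^ (J + 1) := by
    intro j k hk χ hχ s hs1 hs2 J hj
    have hk1 : (1:ℝ) ≤ k := by exact_mod_cast hk
    have hy0 := abs_nonneg s.im
    refine (lg_bound k j hk χ hχ s hs1).trans ?_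
    have hn : ‖s‖ ≤ 2 * (1 + |s.im|) := by
      refine (Complex.norm_le_abs_re_add_abs_im s).trans ?_
      rw [abs_of_pos (by linarith)]; linarith
    have h1 : (j.factorial:ℝ) ≤ J.factorial := by exact_mod_cast Nat.factorial_le hj
    have h2 : (2 * (k:ℝ)) ^ (j+1) ≤ (2 * (k:ℝ)) ^ (J+1) :=
      pow_le_pow_right₀ (by linarith) (by omega)
    have h3 : 1 + |s.im| ≤ (1 + |s.im|) ^ (J+1) := le_self_pow₀ (by linarith) (by omega)
    calc _ ≤ 6 * (J.factorial:ℝ) * (2 * (k:ℝ)) ^ (J+1) * (2 * (1 + |s.im|) ^ (J+1)) := by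
          gcongr
          linarith
      _ = _ := by rw [mul_pow, mul_pow]; ring
  induction J with
  | zero =>
    refine ⟨(12 * (1:ℕ).factorial * 2 ^ (1+1)) / c, by positivity, 10, ?_⟩
    intro i hi k hk χ hχ s hs1 hs2
    obtain rfl : i = 0 := by omega
    have hk1 : (1:ℝ) ≤ k := by exact_mod_cast hk
    have h1 := recur (by positivity) χ 0 s hs1
    simp only [zero_add, Finset.range_one, Finset.sum_singleton, Nat.choose_zero_right,
      Nat.cast_one, one_mul, Nat.sub_zero] at h1
    have h2 := hup 1 k hk χ hχ s hs1 hs2 1 le_rfl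
    rw [h1, norm_mul] at h2
    have h3 := hlow k hk χ hχ s hs1 hs2
    have h0 : lg 0 (fun n : ℕ => χ n) = fun n : ℕ => χ n := by rw [← lg_eq]; rfl
    rw [h0] at h2
    set X : ℝ := k * (1 + |s.im|)
    have hX : 0 < X := by positivity
    have h4 : ‖LSeries (lg 0 (vm χ)) s‖ * (c / X ^ 8)
        ≤ 12 * ((1:ℕ).factorial:ℝ) * 2 ^ (1+1) * X ^ (1+1) :=
      (mul_le_mul_of_nonneg_left h3 (norm_nonneg _)).trans h2
    rw [← le_div_iff₀ (by positivity)] at h4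
    refine h4.trans (le_of_eq ?_)
    field_simp
  | succ J ih =>
    obtain ⟨C, hC, e, hF⟩ := ih
    set A : ℝ := 12 * (J+2).factorial * 2 ^ (J+2+1) with hA
    have hA0 : 0 ≤ A := by positivity
    refine ⟨C + (A + ∑ i ∈ Finset.range (J+1), ((J+1).choose i : ℝ) * C * A) / c, by positivity,
      e + (J + 2 + 1) + 8, ?_⟩
    intro i hi k hk χ hχ s hs1 hs2
    have hk1 : (1:ℝ) ≤ k := by exact_mod_cast hk
    set X : ℝ := k * (1 + |s.im|) with hX
    have hX1 : 1 ≤ X := by rw [hX]; nlinarith [abs_nonneg s.im]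
    have hX0 : 0 < X := by linarith
    set S : ℝ := ∑ i ∈ Finset.range (J+1), ((J+1).choose i : ℝ) * C * A with hS
    have hS0 : 0 ≤ S := by positivity
    rcases Nat.lt_or_ge i (J+1) with hi1 | hi1
    · refine (hF i (by omega) k hk χ hχ s hs1 hs2).trans ?_
      refine mul_le_mul ?_ (pow_le_pow_right₀ hX1 (by omega)) (by positivity) (by positivity)
      have : 0 ≤ (A + S) / c := by positivity
      linarith
    · obtain rfl : i = J + 1 := by omega
      have h1 := recur (by positivity) χ (J+1) s hs1
      rw [Finset.sum_range_succ, Nat.choose_self, Nat.cast_one, one_mul, Nat.sub_self] at h1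
      have h0 : lg 0 (fun n : ℕ => χ n) = fun n : ℕ => χ n := by rw [← lg_eq]; rfl
      rw [h0] at h1
      have h2 : LSeries (lg (J+1) (vm χ)) s * LSeries (fun n : ℕ => χ n) s
          = LSeries (lg (J+1+1) (fun n => χ n)) s - ∑ i ∈ Finset.range (J+1),
      ((J+1).choose i : ℂ) * LSeries (lg i (vm χ)) s * LSeries (lg (J+1 - i) (fun n => χ n)) s := by
        rw [h1]; ring
      have h3 : ‖LSeries (lg (J+1) (vm χ)) s‖ * ‖LSeries (fun n : ℕ => χ n) s‖
          ≤ (A + S) * X ^ (e + (J+2+1)) := by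
        rw [← norm_mul, h2]
        refine (norm_sub_le _ _).trans ?_
        have e1 : ‖LSeries (lg (J+1+1) (fun n => χ n)) s‖ ≤ A * X ^ (e + (J+2+1)) := by
          refine (hup (J+1+1) k hk χ hχ s hs1 hs2 (J+2) le_rfl).trans ?_
          rw [← hX, ← hA]
          exact mul_le_mul_of_nonneg_left (pow_le_pow_right₀ hX1 (by omega)) hA0
        have e2 : ‖∑ i ∈ Finset.range (J+1), ((J+1).choose i : ℂ) * LSeries (lg i (vm χ)) s
            * LSeries (lg (J+1 - i) (fun n => χ n)) s‖ ≤ S * X ^ (e + (J+2+1)) := by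
          rw [hS, Finset.sum_mul]
          refine norm_sum_le_of_le _ fun i hi => ?_
          rw [norm_mul, norm_mul, Complex.norm_natCast]
          have f1 := hF i (by have := Finset.mem_range.1 hi; omega) k hk χ hχ s hs1 hs2
          have f2 := hup (J+1-i) k hk χ hχ s hs1 hs2 (J+2) (by omega)
          rw [← hX] at f1
          rw [← hX, ← hA] at f2
          calc _ ≤ ((J+1).choose i : ℝ) * (C * X ^ e) * (A * X ^ (J+2+1)) := by gcongr
            _ = _ := by rw [pow_add]; ring
        linarith
      have h4 := hlow k hk χ hχ s hs1 hs2
      rw [← hX] at h4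
      have h5 : ‖LSeries (lg (J+1) (vm χ)) s‖ * (c / X ^ 8) ≤ (A + S) * X ^ (e + (J+2+1)) :=
        (mul_le_mul_of_nonneg_left h4 (norm_nonneg _)).trans h3
      rw [← le_div_iff₀ (by positivity)] at h5
      refine h5.trans ?_
      calc _ = (A + S) / c * X ^ (e + (J+2+1) + 8) := by rw [div_div_eq_mul_div]; ring
        _ ≤ _ := by
            refine mul_le_mul_of_nonneg_right ?_ (by positivity)
            linarith

theorem smooth_LSeries {φ : ℝ → ℝ} {g : ℝ → ℂ} (hbump : IsBump φ g) (f : ℕ → ℂ) (σ : ℝ)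
    (hf : LSeriesSummable f σ) (L : ℝ) :
    HasSum (fun n => LSeries.term f σ n * (φ (Real.log n - L) : ℂ))
      (∫ ξ : ℝ, g ξ * cexp (2 * Real.pi * I * ξ * (-L : ℝ))
        * LSeries f (σ - 2 * Real.pi * I * ξ)) := by
  have hg : AEStronglyMeasurable g := by
    by_contra hcon
    have h0 := hbump.inv 0
    have h1 : (∫ ξ : ℝ, g ξ * cexp (2 * Real.pi * I * ξ * (0 : ℝ))) = 0 := by
      simp only [ofReal_zero, mul_zero, Complex.exp_zero, mul_one]
      exact integral_non_aestronglyMeasurable hcon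
    rw [h1, hbump.eq_one 0 (by simp)] at h0
    simp at h0
  have hgi : Integrable g := (integrable_norm_iff hg).1 hbump.integ0
  have hintegr : ∀ u : ℝ, Integrable (fun ξ : ℝ => g ξ * cexp (2 * Real.pi * I * ξ * u)) := by
    intro u
    refine hgi.mul_bdd (c := 1) ?_ (Filter.Eventually.of_forall fun ξ => (norm_cexp_real ξ u).le)
    exact (Continuous.aestronglyMeasurable (by fun_prop))
  have hterm : ∀ (n : ℕ) (ξ : ℝ), LSeries.term f (σ - 2 * Real.pi * I * ξ) n
      = LSeries.term f σ n * cexp (2 * Real.pi * I * ξ * (Real.log n : ℝ)) := by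
    intro n ξ
    rcases eq_or_ne n 0 with rfl | hn
    · simp
    · have hn' : (n:ℂ) ≠ 0 := by exact_mod_cast hn
      rw [LSeries.term_of_ne_zero hn, LSeries.term_of_ne_zero hn, Complex.cpow_sub _ _ hn',
        Complex.cpow_def_of_ne_zero hn' (2 * Real.pi * I * ξ), ← Complex.natCast_log]
      rw [show (Real.log n : ℂ) * (2 * Real.pi * I * ξ) = 2 * Real.pi * I * ξ * (Real.log n : ℝ) by
        ring]
      rw [div_div_eq_mul_div]
      ring
  have key := hasSum_integral_of_summable_integral_norm
    (F := fun (n : ℕ) (ξ : ℝ) => LSeries.term f σ n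
      * (g ξ * cexp (2 * Real.pi * I * ξ * (Real.log n - L : ℝ)))) (μ := volume)
    (fun n => (hintegr _).const_mul _) ?_
  · have e1 : (fun n : ℕ => ∫ ξ : ℝ, LSeries.term f σ n
        * (g ξ * cexp (2 * Real.pi * I * ξ * (Real.log n - L : ℝ))))
        = fun n => LSeries.term f σ n * (φ (Real.log n - L) : ℂ) := by
      funext n
      rw [integral_const_mul, hbump.inv]
    have e2 : (fun ξ : ℝ => ∑' n : ℕ, LSeries.term f σ n
        * (g ξ * cexp (2 * Real.pi * I * ξ * (Real.log n - L : ℝ))))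
        = fun ξ : ℝ => g ξ * cexp (2 * Real.pi * I * ξ * (-L : ℝ))
        * LSeries f (σ - 2 * Real.pi * I * ξ) := by
      funext ξ
      rw [LSeries, ← tsum_mul_left]
      refine tsum_congr fun n => ?_
      rw [hterm, sub_eq_add_neg, Complex.ofReal_add, mul_add, Complex.exp_add]
      ring
    rw [e1, e2] at key
    exact key
  · have e3 : (fun n : ℕ => ∫ ξ : ℝ, ‖LSeries.term f σ n
        * (g ξ * cexp (2 * Real.pi * I * ξ * (Real.log n - L : ℝ)))‖)
        = fun n => ‖LSeries.term f σ n‖ * ∫ ξ, ‖g ξ‖ := by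
      funext n
      rw [← integral_const_mul]
      refine integral_congr_ae (Filter.Eventually.of_forall fun ξ => ?_)
      simp only [norm_mul, norm_cexp_real, mul_one]
    rw [e3]
    exact (hf.norm).mul_right _

theorem E_bound {φ : ℝ → ℝ} {g : ℝ → ℂ} (hbump : IsBump φ g) (J : ℕ) :
    ∃ C : ℝ, 0 ≤ C ∧ ∃ e : ℕ, ∀ k : ℕ, 1 ≤ k →
    ∀ χ : DirichletCharacter ℂ (3 ^ k), χ ≠ 1 → ∀ σ : ℝ, 1 < σ → σ ≤ 2 → ∀ L : ℝ, ∀ N : ℕ,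
    (∀ n : ℕ, N ≤ n → φ (Real.log n - L) = 0) →
    ‖∑ n ∈ Finset.range N, LSeries.term (lg J (vm χ)) σ n * (φ (Real.log n - L) : ℂ)‖
      ≤ C * (k:ℝ) ^ e := by
  obtain ⟨C, hC, e, hF⟩ := F_bound J
  refine ⟨C * 7 ^ e * ∫ ξ, (1 + |ξ|) ^ e * ‖g ξ‖, ?_, e, ?_⟩
  · exact mul_nonneg (by positivity) (integral_nonneg fun ξ => by positivity)
  intro k hk χ hχ σ hσ1 hσ2 L N hN
  have h1 := smooth_LSeries hbump (lg J (vm χ)) σ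
    (vm_lg_summable χ J σ (by simpa using hσ1)) L
  have h2 : HasSum (fun n : ℕ => LSeries.term (lg J (vm χ)) σ n * (φ (Real.log n - L) : ℂ))
      (∑ n ∈ Finset.range N, LSeries.term (lg J (vm χ)) σ n * (φ (Real.log n - L) : ℂ)) :=
    hasSum_sum_of_ne_finset_zero (by
      intro n hn
      rw [hN n (by simpa using hn)]; simp)
  rw [h2.unique h1]
  have hI : Integrable (fun ξ : ℝ => C * 7 ^ e * k ^ e * ((1 + |ξ|) ^ e * ‖g ξ‖)) :=
    (hbump.integ e).const_mul _
  calc _ ≤ ∫ ξ : ℝ, C * 7 ^ e * k ^ e * ((1 + |ξ|) ^ e * ‖g ξ‖) := by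
        refine norm_integral_le_of_norm_le hI (Filter.Eventually.of_forall fun ξ => ?_)
        rw [norm_mul, norm_mul, norm_cexp_real, mul_one]
        have h3 := hF J le_rfl k hk χ hχ (σ - 2 * Real.pi * I * ξ) (by simpa using hσ1)
          (by simpa using hσ2)
        have him : |(σ - 2 * Real.pi * I * ξ : ℂ).im| ≤ 7 * |ξ| := by
          have : (σ - 2 * Real.pi * I * ξ : ℂ).im = -(2 * Real.pi * ξ) := by simp
          rw [this, abs_neg, abs_mul, abs_of_pos (by positivity)]
          refine mul_le_mul_of_nonneg_right ?_ (abs_nonneg _)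
          linarith [Real.pi_lt_d2]
        have h4 : (k * (1 + |(σ - 2 * Real.pi * I * ξ : ℂ).im|)) ^ e
            ≤ ((k:ℝ) * (7 * (1 + |ξ|))) ^ e := by
          refine pow_le_pow_left₀ (by positivity) ?_ e
          refine mul_le_mul_of_nonneg_left ?_ (by positivity)
          linarith
        calc _ ≤ ‖g ξ‖ * (C * ((k:ℝ) * (7 * (1 + |ξ|))) ^ e) :=
              mul_le_mul_of_nonneg_left (h3.trans (mul_le_mul_of_nonneg_left h4 hC)) (norm_nonneg _)
          _ = _ := by rw [mul_pow, mul_pow]; ring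
    _ = _ := by rw [integral_const_mul]; ring

end PPF

namespace PPF

open ArithmeticFunction

theorem nonprime_sum (S : Finset ℕ) (y : ℝ) (hy : 1 ≤ y) (hS : ∀ n ∈ S, (n:ℝ) ≤ y) :
    ∑ n ∈ S with ¬ n.Prime, vonMangoldt n ≤ 2 * Real.sqrt y * Real.log y := by
  refine le_trans ?_ (Chebyshev.psi_sub_theta_le hy)
  rw [Chebyshev.psi_sub_theta_eq_sum_not_prime]
  have h0 : ∑ n ∈ S with ¬ n.Prime, vonMangoldt n
      = ∑ n ∈ S with (¬ n.Prime ∧ n ≠ 0), vonMangoldt n := by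
    rw [Finset.sum_filter, Finset.sum_filter]
    refine Finset.sum_congr rfl fun n _ => ?_
    by_cases hn : n = 0
    · simp [hn]
    · simp [hn]
  rw [h0]
  refine Finset.sum_le_sum_of_subset_of_nonneg ?_ (fun _ _ _ => vonMangoldt_nonneg)
  intro n hn
  rw [Finset.mem_filter] at hn ⊢
  refine ⟨Finset.mem_Ioc.2 ⟨Nat.pos_of_ne_zero hn.2.2, ?_⟩, hn.2.1⟩
  exact Nat.le_floor (hS n hn.1)

theorem np_numeric (x : ℝ) (hx : Real.exp 20 ≤ x) :
    2 * Real.sqrt (Real.exp 4 * x) * Real.log (Real.exp 4 * x) ≤ 30 * Real.sqrt x * Real.log x := by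
  have h20 : (1:ℝ) ≤ Real.exp 20 := Real.one_le_exp (by norm_num)
  have hx0 : 0 < x := by linarith
  have hl : 20 ≤ Real.log x := by rw [Real.le_log_iff_exp_le hx0]; exact hx
  rw [Real.log_mul (Real.exp_pos _).ne' hx0.ne', Real.log_exp, Real.sqrt_mul (Real.exp_pos _).le]
  have h1 : Real.sqrt (Real.exp 4) ≤ 7.5 := by
    rw [Real.sqrt_le_iff]; constructor
    · norm_num
    · linarith [exp_four_lt]
  have h2 := Real.sqrt_nonneg x
  have h3 := Real.sqrt_nonneg (Real.exp 4)
  calc 2 * (Real.sqrt (Real.exp 4) * Real.sqrt x) * (4 + Real.log x)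
      ≤ 2 * (7.5 * Real.sqrt x) * (2 * Real.log x) := by
        gcongr
        linarith
    _ = _ := by ring

/-- The weight used in the Siegel-Walfisz argument. -/
noncomputable def wt (φ : ℝ → ℝ) (J : ℕ) (x : ℝ) (n : ℕ) : ℝ :=
  Real.log n ^ J * vonMangoldt n / (n:ℝ) ^ (1 + 1 / Real.log x) * φ (Real.log n - Real.log x)

theorem wt_lower {φ : ℝ → ℝ} {g : ℝ → ℂ} (hb : IsBump φ g) (J : ℕ) (x : ℝ) (hx : Real.exp 20 ≤ x)
    (hJ : 8 * (J + 1 : ℝ) ≤ Real.log x) (n : ℕ)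
    (h1 : Real.exp (-2) * x ≤ n) (h2 : (n:ℝ) ≤ Real.exp 2 * x) :
    Real.log x ^ J / (2 * Real.exp 5 * x) * vonMangoldt n ≤ wt φ J x n := by
  have h20 : (1:ℝ) ≤ Real.exp 20 := Real.one_le_exp (by norm_num)
  have hx0 : 0 < x := by linarith
  have hl : 20 ≤ Real.log x := by rw [Real.le_log_iff_exp_le hx0]; exact hx
  set l := Real.log x with hl_def
  have hn0 : (0:ℝ) < n := lt_of_lt_of_le (by positivity) h1
  have hlog1 : l - 2 ≤ Real.log n := by
    have := Real.log_le_log (by positivity) h1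
    rw [Real.log_mul (Real.exp_pos _).ne' hx0.ne', Real.log_exp] at this
    linarith
  have hlog2 : Real.log n ≤ l + 2 := by
    have := Real.log_le_log hn0 h2
    rw [Real.log_mul (Real.exp_pos _).ne' hx0.ne', Real.log_exp] at this
    linarith
  have hφ : φ (Real.log n - l) = 1 := hb.eq_one _ (abs_le.2 ⟨by linarith, by linarith⟩)
  rw [wt, ← hl_def, hφ, mul_one]
  have hpow : l ^ J / 2 ≤ Real.log n ^ J := by
    have e1 : (l - 2) ^ J ≤ Real.log n ^ J := pow_le_pow_left₀ (by linarith) hlog1 J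
    refine le_trans ?_ e1
    have e2 : (l - 2) ^ J = l ^ J * (1 + (-2 / l)) ^ J := by
      rw [← mul_pow]; congr 1; field_simp; ring
    rw [e2]
    have e3 : 1 + (J:ℝ) * (-2 / l) ≤ (1 + (-2 / l)) ^ J := by
      refine one_add_mul_le_pow ?_ J
      rw [le_div_iff₀ (by linarith)]; linarith
    have e4 : 1 / 2 ≤ 1 + (J:ℝ) * (-2 / l) := by
      have : (J:ℝ) * (2 / l) ≤ 1 / 2 := by
        rw [mul_div_assoc', div_le_iff₀ (by linarith)]; linarith
      have e5 : (J:ℝ) * (-2 / l) = -(J * (2 / l)) := by ring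
      linarith
    calc l ^ J / 2 = l ^ J * (1/2) := by ring
      _ ≤ _ := mul_le_mul_of_nonneg_left (e4.trans e3) (by positivity)
  have hden : (n:ℝ) ^ (1 + 1 / l) ≤ Real.exp 5 * x := by
    rw [Real.rpow_def_of_pos hn0]
    have : Real.exp 5 * x = Real.exp (5 + l) := by
      rw [Real.exp_add, hl_def, Real.exp_log hx0]
    rw [this, Real.exp_le_exp]
    calc Real.log n * (1 + 1 / l) ≤ (l + 2) * (1 + 1 / l) :=
          mul_le_mul_of_nonneg_right hlog2 (by positivity)
      _ = l + 3 + 2 / l := by field_simp; ring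
      _ ≤ 5 + l := by
          have : 2 / l ≤ 1 := by rw [div_le_one (by linarith)]; linarith
          linarith
  have hv := vonMangoldt_nonneg (n := n)
  rw [div_mul_eq_mul_div, div_le_div_iff₀ (by positivity) (by positivity)]
  have hd0 : 0 ≤ (n:ℝ) ^ (1 + 1 / l) := by positivity
  calc l ^ J * vonMangoldt n * (n:ℝ) ^ (1 + 1 / l)
      ≤ (2 * Real.log n ^ J) * vonMangoldt n * (Real.exp 5 * x) := by
        gcongr
        linarith
    _ = _ := by ring

theorem wt_upper {φ : ℝ → ℝ} {g : ℝ → ℂ} (hb : IsBump φ g) (J : ℕ) (x : ℝ) (hx : Real.exp 20 ≤ x)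
    (hJ : 8 * (J + 1 : ℝ) ≤ Real.log x) (n : ℕ) :
    wt φ J x n ≤ 2 * Real.exp 4 * Real.log x ^ J / x
      * (vonMangoldt n * φ (Real.log n - Real.log x)) := by
  have h20 : (1:ℝ) ≤ Real.exp 20 := Real.one_le_exp (by norm_num)
  have hx0 : 0 < x := by linarith
  have hl : 20 ≤ Real.log x := by rw [Real.le_log_iff_exp_le hx0]; exact hx
  set l := Real.log x with hl_def
  have hv := vonMangoldt_nonneg (n := n)
  have hp := hb.nonneg (Real.log n - l)
  by_cases hz : φ (Real.log n - l) = 0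
  · simp [wt, ← hl_def, hz]
  rcases Nat.eq_zero_or_pos n with rfl | hn
  · simp [wt]
  have hn0 : (0:ℝ) < n := by exact_mod_cast hn
  have hn1 : (1:ℝ) ≤ n := by exact_mod_cast hn
  have habs : |Real.log n - l| < 4 := by
    by_contra hc
    exact hz (hb.eq_zero _ (not_lt.1 hc))
  rw [abs_lt] at habs
  have hlogn : 0 ≤ Real.log n := Real.log_natCast_nonneg n
  have hpow : Real.log n ^ J ≤ 2 * l ^ J := by
    have e1 : Real.log n ^ J ≤ (l + 4) ^ J := pow_le_pow_left₀ hlogn (by linarith) J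
    refine e1.trans ?_
    have e2 : l ^ J = (l + 4) ^ J * (1 + (-4 / (l + 4))) ^ J := by
      rw [← mul_pow]; congr 1
      have : l + 4 ≠ 0 := by linarith
      field_simp; ring
    have e3 : 1 + (J:ℝ) * (-4 / (l+4)) ≤ (1 + (-4 / (l+4))) ^ J := by
      refine one_add_mul_le_pow ?_ J
      rw [le_div_iff₀ (by linarith)]; linarith
    have e4 : 1 / 2 ≤ 1 + (J:ℝ) * (-4 / (l+4)) := by
      have : (J:ℝ) * (4 / (l+4)) ≤ 1 / 2 := by
        rw [mul_div_assoc', div_le_iff₀ (by linarith)]; linarith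
      have e5 : (J:ℝ) * (-4 / (l+4)) = -(J * (4 / (l+4))) := by ring
      linarith
    have e6 : (l+4)^J * (1/2) ≤ l ^ J := by
      rw [e2]
      exact mul_le_mul_of_nonneg_left (e4.trans e3) (by positivity)
    linarith
  have hden : Real.exp (-4) * x ≤ (n:ℝ) ^ (1 + 1 / l) := by
    rw [Real.rpow_def_of_pos hn0]
    have : Real.exp (-4) * x = Real.exp (-4 + l) := by
      rw [Real.exp_add, hl_def, Real.exp_log hx0]
    rw [this, Real.exp_le_exp]
    have : 0 ≤ Real.log n * (1 / l) := by positivity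
    nlinarith
  rw [wt, ← hl_def, ← mul_assoc]
  refine mul_le_mul_of_nonneg_right ?_ hp
  rw [div_mul_eq_mul_div, div_le_div_iff₀ (by positivity) hx0]
  have he : Real.exp 4 * Real.exp (-4) = 1 := by rw [← Real.exp_add]; simp
  calc Real.log n ^ J * vonMangoldt n * x
      ≤ (2 * l ^ J) * vonMangoldt n * x := by gcongr
    _ = 2 * Real.exp 4 * l ^ J * vonMangoldt n * (Real.exp (-4) * x) := by
        linear_combination (-(2 * l ^ J) * vonMangoldt n * x) * he
    _ ≤ _ := mul_le_mul_of_nonneg_left hden (by positivity)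

theorem term_eq_wt {W : ℕ} (χ : DirichletCharacter ℂ W) (φ : ℝ → ℝ) (J : ℕ) (x : ℝ) (n : ℕ) :
    LSeries.term (lg J (vm χ)) ((1 + 1 / Real.log x : ℝ) : ℂ) n * (φ (Real.log n - Real.log x) : ℂ)
      = χ n * (wt φ J x n : ℂ) := by
  rcases eq_or_ne n 0 with rfl | hn
  · simp [wt]
  · rw [LSeries.term_of_ne_zero hn, wt, lg, vm]
    push_cast [Complex.ofReal_cpow (Nat.cast_nonneg n)]
    ring

theorem sw {φ : ℝ → ℝ} {g : ℝ → ℂ} (hb : IsBump φ g) :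
    ∃ c : ℝ, 0 < c ∧ ∀ B : ℕ, ∃ x0 : ℝ, ∀ x : ℝ, x0 ≤ x → ∀ k : ℕ, 1 ≤ k →
      (3:ℝ) ^ k ≤ Real.log x ^ B →
      c * x / 3 ^ k ≤ ∑ n ∈ Finset.range (Nx x), if (n : ZMod (3 ^ k)) = 1 then
        vonMangoldt n * φ (Real.log n - Real.log x) else 0 := by
  refine ⟨1 / (8 * Real.exp 9), by positivity, fun B => ?_⟩
  set J := B + 1 with hJ
  obtain ⟨C, hC, e, hE⟩ := E_bound hb J
  have hev1 : ∀ᶠ x : ℝ in Filter.atTop, C * (B * Real.log (Real.log x)) ^ e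
      ≤ Real.log x / (4 * Real.exp 5) := by
    have h1 : (fun y : ℝ => Real.log y ^ e) =o[Filter.atTop] (fun y => y) :=
      Real.isLittleO_pow_log_id_atTop
    have h2 := (h1.comp_tendsto Real.tendsto_log_atTop).bound
      (c := 1 / (4 * Real.exp 5 * (C * B ^ e + 1))) (by positivity)
    filter_upwards [h2, Filter.eventually_ge_atTop (Real.exp 1)] with x hx hx1
    have hlx : 1 ≤ Real.log x := by
      rw [Real.le_log_iff_exp_le (lt_of_lt_of_le (Real.exp_pos _) hx1)]; exact hx1
    have hllx : 0 ≤ Real.log (Real.log x) := Real.log_nonneg hlx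
    simp only [Function.comp] at hx
    rw [Real.norm_of_nonneg (by positivity), Real.norm_of_nonneg (by positivity)] at hx
    rw [mul_pow]
    calc C * ((B:ℝ) ^ e * Real.log (Real.log x) ^ e)
        = (C * B ^ e) * Real.log (Real.log x) ^ e := by ring
      _ ≤ (C * B ^ e + 1) * (1 / (4 * Real.exp 5 * (C * B ^ e + 1)) * Real.log x) :=
          mul_le_mul (by linarith) hx (by positivity) (by positivity)
      _ = _ := by field_simp
  have hev2 : ∀ᶠ x : ℝ in Filter.atTop, 30 * Real.log x ≤ Real.sqrt x := by
    have h1 := (isLittleO_log_rpow_atTop (r := 1/2) (by norm_num)).bound (c := 1/30) (by norm_num)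
    filter_upwards [h1, Filter.eventually_ge_atTop 1] with x hx hx1
    rw [Real.norm_of_nonneg (Real.log_nonneg hx1), Real.norm_of_nonneg (by positivity),
      ← Real.sqrt_eq_rpow] at hx
    linarith
  have hev3 : ∀ᶠ x : ℝ in Filter.atTop, 8 * (J + 1 : ℝ) ≤ Real.log x :=
    Real.tendsto_log_atTop.eventually_ge_atTop _
  obtain ⟨x0, hx0⟩ := Filter.eventually_atTop.1 (hev1.and (hev2.and (hev3.and
    ((Filter.eventually_ge_atTop (Real.exp 20)).and (Filter.eventually_ge_atTop (50^4:ℝ))))))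
  refine ⟨x0, fun x hx k hk hkB => ?_⟩
  obtain ⟨h1, h2, h3, h4, h5⟩ := hx0 x hx
  clear hx0 hev1 hev2 hev3
  have hx1 : 1 ≤ x := by linarith [(by norm_num : (1:ℝ) ≤ 50^4)]
  have hxp : 0 < x := by linarith
  have hl20 : 20 ≤ Real.log x := by rw [Real.le_log_iff_exp_le hxp]; exact h4
  set l := Real.log x with hl
  have : NeZero (3 ^ k) := ⟨by positivity⟩
  set N := Nx x with hN
  set w := wt φ J x with hw
  have hw0 : ∀ n, 0 ≤ w n := by
    intro n
    rw [hw, wt]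
    exact mul_nonneg (div_nonneg (mul_nonneg (pow_nonneg (Real.log_natCast_nonneg n) _)
      vonMangoldt_nonneg) (by positivity)) (hb.nonneg _)
  -- principal character
  set E : DirichletCharacter ℂ (3^k) → ℂ := fun χ => ∑ n ∈ Finset.range N, χ n * (w n : ℂ) with hEd
  have hE1 : l ^ J / (2 * Real.exp 5) ≤ (E 1).re := by
    have hunit : ∀ n : ℕ, IsUnit ((n : ℕ) : ZMod (3^k)) ↔ ¬ 3 ∣ n := by
      intro n
      rw [ZMod.isUnit_iff_coprime, Nat.coprime_pow_right_iff (by omega), Nat.coprime_comm,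
          Nat.Prime.coprime_iff_not_dvd Nat.prime_three]
    have e1 : (E 1).re = ∑ n ∈ Finset.range N with ¬ 3 ∣ n, w n := by
      rw [hEd, Complex.re_sum, Finset.sum_filter]
      refine Finset.sum_congr rfl fun n _ => ?_
      by_cases h : 3 ∣ n
      · rw [MulChar.map_nonunit _ (by rw [hunit]; exact not_not.2 h), if_neg (not_not.2 h)]; simp
      · rw [MulChar.one_apply ((hunit n).2 h), if_pos h]; simp
    rw [e1]
    set Bk := Finset.Ioc ⌊Real.exp (-2) * x⌋₊ ⌊Real.exp 2 * x⌋₊ with hBk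
    have hBkm : ∀ n ∈ Bk, Real.exp (-2) * x ≤ n ∧ (n:ℝ) ≤ Real.exp 2 * x := by
      intro n hn
      rw [hBk, Finset.mem_Ioc] at hn
      exact ⟨(Nat.lt_of_floor_lt hn.1).le, (Nat.le_floor_iff (by positivity)).1 hn.2⟩
    have hsub : (Bk.filter (fun n => ¬ 3 ∣ n)) ⊆ (Finset.range N).filter (fun n => ¬ 3 ∣ n) := by
      refine Finset.filter_subset_filter _ fun n hn => ?_
      rw [hBk, Finset.mem_Ioc] at hn
      rw [Finset.mem_range, hN, Nx]
      have : ⌊Real.exp 2 * x⌋₊ ≤ ⌊Real.exp 4 * x⌋₊ :=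
        Nat.floor_le_floor (mul_le_mul_of_nonneg_right (Real.exp_le_exp.2 (by norm_num)) hxp.le)
      omega
    refine le_trans ?_ (Finset.sum_le_sum_of_subset_of_nonneg hsub fun n _ _ => hw0 n)
    have e2 : ∑ n ∈ Bk with ¬ 3 ∣ n, l ^ J / (2 * Real.exp 5 * x) * vonMangoldt n
        ≤ ∑ n ∈ Bk with ¬ 3 ∣ n, w n := by
      refine Finset.sum_le_sum fun n hn => ?_
      have := hBkm n (Finset.mem_filter.1 hn).1
      exact wt_lower hb J x h4 h3 n this.1 this.2
    refine le_trans ?_ e2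
    rw [← Finset.mul_sum]
    have e3 : ∑ n ∈ Bk with 3 ∣ n, vonMangoldt n ≤ x := by
      calc _ ≤ ∑ n ∈ Bk with ¬ n.Prime, vonMangoldt n := by
            refine Finset.sum_le_sum_of_subset_of_nonneg ?_ (fun _ _ _ => vonMangoldt_nonneg)
            intro n hn
            rw [Finset.mem_filter] at hn ⊢
            refine ⟨hn.1, fun hp => ?_⟩
            have h3n : 3 = n := (Nat.prime_dvd_prime_iff_eq Nat.prime_three hp).1 hn.2
            have := (hBkm n hn.1).1
            rw [← h3n] at this
            have he2 : Real.exp (-2) * 10 ≥ 1 := by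
              have : Real.exp 2 ≤ 10 := by
                have h := Real.exp_one_lt_d9
                rw [show (2:ℝ) = 1 + 1 by norm_num, Real.exp_add]
                nlinarith [Real.exp_pos 1]
              have h' : Real.exp (-2) * Real.exp 2 = 1 := by rw [← Real.exp_add]; simp
              nlinarith [Real.exp_pos (-2)]
            push_cast at this
            nlinarith
        _ ≤ 2 * Real.sqrt (Real.exp 4 * x) * Real.log (Real.exp 4 * x) := by
            refine nonprime_sum Bk _ ?_ ?_
            · nlinarith [Real.one_le_exp (show (0:ℝ) ≤ 4 by norm_num)]
            · intro n hn
              refine (hBkm n hn).2.trans ?_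
              exact mul_le_mul_of_nonneg_right (Real.exp_le_exp.2 (by norm_num)) hxp.le
        _ ≤ 30 * Real.sqrt x * l := np_numeric x h4
        _ = Real.sqrt x * (30 * l) := by ring
        _ ≤ Real.sqrt x * Real.sqrt x := mul_le_mul_of_nonneg_left h2 (Real.sqrt_nonneg _)
        _ = x := Real.mul_self_sqrt hxp.le
    have e4 := psi_block h5
    rw [← hBk] at e4
    have e5 := Finset.sum_filter_add_sum_filter_not Bk (fun n => 3 ∣ n) (fun n => vonMangoldt n)
    have e6 : x ≤ ∑ n ∈ Bk with ¬ 3 ∣ n, vonMangoldt n := by linarith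
    calc l ^ J / (2 * Real.exp 5) = l ^ J / (2 * Real.exp 5 * x) * x := by field_simp
      _ ≤ _ := mul_le_mul_of_nonneg_left e6 (by positivity)
  -- other characters
  have hEo : ∀ χ : DirichletCharacter ℂ (3^k), χ ≠ 1 → ‖E χ‖ ≤ l / (4 * Real.exp 5) := by
    intro χ hχ
    have h6 := hE k hk χ hχ (1 + 1 / l) (by have : 0 < 1 / l := by positivity
                                            linarith)
      (by have : 1 / l ≤ 1 := by rw [div_le_one (by linarith)]; linarith
          linarith) l N (fun n hn => phi_zero_of_ge hb x hx1 n hn)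
    simp only [hl] at h6
    simp only [term_eq_wt] at h6
    refine le_trans h6 (le_trans ?_ h1)
    refine mul_le_mul_of_nonneg_left (pow_le_pow_left₀ (by positivity) ?_ e) hC
    have h7 := Real.log_le_log (by positivity) hkB
    rw [Real.log_pow, Real.log_pow] at h7
    have h8 : 1 ≤ Real.log 3 := by
      rw [Real.le_log_iff_exp_le (by norm_num)]
      linarith [Real.exp_one_lt_d9]
    nlinarith [(Nat.cast_nonneg k : (0:ℝ) ≤ k)]
  -- orthogonality
  set S : ℝ := ∑ n ∈ Finset.range N, if (n : ZMod (3 ^ k)) = 1 then w n else 0 with hS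
  set t : ℝ := ((3^k).totient : ℝ) with ht
  have ht0 : 0 < t := by
    rw [ht]; exact_mod_cast Nat.totient_pos.2 (by positivity)
  have ht3 : t ≤ 3 ^ k := by
    rw [ht]; exact_mod_cast Nat.totient_le _
  have horth : ∑ χ : DirichletCharacter ℂ (3^k), E χ = ((t * S : ℝ) : ℂ) := by
    rw [hEd, Finset.sum_comm, hS, Finset.mul_sum, Complex.ofReal_sum]
    refine Finset.sum_congr rfl fun n _ => ?_
    rw [← Finset.sum_mul, DirichletCharacter.sum_characters_eq]
    split_ifs
    · push_cast; rfl
    · simp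
  classical
  have hsum : (E 1).re - ∑ χ ∈ (Finset.univ : Finset (DirichletCharacter ℂ (3^k))).erase 1, ‖E χ‖
      ≤ t * S := by
    have h6 := congrArg Complex.re horth
    rw [Complex.ofReal_re, ← Finset.add_sum_erase _ _ (Finset.mem_univ 1), Complex.add_re] at h6
    have h8 : (∑ χ ∈ (Finset.univ : Finset (DirichletCharacter ℂ (3^k))).erase 1, E χ).re
        = ∑ χ ∈ (Finset.univ : Finset (DirichletCharacter ℂ (3^k))).erase 1, (E χ).re :=
      Complex.re_sum _ _
    have h7 : -∑ χ ∈ (Finset.univ : Finset (DirichletCharacter ℂ (3^k))).erase 1, ‖E χ‖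
        ≤ ∑ χ ∈ (Finset.univ : Finset (DirichletCharacter ℂ (3^k))).erase 1, (E χ).re := by
      rw [← Finset.sum_neg_distrib]
      exact Finset.sum_le_sum fun χ _ => (abs_le.1 (Complex.abs_re_le_norm _)).1
    linarith
  have hoth : ∑ χ ∈ (Finset.univ : Finset (DirichletCharacter ℂ (3^k))).erase 1, ‖E χ‖
      ≤ l ^ J / (4 * Real.exp 5) := by
    calc _ ≤ ∑ χ ∈ (Finset.univ : Finset (DirichletCharacter ℂ (3^k))).erase 1,
            l / (4 * Real.exp 5) :=
          Finset.sum_le_sum fun χ hχ => hEo χ (Finset.ne_of_mem_erase hχ)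
      _ ≤ t * (l / (4 * Real.exp 5)) := by
          rw [Finset.sum_const, nsmul_eq_mul]
          refine mul_le_mul_of_nonneg_right ?_ (by positivity)
          rw [ht, ← DirichletCharacter.card_eq_totient_of_hasEnoughRootsOfUnity ℂ (3^k),
            Nat.card_eq_fintype_card]
          exact_mod_cast (Finset.card_erase_le).trans (le_of_eq Finset.card_univ)
      _ ≤ l ^ B * (l / (4 * Real.exp 5)) :=
          mul_le_mul_of_nonneg_right (ht3.trans hkB) (by positivity)
      _ = _ := by rw [hJ, pow_succ]; ring
  have hfin : l ^ J / (4 * Real.exp 5) ≤ t * S := by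
    have : l ^ J / (2 * Real.exp 5) = l ^ J / (4 * Real.exp 5) + l ^ J / (4 * Real.exp 5) := by
      field_simp; norm_num
    linarith
  set P : ℝ := ∑ n ∈ Finset.range N, if (n : ZMod (3 ^ k)) = 1 then
        vonMangoldt n * φ (Real.log n - l) else 0 with hP
  have hSP : S ≤ 2 * Real.exp 4 * l ^ J / x * P := by
    rw [hS, hP, Finset.mul_sum]
    refine Finset.sum_le_sum fun n _ => ?_
    split_ifs
    · exact wt_upper hb J x h4 h3 n
    · simp
  have hP0 : 0 ≤ P := by
    rw [hP]
    refine Finset.sum_nonneg fun n _ => ?_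
    split_ifs
    · exact mul_nonneg vonMangoldt_nonneg (hb.nonneg _)
    · exact le_rfl
  have h6 : l ^ J / (4 * Real.exp 5) ≤ 3 ^ k * (2 * Real.exp 4 * l ^ J / x * P) := by
    refine hfin.trans ?_
    calc t * S ≤ t * (2 * Real.exp 4 * l ^ J / x * P) := mul_le_mul_of_nonneg_left hSP ht0.le
      _ ≤ _ := mul_le_mul_of_nonneg_right ht3 (by positivity)
  have hlJ : 0 < l ^ J := by positivity
  have h7 : l ^ J * (x / (4 * Real.exp 5)) ≤ l ^ J * (3 ^ k * (2 * Real.exp 4) * P) := by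
    have := mul_le_mul_of_nonneg_right h6 hxp.le
    calc _ = l ^ J / (4 * Real.exp 5) * x := by ring
      _ ≤ _ := this
      _ = _ := by field_simp
  have h8 := le_of_mul_le_mul_left h7 hlJ
  rw [div_le_iff₀ (by positivity)] at h8
  rw [div_le_iff₀ (by positivity), div_mul_eq_mul_div, one_mul, div_le_iff₀ (by positivity)]
  calc x ≤ _ := h8
    _ = P * 3 ^ k * (8 * (Real.exp 4 * Real.exp 5)) := by ring
    _ = _ := by rw [← Real.exp_add]; norm_num

end PPF

namespace PPF
open ArithmeticFunction

/-- primes near `x` congruent to one modulo `D` -/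
noncomputable def Pset (x : ℝ) (D : ℕ) : Finset ℕ :=
  (Finset.range (Nx x)).filter (fun n => n.Prime ∧ (n : ZMod D) = 1 ∧ Real.exp (-4) * x ≤ n)

theorem range_Nx_le {x : ℝ} (hx : 0 ≤ x) {n : ℕ} (hn : n ∈ Finset.range (Nx x)) :
    (n:ℝ) ≤ Real.exp 4 * x := by
  rw [Finset.mem_range, Nx] at hn
  exact (Nat.le_floor_iff (by positivity)).1 (by omega)

theorem phi_zero_of_lt {φ : ℝ → ℝ} {g : ℝ → ℂ} (hb : IsBump φ g) {x : ℝ} (hx : 0 < x) {n : ℕ}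
    (hn0 : 0 < n) (hn : (n:ℝ) < Real.exp (-4) * x) : φ (Real.log n - Real.log x) = 0 := by
  refine hb.eq_zero _ ?_
  have h0 : (0:ℝ) < n := by exact_mod_cast hn0
  have h1 := Real.log_lt_log h0 hn
  rw [Real.log_mul (Real.exp_pos _).ne' hx.ne', Real.log_exp] at h1
  rw [abs_of_neg (by linarith)]; linarith

theorem nonprime_range {x : ℝ} (hx : Real.exp 20 ≤ x) :
    ∑ n ∈ Finset.range (Nx x) with ¬ n.Prime, vonMangoldt n
      ≤ 30 * Real.sqrt x * Real.log x := by
  have hx1 : 1 ≤ x := (Real.one_le_exp (by norm_num)).trans hx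
  refine le_trans (nonprime_sum (Finset.range (Nx x)) (Real.exp 4 * x) ?_ ?_) (np_numeric x hx)
  · nlinarith [Real.one_le_exp (show (0:ℝ) ≤ 4 by norm_num)]
  · intro n hn; exact range_Nx_le (by linarith) hn

theorem primes_card {φ : ℝ → ℝ} {g : ℝ → ℂ} (hb : IsBump φ g) {x : ℝ} (hx : Real.exp 20 ≤ x)
    (D : ℕ) (X : ℝ) (h : X ≤ ∑ n ∈ Finset.range (Nx x), if (n : ZMod D) = 1 then
        vonMangoldt n * φ (Real.log n - Real.log x) else 0) :
    X - 30 * Real.sqrt x * Real.log x ≤ (Pset x D).card * (2 * Real.log x) := by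
  have hx1 : 1 ≤ x := (Real.one_le_exp (by norm_num)).trans hx
  have hx0 : 0 < x := by linarith
  have hl20 : 20 ≤ Real.log x := by rw [Real.le_log_iff_exp_le hx0]; exact hx
  have h1 := nonprime_range hx
  rw [← Finset.sum_filter_add_sum_filter_not _ (fun n : ℕ => n.Prime)] at h
  have h2 : ∑ n ∈ Finset.range (Nx x) with ¬ n.Prime, (if (n : ZMod D) = 1 then
        vonMangoldt n * φ (Real.log n - Real.log x) else 0)
      ≤ ∑ n ∈ Finset.range (Nx x) with ¬ n.Prime, vonMangoldt n := by
    refine Finset.sum_le_sum fun n _ => ?_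
    have hv : 0 ≤ vonMangoldt n := vonMangoldt_nonneg
    split_ifs
    · exact mul_le_of_le_one_right hv (hb.le_one _)
    · exact hv
  have h3 : ∑ n ∈ Finset.range (Nx x) with n.Prime, (if (n : ZMod D) = 1 then
        vonMangoldt n * φ (Real.log n - Real.log x) else 0)
      ≤ (Pset x D).card * (2 * Real.log x) := by
    rw [← nsmul_eq_mul, ← Finset.sum_const]
    have hsub : Pset x D ⊆ (Finset.range (Nx x)).filter (fun n => n.Prime) := by
      intro n hn
      rw [Pset, Finset.mem_filter] at hn
      rw [Finset.mem_filter]; exact ⟨hn.1, hn.2.1⟩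
    rw [← Finset.sum_subset hsub]
    · refine Finset.sum_le_sum fun n hn => ?_
      rw [Pset, Finset.mem_filter] at hn
      rw [if_pos hn.2.2.1, vonMangoldt_apply_prime hn.2.1]
      have hn0 : (0:ℝ) < n := by exact_mod_cast hn.2.1.pos
      have h4 := Real.log_le_log hn0 (range_Nx_le hx0.le hn.1)
      rw [Real.log_mul (Real.exp_pos _).ne' hx0.ne', Real.log_exp] at h4
      refine (mul_le_of_le_one_right (Real.log_natCast_nonneg n) (hb.le_one _)).trans ?_
      linarith
    · intro n hn hnp
      rw [Finset.mem_filter] at hn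
      split_ifs with hD
      · rw [phi_zero_of_lt hb hx0 hn.2.pos, mul_zero]
        by_contra hc
        exact hnp (by rw [Pset, Finset.mem_filter]; exact ⟨hn.1, hn.2, hD, not_lt.1 hc⟩)
      · rfl
  linarith

theorem lower_D {φ : ℝ → ℝ} {g : ℝ → ℂ} (hb : IsBump φ g) {x : ℝ} (hx : Real.exp 20 ≤ x)
    (W q : ℕ) (hq : q.Prime) (hq3 : 3 ≤ q) (hWq : Nat.Coprime W q) (hqx : (q:ℝ) < Real.exp (-4) * x)
    (X Y : ℝ) (hX : X ≤ ∑ n ∈ Finset.range (Nx x), if (n : ZMod W) = 1 then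
        vonMangoldt n * φ (Real.log n - Real.log x) else 0)
    (hY : |∑ n ∈ Finset.range (Nx x), vonMangoldt n *
        (φ (Real.log n - Real.log x) * kapW W q n)| ≤ Y) :
    (X - 30 * Real.sqrt x * Real.log x) / ((q:ℝ) - 1) - Y ≤
      ∑ n ∈ Finset.range (Nx x), if (n : ZMod (W * q)) = 1 then
        vonMangoldt n * φ (Real.log n - Real.log x) else 0 := by
  have hx1 : 1 ≤ x := (Real.one_le_exp (by norm_num)).trans hx
  have hx0 : 0 < x := by linarith
  have h1 := nonprime_range hx
  have hq1 : (0:ℝ) < (q:ℝ) - 1 := by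
    have : (3:ℝ) ≤ q := by exact_mod_cast hq3
    linarith
  set f : ℕ → ℝ := fun n => vonMangoldt n * φ (Real.log n - Real.log x) with hf
  have hf0 : ∀ n, 0 ≤ f n := fun n => mul_nonneg vonMangoldt_nonneg (hb.nonneg _)
  have hmod : ∀ n : ℕ, (n : ZMod (W * q)) = 1 ↔ (n : ZMod W) = 1 ∧ (n : ZMod q) = 1 := by
    intro n
    have e : ∀ m : ℕ, (n : ZMod m) = 1 ↔ n ≡ 1 [MOD m] := by
      intro m
      rw [← ZMod.natCast_eq_natCast_iff]; simp
    rw [e, e, e, Nat.modEq_and_modEq_iff_modEq_mul hWq]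
  have hterm : ∀ n ∈ Finset.range (Nx x), vonMangoldt n * (φ (Real.log n - Real.log x) * kapW W q n)
      ≤ (if (n : ZMod (W * q)) = 1 then f n else 0)
        - ((if (n : ZMod W) = 1 then f n else 0) - (if ¬ n.Prime then vonMangoldt n else 0))
          / ((q:ℝ) - 1) := by
    intro n hn
    have hv : 0 ≤ vonMangoldt n := vonMangoldt_nonneg
    have hnp : 0 ≤ (if ¬ n.Prime then vonMangoldt n else 0 : ℝ) := by split_ifs <;> simp [hv]
    have hnp' := div_nonneg hnp hq1.le
    rw [← mul_assoc, kapW, sub_div]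
    change f n * _ ≤ _
    by_cases hW : (n : ZMod W) = 1
    · rw [if_pos hW, if_pos hW, kap]
      have e1 : (if (n : ZMod (W * q)) = 1 then f n else 0)
          = f n * (if (n : ZMod q) = 1 then 1 else 0) := by
        by_cases h : (n : ZMod q) = 1
        · rw [if_pos ((hmod n).2 ⟨hW, h⟩), if_pos h, mul_one]
        · rw [if_neg (fun h' => h ((hmod n).1 h').2), if_neg h, mul_zero]
      rw [e1]
      by_cases hz : (n : ZMod q) = 0
      · rw [if_pos hz, sub_zero]
        have key : f n ≤ (if ¬ n.Prime then vonMangoldt n else 0 : ℝ) := by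
          by_cases hp : n.Prime
          · rw [if_neg (not_not.2 hp)]
            have hqn : q ∣ n := (ZMod.natCast_eq_zero_iff _ _).1 hz
            have : q = n := (Nat.prime_dvd_prime_iff_eq hq hp).1 hqn
            rw [hf]; simp only
            rw [phi_zero_of_lt hb hx0 hp.pos (by rw [← this]; exact hqx), mul_zero]
          · rw [if_pos hp]
            exact mul_le_of_le_one_right hv (hb.le_one _)
        have := div_le_div_of_nonneg_right key hq1.le
        linarith
      · rw [if_neg hz, mul_sub, mul_one_div]; linarith
    · rw [if_neg hW, if_neg hW, if_neg (fun h' => hW ((hmod n).1 h').1)]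
      simp only [mul_zero, zero_div]; linarith
  have h2 := Finset.sum_le_sum hterm
  rw [Finset.sum_sub_distrib, ← Finset.sum_div, Finset.sum_sub_distrib, ← Finset.sum_filter (fun n : ℕ => ¬ n.Prime)] at h2
  have h3 := (abs_le.1 hY).1
  have h4 : (X - 30 * Real.sqrt x * Real.log x) / ((q:ℝ) - 1) ≤
      ((∑ n ∈ Finset.range (Nx x), if (n : ZMod W) = 1 then f n else 0) -
        ∑ n ∈ Finset.range (Nx x) with ¬ n.Prime, vonMangoldt n) / ((q:ℝ) - 1) :=
    div_le_div_of_nonneg_right (by linarith) hq1.le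
  linarith

theorem good_q {φ : ℝ → ℝ} {g : ℝ → ℂ} (hb : IsBump φ g) : ∃ K : ℝ, 0 < K ∧
    ∀ x : ℝ, Real.exp 20 ≤ x → ∀ k : ℕ, ∀ Q : ℝ, 50 ^ 4 ≤ Q → 8 * Q ≤ x →
    ∃ q : ℕ, q.Prime ∧ Q < q ∧ (q:ℝ) ≤ 8 * Q ∧
      |∑ n ∈ Finset.range (Nx x), vonMangoldt n *
        (φ (Real.log n - Real.log x) * kapW (3^k) q n)| ≤
      K * Real.log x ^ 5 * (Real.sqrt x + x / x ^ (1/8:ℝ) / Q + x / Q ^ 2) := by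
  obtain ⟨K, hK, h⟩ := bv hb
  refine ⟨K, hK, fun x hx k Q hQ hQx => ?_⟩
  have hx1 : 1 ≤ x := (Real.one_le_exp (by norm_num)).trans hx
  have hx0 : 0 < x := by linarith
  have hl20 : 20 ≤ Real.log x := by rw [Real.le_log_iff_exp_le hx0]; exact hx
  have hQ0 : 0 < Q := lt_of_lt_of_le (by norm_num) hQ
  have hQ5 : 5 < Q := lt_of_lt_of_le (by norm_num) hQ
  have hc := prime_count hQ
  set Qs := primesIn Q (8 * Q) with hQs
  have hm : ∀ q ∈ Qs, q.Prime ∧ Q < q ∧ (q:ℝ) ≤ 8 * Q := fun q hq =>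
    (mem_primesIn hQ0.le q).1 hq
  have h1 := h x hx (3^k) (by positivity) Qs Q (by linarith) (fun q hq => by
    obtain ⟨a, b, c⟩ := hm q hq
    refine ⟨a, b.le, c, Nat.Coprime.pow_left _ ((Nat.coprime_primes Nat.prime_three a).2 ?_)⟩
    rintro rfl
    push_cast at b; linarith)
  by_contra hcon
  push Not at hcon
  set V := K * Real.log x ^ 5 * (Real.sqrt x + x / x ^ (1/8:ℝ) / Q + x / Q ^ 2) with hV
  have hV0 : 0 < V := by positivity
  have hlog : Real.log (8 * Q) ≤ Real.log x := Real.log_le_log (by linarith) hQx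
  have hcard : Q ≤ Qs.card * Real.log x :=
    hc.trans (mul_le_mul_of_nonneg_left hlog (Nat.cast_nonneg _))
  have hne : Qs.Nonempty := by
    rw [← Finset.card_pos]
    by_contra h0
    have : Qs.card = 0 := by omega
    rw [this] at hcard; simp at hcard; linarith
  have h2 : ∑ q ∈ Qs, V < ∑ q ∈ Qs, |∑ n ∈ Finset.range (Nx x), vonMangoldt n *
        (φ (Real.log n - Real.log x) * kapW (3^k) q n)| :=
    Finset.sum_lt_sum_of_nonempty hne fun q hq => hcon q (hm q hq).1 (hm q hq).2.1 (hm q hq).2.2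
  rw [Finset.sum_const, nsmul_eq_mul] at h2
  have h3 : Q * V ≤ Qs.card * Real.log x * V := mul_le_mul_of_nonneg_right hcard hV0.le
  have h4 : Q * V = Real.log x * (K * Real.log x ^ 4 * (Q * Real.sqrt x + x / x ^ (1/8:ℝ) + x / Q)) := by
    rw [hV]; field_simp
  have h5 := lt_of_lt_of_le h2 h1
  have h6 : Real.log x * (Qs.card * V) < Real.log x * (K * Real.log x ^ 4 * (Q * Real.sqrt x + x / x ^ (1/8:ℝ) + x / Q)) :=
    mul_lt_mul_of_pos_left h5 (by linarith)
  linarith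

end PPF

namespace PPF
open ArithmeticFunction

theorem mem_Pset_dvd {x : ℝ} {D p : ℕ} (hp : p ∈ Pset x D) : D * ((p - 1) / D) + 1 = p := by
  rw [Pset, Finset.mem_filter] at hp
  have h1 : p ≡ 1 [MOD D] := by
    rw [← ZMod.natCast_eq_natCast_iff, hp.2.2.1]; simp
  have h2 : D ∣ p - 1 := (Nat.modEq_iff_dvd' hp.2.1.one_lt.le).1 h1.symm
  rw [Nat.mul_div_cancel' h2]
  have := hp.2.1.pos
  omega

theorem sieve_use {x : ℝ} (hx : Real.exp 20 ≤ x) (k q j : ℕ) (hq : q.Prime) (y : ℝ)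
    (hy : 50 ^ 4 ≤ y) (hzq : y ^ (2 ^ j) < q) (hzx : (y ^ (2 ^ j)) ^ 2 ≤ x ^ (1/10:ℝ))
    (hD : (3:ℝ) ^ k * q ≤ Real.sqrt x) (hj : 24000 ≤ j * Real.log x)
    (hno : ∀ p ∈ Pset x (3 ^ k * q), ∀ r ∈ primesIn y (y ^ (2 ^ j)),
      ¬ r ∣ (p - 1) / (3 ^ k * q)) :
    (Pset x (3 ^ k * q)).card * (j * Real.log x) * (3 ^ k * q) ≤ 171 * 24000 * x := by
  have hx1 : 1 ≤ x := (Real.one_le_exp (by norm_num)).trans hx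
  have hx0 : 0 < x := by linarith
  have hl20 : 20 ≤ Real.log x := by rw [Real.le_log_iff_exp_le hx0]; exact hx
  have hy1 : 5 < y := lt_of_lt_of_le (by norm_num) hy
  have hyz : y ≤ y ^ (2 ^ j) := le_self_pow₀ (by linarith) (by positivity)
  set z := y ^ (2 ^ j) with hz
  set D := 3 ^ k * q with hDdef
  have hDc : (D:ℝ) = 3 ^ k * q := by rw [hDdef]; push_cast; ring
  have hD0 : 0 < D := by rw [hDdef]; exact Nat.mul_pos (by positivity) hq.pos
  have hD0' : (0:ℝ) < D := by exact_mod_cast hD0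
  rw [← hDc] at hD ⊢
  have hsq : Real.sqrt x * Real.sqrt x = x := Real.mul_self_sqrt hx0.le
  have hs0 : 0 < Real.sqrt x := Real.sqrt_pos.2 hx0
  have hsx : Real.sqrt x ≤ x / D := by
    rw [le_div_iff₀ hD0']
    calc Real.sqrt x * D ≤ Real.sqrt x * Real.sqrt x := mul_le_mul_of_nonneg_left hD hs0.le
      _ = x := hsq
  have hs1 : 1 ≤ Real.sqrt x := Real.one_le_sqrt.2 hx1
  set R := ⌊x ^ (1/10:ℝ)⌋₊ with hR
  have hxr : 1 ≤ x ^ (1/10:ℝ) := Real.one_le_rpow hx1 (by norm_num)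
  have hR1 : 1 ≤ R := Nat.le_floor (by exact_mod_cast hxr)
  have hRle : (R:ℝ) ≤ x ^ (1/10:ℝ) := Nat.floor_le (by linarith)
  have hlogR : Real.log x / 20 ≤ Real.log R := by
    have h20 : 2 ≤ x ^ (1/20:ℝ) := by
      have : Real.exp 1 ≤ x ^ (1/20:ℝ) := by
        rw [Real.rpow_def_of_pos hx0, Real.exp_le_exp]; linarith
      linarith [Real.add_one_le_exp (1:ℝ)]
    have e1 : x ^ (1/10:ℝ) = x ^ (1/20:ℝ) * x ^ (1/20:ℝ) := by
      rw [← Real.rpow_add hx0]; norm_num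
    have e2 : x ^ (1/10:ℝ) < R + 1 := Nat.lt_floor_add_one _
    have e3 : x ^ (1/20:ℝ) ≤ R := by nlinarith
    have e4 := Real.log_le_log (by positivity) e3
    rw [Real.log_rpow hx0] at e4
    linarith
  set M := Nx x / D + 1 with hM
  have hNxx : x ≤ Nx x := by
    have : Real.exp 4 * x < Nx x := by
      rw [Nx]; push_cast; exact Nat.lt_floor_add_one _
    nlinarith [Real.one_le_exp (show (0:ℝ) ≤ 4 by norm_num)]
  have hMlo : x / D ≤ M := by
    have h1 : Nx x < D * M := by
      rw [hM]; exact Nat.lt_mul_div_succ _ hD0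
    have h2 : (Nx x : ℝ) ≤ D * M := by exact_mod_cast h1.le
    rw [div_le_iff₀ hD0']; linarith
  have hMhi : (M:ℝ) ≤ 57 * x / D := by
    have h1 : ((Nx x / D : ℕ) : ℝ) ≤ Nx x / D := Nat.cast_div_le
    have h2 : (Nx x : ℝ) / D ≤ 56 * x / D := div_le_div_of_nonneg_right (Nx_le x hx1) hD0'.le
    have h3 : 57 * x / D = 56 * x / D + x / D := by ring
    rw [hM]; push_cast; linarith
  have hRs : x ^ (1/10:ℝ) ≤ Real.sqrt x := by
    rw [Real.sqrt_eq_rpow]; exact Real.rpow_le_rpow_of_exponent_le hx1 (by norm_num)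
  have hRM : R ^ 4 ≤ M := by
    have : (R:ℝ) ^ 4 ≤ M := by
      calc (R:ℝ) ^ 4 ≤ (x ^ (1/10:ℝ)) ^ 4 := pow_le_pow_left₀ (Nat.cast_nonneg _) hRle 4
        _ = x ^ (4/10:ℝ) := by rw [← Real.rpow_natCast, ← Real.rpow_mul hx0.le]; norm_num
        _ ≤ Real.sqrt x := by
          rw [Real.sqrt_eq_rpow]; exact Real.rpow_le_rpow_of_exponent_le hx1 (by norm_num)
        _ ≤ M := hsx.trans hMlo
    exact_mod_cast this
  set I := primesIn y z with hI
  have hImem : ∀ r ∈ I, r.Prime ∧ y < r ∧ (r:ℝ) ≤ z := fun r hr =>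
    (mem_primesIn (by linarith) r).1 hr
  have hmu : (j:ℝ) / 100 ≤ ∑ r ∈ I, (1 / r : ℝ) := recip_pow hy j
  have hL : j * Real.log x / 24000 ≤ (∑ r ∈ I, (1 / r : ℝ)) * Real.log R / 12 := by
    have : (j:ℝ) / 100 * (Real.log x / 20) ≤ (∑ r ∈ I, (1 / r : ℝ)) * Real.log R :=
      mul_le_mul hmu hlogR (by linarith) (le_trans (by positivity) hmu)
    linarith
  set S := (Pset x D).image (fun p => (p - 1) / D) with hS
  have hcard : S.card = (Pset x D).card := by
    rw [hS]
    refine Finset.card_image_of_injOn fun p hp p' hp' h => ?_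
    rw [← mem_Pset_dvd (Finset.mem_coe.1 hp), ← mem_Pset_dvd (Finset.mem_coe.1 hp')]
    have h' : (p - 1) / D = (p' - 1) / D := h
    rw [h']
  have hzq' : ∀ r ∈ I, r ≠ q := by
    rintro r hr rfl
    linarith [(hImem _ hr).2.2]
  have key := sieve_count D q R M I hq (by
      have : (5:ℝ) ≤ q := by linarith
      exact_mod_cast this) (by
      intro p hp hpD
      rw [hDdef] at hpD
      rcases (Nat.Prime.dvd_mul hp).1 hpD with h | h
      · exact Or.inl ((Nat.prime_dvd_prime_iff_eq hp Nat.prime_three).1 (hp.dvd_of_dvd_pow h))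
      · exact Or.inr ((Nat.prime_dvd_prime_iff_eq hp hq).1 h)) hR1 (by
      intro r hr
      obtain ⟨h1, h2, h3⟩ := hImem r hr
      refine ⟨h1, ?_, hzq' r hr, ?_⟩
      · have : (5:ℝ) ≤ r := by linarith
        exact_mod_cast this
      · refine Nat.le_floor ?_
        push_cast
        exact (pow_le_pow_left₀ (Nat.cast_nonneg _) h3 2).trans hzx) hRM
      (by linarith) S (by
      intro m hm
      rw [hS, Finset.mem_image] at hm
      obtain ⟨p, hp, rfl⟩ := hm
      have h1 := mem_Pset_dvd hp
      have h2 := hp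
      rw [Pset, Finset.mem_filter, Finset.mem_range] at h2
      refine ⟨?_, by rw [h1]; exact h2.2.1, ?_, fun r hr => hno p hp r hr⟩
      · rw [hM]
        exact Nat.lt_succ_of_le (Nat.div_le_div_right (by omega))
      · rw [h1]
        have : (R:ℝ) < p := by
          refine lt_of_le_of_lt (hRle.trans hRs) (lt_of_lt_of_le ?_ h2.2.2.2)
          have e1 : Real.exp 10 ≤ Real.sqrt x := by
            refine Real.le_sqrt_of_sq_le ?_
            rw [← Real.exp_nat_mul]; norm_num; exact hx
          have e2 : 1 < Real.exp (-4) * Real.exp 10 := by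
            rw [← Real.exp_add, Real.one_lt_exp_iff]; norm_num
          have e3 : 1 < Real.exp (-4) * Real.sqrt x :=
            lt_of_lt_of_le e2 (mul_le_mul_of_nonneg_left e1 (Real.exp_pos _).le)
          calc Real.sqrt x = 1 * Real.sqrt x := by ring
            _ < Real.exp (-4) * Real.sqrt x * Real.sqrt x := mul_lt_mul_of_pos_right e3 hs0
            _ = Real.exp (-4) * x := by rw [mul_assoc, hsq]
        exact_mod_cast this)
  rw [hcard] at key
  have h1 : ((Pset x D).card : ℝ) * (j * Real.log x / 24000) ≤ 3 * (57 * x / D) :=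
    ((mul_le_mul_of_nonneg_left hL (Nat.cast_nonneg _)).trans key).trans (by linarith)
  have h2 := mul_le_mul_of_nonneg_right h1 hD0'.le
  have h3 : 3 * (57 * x / D) * D = 171 * x := by field_simp; norm_num
  rw [h3] at h2
  linarith

end PPF

namespace PPF
open ArithmeticFunction

theorem finish {a b p A : ℕ} (ha : 0 < a) (hp : p.Prime) (hb : 0 < b) (h4 : 4 * (a * b) ≤ p)
    (hA : A ∣ p - 1) (haA : a ≤ A) (hA3 : A ≤ 3 * a) :
    ∃ A B : ℕ, a ≤ A ∧ b ≤ B ∧ (A * B + 1).Prime ∧ A * B ≤ p := by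
  obtain ⟨B, hB⟩ := hA
  have hp1 := hp.one_lt
  refine ⟨A, B, haA, ?_, ?_, by omega⟩
  · have hab : 0 < a * b := Nat.mul_pos ha hb
    have h1 : 3 * a * b ≤ A * B := by rw [← hB, mul_assoc]; omega
    have h2 : A * b ≤ A * B := (Nat.mul_le_mul_right b hA3).trans h1
    exact Nat.le_of_mul_le_mul_left h2 (by omega)
  · rw [← hB, Nat.sub_add_cancel hp1.le]; exact hp

theorem polylog (n : ℕ) (C r : ℝ) (hC : 0 < C) (hr : 0 < r) :
    ∀ᶠ x : ℝ in Filter.atTop, C * Real.log x ^ n ≤ x ^ r := by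
  have h := (isLittleO_log_rpow_rpow_atTop (n:ℝ) hr).bound (c := 1 / C) (by positivity)
  filter_upwards [h, Filter.eventually_ge_atTop 1] with x hx hx1
  have hl := Real.log_nonneg hx1
  rw [Real.norm_of_nonneg (by positivity), Real.norm_of_nonneg (by positivity),
    Real.rpow_natCast] at hx
  calc C * Real.log x ^ n ≤ C * (1 / C * x ^ r) := mul_le_mul_of_nonneg_left hx hC.le
    _ = _ := by field_simp

theorem Pset_four {a b D p : ℕ} {x : ℝ} (hx : x = 4 * Real.exp 4 * (a * b)) (hp : p ∈ Pset x D) :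
    4 * (a * b) ≤ p := by
  rw [Pset, Finset.mem_filter] at hp
  have h := hp.2.2.2
  have he : Real.exp (-4) * Real.exp 4 = 1 := by rw [← Real.exp_add]; simp
  have h2 : Real.exp (-4) * x = 4 * (a * b) := by
    rw [hx]; linear_combination (4 * (a:ℝ) * b) * he
  rw [h2] at h
  exact_mod_cast h

/-- the conclusion for a given pair -/
def Concl (a b : ℕ) (x : ℝ) : Prop :=
  ∃ A B : ℕ, a ≤ A ∧ b ≤ B ∧ (A * B + 1).Prime ∧ ((A * B : ℕ) : ℝ) ≤ Real.exp 4 * x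

theorem concl_of {a b D p A : ℕ} {x : ℝ} (ha : 0 < a) (hb : 0 < b)
    (hx : x = 4 * Real.exp 4 * (a * b)) (hp : p ∈ Pset x D)
    (hA : A ∣ p - 1) (haA : a ≤ A) (hA3 : A ≤ 3 * a) : Concl a b x := by
  have h4 := Pset_four hx hp
  rw [Pset, Finset.mem_filter] at hp
  obtain ⟨A, B, h1, h2, h3, h5⟩ := finish ha hp.2.1 hb h4 hA haA hA3
  refine ⟨A, B, h1, h2, h3, le_trans (by exact_mod_cast h5) (range_Nx_le ?_ hp.1)⟩
  rw [hx]; positivity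

theorem caseS {φ : ℝ → ℝ} {g : ℝ → ℂ} (hbp : IsBump φ g) (B : ℕ) :
    ∀ᶠ x : ℝ in Filter.atTop, ∀ a b : ℕ, 0 < a → 0 < b → x = 4 * Real.exp 4 * (a * b) →
      (a:ℝ) ≤ Real.log x ^ B → Concl a b x := by
  obtain ⟨c, hc, h⟩ := sw hbp
  obtain ⟨x0, h0⟩ := h (B + 1)
  filter_upwards [Filter.eventually_ge_atTop x0, Filter.eventually_ge_atTop (Real.exp 20),
    polylog (B + 2) (60 / c) (1/2) (by positivity) (by norm_num)] with x h1 h2 h3 a b ha hb hx haB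
  have hx1 : 1 ≤ x := (Real.one_le_exp (by norm_num)).trans h2
  have hx0 : 0 < x := by linarith
  have hl20 : 20 ≤ Real.log x := by rw [Real.le_log_iff_exp_le hx0]; exact h2
  set l := Real.log x with hl
  set k := Nat.log 3 a + 1 with hk
  have hk1 : a ≤ 3 ^ k := (Nat.lt_pow_succ_log_self (by norm_num) a).le
  have hk2 : 3 ^ k ≤ 3 * a := by
    rw [hk, pow_succ, mul_comm]
    exact Nat.mul_le_mul_left 3 (Nat.pow_log_le_self 3 (by omega))
  have hk3 : (3:ℝ) ^ k ≤ 3 * a := by exact_mod_cast hk2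
  have hk4 : (3:ℝ) ^ k ≤ l ^ (B + 1) := by
    have e1 : l ^ (B + 1) = l ^ B * l := pow_succ l B
    have : 0 < l ^ B := by positivity
    rw [e1]
    nlinarith
  have h4 := h0 x h1 k (by omega) hk4
  have h5 := primes_card hbp h2 (3 ^ k) _ h4
  have h6 : 0 < c * x / 3 ^ k - 30 * Real.sqrt x * l := by
    rw [sub_pos, lt_div_iff₀ (by positivity)]
    rw [← Real.sqrt_eq_rpow] at h3
    have hs0 : 0 < Real.sqrt x := Real.sqrt_pos.2 hx0
    have hsq : Real.sqrt x * Real.sqrt x = x := Real.mul_self_sqrt hx0.le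
    have e1 : 60 * l ^ (B + 2) ≤ c * Real.sqrt x := by
      have := mul_le_mul_of_nonneg_left h3 hc.le
      have e : c * (60 / c * l ^ (B + 2)) = 60 * l ^ (B + 2) := by field_simp
      linarith
    have hlp : 0 < l ^ (B + 2) := by positivity
    calc 30 * Real.sqrt x * l * 3 ^ k ≤ 30 * Real.sqrt x * l * l ^ (B + 1) := by gcongr
      _ = Real.sqrt x * (30 * l ^ (B + 2)) := by ring
      _ < Real.sqrt x * (60 * l ^ (B + 2)) := mul_lt_mul_of_pos_left (by linarith) hs0
      _ ≤ Real.sqrt x * (c * Real.sqrt x) := mul_le_mul_of_nonneg_left e1 hs0.le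
      _ = c * x := by linear_combination c * hsq
  have h7 : (Pset x (3 ^ k)).Nonempty := by
    rw [Finset.nonempty_iff_ne_empty]
    intro he
    rw [he] at h5
    simp at h5
    linarith
  obtain ⟨p, hp⟩ := h7
  refine concl_of ha hb hx hp (A := 3 ^ k) ?_ hk1 hk2
  have := mem_Pset_dvd hp
  exact ⟨(p - 1) / 3 ^ k, by omega⟩

theorem sqrt_lt_exp {x : ℝ} (hx : Real.exp 20 ≤ x) : Real.sqrt x < Real.exp (-4) * x := by
  have hx0 : 0 < x := lt_of_lt_of_le (Real.exp_pos _) hx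
  have hs0 : 0 < Real.sqrt x := Real.sqrt_pos.2 hx0
  have hsq : Real.sqrt x * Real.sqrt x = x := Real.mul_self_sqrt hx0.le
  have e1 : Real.exp 10 ≤ Real.sqrt x := by
    refine Real.le_sqrt_of_sq_le ?_
    rw [← Real.exp_nat_mul]; norm_num; exact hx
  have e2 : 1 < Real.exp (-4) * Real.exp 10 := by
    rw [← Real.exp_add, Real.one_lt_exp_iff]; norm_num
  have e3 : 1 < Real.exp (-4) * Real.sqrt x :=
    lt_of_lt_of_le e2 (mul_le_mul_of_nonneg_left e1 (Real.exp_pos _).le)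
  calc Real.sqrt x = 1 * Real.sqrt x := by ring
    _ < Real.exp (-4) * Real.sqrt x * Real.sqrt x := mul_lt_mul_of_pos_right e3 hs0
    _ = Real.exp (-4) * x := by rw [mul_assoc, hsq]

theorem exists_mid {a s k : ℕ} (h1 : s ≤ a) (h2 : a ≤ s * 3 ^ k) :
    ∃ i, i ≤ k ∧ a ≤ s * 3 ^ i ∧ s * 3 ^ i ≤ 3 * a := by
  induction k with
  | zero => exact ⟨0, le_rfl, h2, by simp; omega⟩
  | succ k ih =>
    by_cases h : a ≤ s * 3 ^ k
    · obtain ⟨i, e1, e2, e3⟩ := ih h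
      exact ⟨i, by omega, e2, e3⟩
    · refine ⟨k + 1, le_rfl, h2, ?_⟩
      rw [pow_succ]
      have : s * (3 ^ k * 3) = 3 * (s * 3 ^ k) := by ring
      omega

/-- The error from the average over `q`. -/
theorem Y_bound {K c x l y z Q D : ℝ} (hK : 0 < K) (hx : 1 ≤ x) (hl : 1 ≤ l)
    (hy : y = l ^ 7) (hz : 1 ≤ z) (hzx : z ≤ x ^ (1/8:ℝ)) (hQ : z ≤ Q)
    (hD1 : D * l ^ 7 ≤ 24 * Real.sqrt x) (hD2 : D * y ≤ 192 * (Q * z))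
    (hlK : 2304 * K ≤ c * l ^ 2) :
    K * l ^ 5 * (Real.sqrt x + x / x ^ (1/8:ℝ) / Q + x / Q ^ 2) * D ≤ c / 4 * x := by
  have hx0 : 0 < x := by linarith
  have hQ0 : 0 < Q := by linarith
  have hl0 : 0 < l := by linarith
  have hsq : Real.sqrt x * Real.sqrt x = x := Real.mul_self_sqrt hx0.le
  have hs0 := Real.sqrt_nonneg x
  set X8 := x ^ (1/8:ℝ) with hX8
  have hX80 : 0 < X8 := by positivity
  subst hy
  -- multiply by l ^ 2
  have hl2 : 0 < l ^ 2 := by positivity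
  have t1 : K * (D * l ^ 7 * Real.sqrt x) ≤ K * (192 * x) := by
    refine mul_le_mul_of_nonneg_left ?_ hK.le
    have := mul_le_mul_of_nonneg_right hD1 hs0
    nlinarith
  have t2 : K * (D * l ^ 7 * (x / X8 / Q)) ≤ K * (192 * x) := by
    refine mul_le_mul_of_nonneg_left ?_ hK.le
    calc D * l ^ 7 * (x / X8 / Q) ≤ 192 * (Q * z) * (x / X8 / Q) :=
          mul_le_mul_of_nonneg_right hD2 (by positivity)
      _ = 192 * x * (z / X8) := by field_simp
      _ ≤ 192 * x * 1 := by
          refine mul_le_mul_of_nonneg_left ?_ (by positivity)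
          rw [div_le_one hX80]; exact hzx
      _ = _ := by ring
  have t3 : K * (D * l ^ 7 * (x / Q ^ 2)) ≤ K * (192 * x) := by
    refine mul_le_mul_of_nonneg_left ?_ hK.le
    calc D * l ^ 7 * (x / Q ^ 2) ≤ 192 * (Q * z) * (x / Q ^ 2) :=
          mul_le_mul_of_nonneg_right hD2 (by positivity)
      _ = 192 * x * (z / Q) := by field_simp
      _ ≤ 192 * x * 1 := by
          refine mul_le_mul_of_nonneg_left ?_ (by positivity)
          rw [div_le_one hQ0]; exact hQ
      _ = _ := by ring
  have t4 : 2304 * K * x ≤ c * l ^ 2 * x := mul_le_mul_of_nonneg_right hlK hx0.le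
  refine le_of_mul_le_mul_right ?_ hl2
  calc K * l ^ 5 * (Real.sqrt x + x / X8 / Q + x / Q ^ 2) * D * l ^ 2
      = K * (D * l ^ 7 * Real.sqrt x) + K * (D * l ^ 7 * (x / X8 / Q))
        + K * (D * l ^ 7 * (x / Q ^ 2)) := by ring
    _ ≤ 576 * K * x := by linarith
    _ ≤ c / 4 * x * l ^ 2 := by linarith

end PPF

namespace PPF
open ArithmeticFunction

set_option maxHeartbeats 1600000 in
theorem caseT {φ : ℝ → ℝ} {g : ℝ → ℂ} (hbp : IsBump φ g) : ∃ B : ℕ,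
    ∀ᶠ x : ℝ in Filter.atTop, ∀ a b : ℕ, 0 < a → a ≤ b → x = 4 * Real.exp 4 * (a * b) →
      Real.log x ^ B ≤ a → Concl a b x := by
  obtain ⟨c, hc, hsw⟩ := sw hbp
  obtain ⟨K, hK, hgq⟩ := good_q hbp
  obtain ⟨j, hj⟩ := exists_nat_gt ((171 * 24000 * 8 + 24000) / c + 24000)
  have hj1 : (24000:ℝ) < j := lt_of_le_of_lt (le_add_of_nonneg_left (by positivity)) hj
  have hj2 : 171 * 24000 * 8 < j * c := by
    have h1 : (171 * 24000 * 8 + 24000) / c < j := by linarith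
    rw [div_lt_iff₀ hc] at h1
    linarith
  set P := 2 ^ j with hP
  have hP1 : 1 ≤ P := Nat.one_le_two_pow
  refine ⟨14 * P + 1, ?_⟩
  obtain ⟨x0, h0⟩ := hsw (7 * P)
  filter_upwards [Filter.eventually_ge_atTop x0, Filter.eventually_ge_atTop (Real.exp 20),
    polylog (14 * P) 1 (1/10) (by positivity) (by norm_num),
    Real.tendsto_log_atTop.eventually_ge_atTop (50 ^ 4),
    Real.tendsto_log_atTop.eventually_ge_atTop (2304 * K / c),
    Real.tendsto_log_atTop.eventually_ge_atTop (2880 / c)]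
    with x hx1 hx2 hz2 hl50 hlK hlc a b ha hab hx haB
  have hone : 1 ≤ x := (Real.one_le_exp (by norm_num)).trans hx2
  have hx0 : 0 < x := by linarith
  set l := Real.log x with hl
  have hl1000 : 1000 ≤ l := le_trans (by norm_num) hl50
  have hl0 : 0 < l := by linarith
  have hl1 : 1 ≤ l := by linarith
  have hbpos : 0 < b := by omega
  have hsq : Real.sqrt x * Real.sqrt x = x := Real.mul_self_sqrt hx0.le
  have hs0 : 0 < Real.sqrt x := Real.sqrt_pos.2 hx0
  have ha0 : (0:ℝ) < a := by exact_mod_cast ha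
  have hasq : (a:ℝ) ≤ Real.sqrt x := by
    refine Real.le_sqrt_of_sq_le ?_
    have h1 : (a:ℝ) ≤ b := by exact_mod_cast hab
    have h2 : (a:ℝ) ^ 2 ≤ a * b := by nlinarith
    have h3 : 1 ≤ Real.exp 4 := Real.one_le_exp (by norm_num)
    have h4 : 0 < (a:ℝ) * b := by positivity
    have h5 := mul_le_mul_of_nonneg_right h3 h4.le
    rw [hx]; linarith
  set y := l ^ 7 with hy
  have hly : l ≤ y := le_self_pow₀ hl1 (by norm_num)
  have hy50 : 50 ^ 4 ≤ y := hl50.trans hly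
  have hy0 : 0 < y := by positivity
  set z := y ^ P with hz
  have hzl : z = l ^ (7 * P) := by rw [hz, hy, ← pow_mul]
  have hyz : y ≤ z := le_self_pow₀ (by linarith) (by omega)
  have hz0 : 0 < z := by positivity
  have hz1 : 1 ≤ z := by linarith
  have hzz : z ^ 2 ≤ x ^ (1/10:ℝ) := by
    rw [hzl, ← pow_mul]
    rw [one_mul] at hz2
    convert hz2 using 2; ring
  have hzx : z ≤ x ^ (1/8:ℝ) := by
    have h1 : z ≤ z ^ 2 := le_self_pow₀ hz1 (by norm_num)
    exact (h1.trans hzz).trans (Real.rpow_le_rpow_of_exponent_le hone (by norm_num))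
  have haz : 8 * z ^ 2 ≤ a := by
    refine le_trans ?_ haB
    have e1 : l ^ (14 * P + 1) = z ^ 2 * l := by rw [hzl]; ring
    rw [e1, mul_comm]
    exact mul_le_mul_of_nonneg_left (by linarith) (sq_nonneg z)
  -- the power of three
  obtain ⟨n, hn1, hn2⟩ := exists_nat_pow_near (x := 8 * z / y) (y := (3:ℝ))
    (by rw [le_div_iff₀ hy0]; linarith) (by norm_num)
  set k := n + 1 with hk
  rw [div_lt_iff₀ hy0] at hn2
  rw [le_div_iff₀ hy0] at hn1
  have hk2 : (3:ℝ) ^ k * y ≤ 24 * z := by rw [hk, pow_succ]; linarith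
  have hk0 : (1:ℝ) ≤ 3 ^ k := one_le_pow₀ (by norm_num)
  have hk3 : (3:ℝ) ^ k ≤ l ^ (7 * P) := by
    rw [← hzl]
    have h24 : (24:ℝ) ≤ y := by linarith
    have h1 : (3:ℝ) ^ k * 24 ≤ 3 ^ k * y := mul_le_mul_of_nonneg_left h24 (by linarith)
    linarith
  have hS := h0 x hx1 k (by omega) hk3
  -- the prime q
  set Q := (a:ℝ) / (8 * z) with hQ
  have hQa : 8 * (Q * z) = a := by rw [hQ]; field_simp
  have hQz : z ≤ Q := by rw [hQ, le_div_iff₀ (by positivity)]; linarith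
  have hQ8a : 8 * Q ≤ a := by
    have h1 := mul_le_mul_of_nonneg_left hz1 (show 0 ≤ Q by linarith)
    linarith
  have hsx : Real.sqrt x ≤ x := by
    have h1 : 1 ≤ Real.sqrt x := Real.one_le_sqrt.2 hone
    have h2 := mul_le_mul_of_nonneg_left h1 hs0.le
    linarith
  obtain ⟨q, hq, hq1, hq2, hqY⟩ := hgq x hx2 k Q (by linarith) (by linarith)
  have hq0 : (0:ℝ) < q := by linarith
  have hq5 : 5 < q := by
    have : (5:ℝ) < q := by linarith [(by norm_num : (5:ℝ) < 50 ^ 4)]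
    exact_mod_cast this
  set D : ℝ := 3 ^ k * q with hD
  have hD0 : 0 < D := by positivity
  have hD2 : D * y ≤ 192 * (Q * z) := by
    calc D * y = (3 ^ k * y) * q := by rw [hD]; ring
      _ ≤ (24 * z) * (8 * Q) := mul_le_mul hk2 hq2 hq0.le (by positivity)
      _ = _ := by ring
  have hD1 : D * l ^ 7 ≤ 24 * Real.sqrt x := by
    rw [← hy]; linarith
  have hlK' : 2304 * K ≤ c * l ^ 2 := by
    rw [div_le_iff₀ hc] at hlK
    have h1 : c * l ≤ c * l ^ 2 := mul_le_mul_of_nonneg_left (le_self_pow₀ hl1 (by norm_num)) hc.le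
    linarith
  have hYD := Y_bound hK hone hl1 hy hz1 hzx hQz hD1 hD2 hlK'
  set Y := K * l ^ 5 * (Real.sqrt x + x / x ^ (1/8:ℝ) / Q + x / Q ^ 2) with hY
  have hED : 30 * Real.sqrt x * l * D ≤ c / 4 * x := by
    rw [div_le_iff₀ hc] at hlc
    have e1 : D * l ^ 2 ≤ D * l ^ 7 :=
      mul_le_mul_of_nonneg_left (pow_le_pow_right₀ hl1 (by norm_num)) hD0.le
    have e2 : 30 * Real.sqrt x * (D * l ^ 2) ≤ 30 * Real.sqrt x * (24 * Real.sqrt x) :=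
      mul_le_mul_of_nonneg_left (e1.trans hD1) (by positivity)
    have e3 : 30 * Real.sqrt x * (24 * Real.sqrt x) = 720 * x := by rw [← hsq]; ring_nf; rw [Real.sq_sqrt hx0.le]; rw [Real.sq_sqrt hx0.le]
    have e4 : 2880 * x ≤ l * c * x := mul_le_mul_of_nonneg_right hlc hx0.le
    refine le_of_mul_le_mul_right ?_ hl0
    calc 30 * Real.sqrt x * l * D * l = 30 * Real.sqrt x * (D * l ^ 2) := by ring
      _ ≤ 720 * x := by linarith
      _ ≤ c / 4 * x * l := by linarith
  have hWq : Nat.Coprime (3 ^ k) q :=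
    Nat.Coprime.pow_left _ ((Nat.coprime_primes Nat.prime_three hq).2 (by omega))
  have hqx : (q:ℝ) < Real.exp (-4) * x := lt_of_le_of_lt (by linarith) (sqrt_lt_exp hx2)
  have hlow := lower_D hbp hx2 (3 ^ k) q hq (by omega) hWq hqx _ Y hS hqY
  have hcard := primes_card hbp hx2 (3 ^ k * q) _ hlow
  rw [← hl] at hcard
  set E := 30 * Real.sqrt x * l with hE
  have hE0 : 0 ≤ E := by positivity
  have hmain : c * x / 4 ≤ (Pset x (3 ^ k * q)).card * (2 * l) * D := by
    have hq1' : (0:ℝ) < (q:ℝ) - 1 := by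
      have : (5:ℝ) < q := by exact_mod_cast hq5
      linarith
    have hEk : E * 3 ^ k ≤ c / 4 * x := by
      refine le_trans ?_ hED
      refine mul_le_mul_of_nonneg_left ?_ hE0
      rw [hD]
      exact le_mul_of_one_le_right (by linarith) (by linarith)
    have e1 : (c * x / 3 ^ k - E) * 3 ^ k = c * x - E * 3 ^ k := by field_simp
    have e2 : 0 ≤ c * x / 3 ^ k - E := by
      rw [sub_nonneg, le_div_iff₀ (by positivity)]
      have : 0 < c * x := by positivity
      linarith
    have e3 : (c * x / 3 ^ k - E) / q ≤ (c * x / 3 ^ k - E) / ((q:ℝ) - 1) :=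
      div_le_div_of_nonneg_left e2 hq1' (by linarith)
    have e4 : (c * x / 3 ^ k - E) / q * D = (c * x / 3 ^ k - E) * 3 ^ k := by
      rw [hD]; field_simp
    have e5 : ((c * x / 3 ^ k - E) / q - Y - E) * D ≤ (Pset x (3 ^ k * q)).card * (2 * l) * D :=
      mul_le_mul_of_nonneg_right (by linarith) hD0.le
    rw [sub_mul, sub_mul, e4, e1] at e5
    linarith
  have hex : ∃ p ∈ Pset x (3 ^ k * q), ∃ r ∈ primesIn y z, r ∣ (p - 1) / (3 ^ k * q) := by
    by_contra hcon
    push Not at hcon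
    have hD3 : (3:ℝ) ^ k * q ≤ Real.sqrt x := by
      have h1 : (24:ℝ) ≤ l ^ 7 := by linarith
      rw [← hD]
      have h2 := mul_le_mul_of_nonneg_left h1 hD0.le
      linarith
    have h1 := sieve_use hx2 k q j hq y hy50 (by linarith) hzz hD3
      (by have h2 := mul_le_mul hj1.le hl1 zero_le_one (Nat.cast_nonneg j)
          linarith) hcon
    rw [← hl, ← hD] at h1
    have h2 : j * (c * x / 4) ≤ j * ((Pset x (3 ^ k * q)).card * (2 * l) * D) :=
      mul_le_mul_of_nonneg_left hmain (Nat.cast_nonneg _)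
    have h3 : 171 * 24000 * 8 * x < j * c * x := mul_lt_mul_of_pos_right hj2 hx0
    linarith
  obtain ⟨p, hp, r, hr, hrd⟩ := hex
  obtain ⟨hrp, hr1, hr2⟩ := (mem_primesIn hy0.le r).1 hr
  have hqr1 : q * r ≤ a := by
    have : (q:ℝ) * r ≤ a := by
      calc (q:ℝ) * r ≤ (8 * Q) * z := mul_le_mul hq2 hr2 (Nat.cast_nonneg _) (by linarith)
        _ = a := by linarith
    exact_mod_cast this
  have hqr2 : a ≤ q * r * 3 ^ k := by
    have : (a:ℝ) ≤ q * r * 3 ^ k := by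
      calc (a:ℝ) = Q * (8 * z) := by linarith
        _ ≤ Q * (3 ^ k * y) := mul_le_mul_of_nonneg_left hn2.le (by linarith)
        _ ≤ q * (3 ^ k * r) :=
            mul_le_mul hq1.le (mul_le_mul_of_nonneg_left hr1.le (by positivity)) (by positivity) hq0.le
        _ = _ := by ring
    exact_mod_cast this
  obtain ⟨i, hi, hi1, hi2⟩ := exists_mid hqr1 hqr2
  refine concl_of ha hbpos hx hp ?_ hi1 hi2
  have hpd := mem_Pset_dvd hp
  have hpd' : p - 1 = 3 ^ k * q * ((p - 1) / (3 ^ k * q)) := by omega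
  rw [hpd']
  calc q * r * 3 ^ i = 3 ^ i * q * r := by ring
    _ ∣ _ := Nat.mul_dvd_mul (Nat.mul_dvd_mul (pow_dvd_pow 3 hi) (dvd_refl q)) hrd

theorem main : ∃ C : ℝ, 0 < C ∧
      ∀ a b : ℕ, 0 < a → a ≤ b →
        ∃ A B : ℕ, a ≤ A ∧ b ≤ B ∧ Nat.Prime (A * B + 1) ∧
          ((A * B : ℕ) : ℝ) ≤ C * (a : ℝ) * (b : ℝ) := by
  obtain ⟨φ, g, hbp⟩ := exists_bump
  obtain ⟨B, hT⟩ := caseT hbp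
  obtain ⟨x0, h0⟩ := Filter.eventually_atTop.1 (hT.and (caseS hbp B))
  have hm : ∀ n : ℕ, ∃ m : ℕ, 0 < n → 1 ≤ m ∧ (n * m + 1).Prime := by
    intro n
    rcases Nat.eq_zero_or_pos n with rfl | hn
    · exact ⟨0, fun h => absurd h (by omega)⟩
    · obtain ⟨p, hp, hp1, hp2⟩ := Nat.exists_prime_gt_modEq_one n hn.ne'
      have h2 : n ∣ p - 1 := (Nat.modEq_iff_dvd' hp.one_lt.le).1 hp2.symm
      obtain ⟨m, hm⟩ := h2
      refine ⟨m, fun _ => ⟨?_, ?_⟩⟩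
      · rcases Nat.eq_zero_or_pos m with rfl | h
        · have := hp.one_lt; omega
        · exact h
      · rw [← hm, Nat.sub_add_cancel hp.one_lt.le]; exact hp
  choose m hm using hm
  set N0 := ⌈x0⌉₊ with hN0
  set C0 : ℕ := ∑ n ∈ Finset.range N0, m n with hC0
  refine ⟨4 * Real.exp 4 * Real.exp 4 + C0, by positivity, fun a b ha hab => ?_⟩
  have hb : 0 < b := by omega
  set x : ℝ := 4 * Real.exp 4 * (a * b) with hx
  have habr : (0:ℝ) ≤ (a:ℝ) * b := by positivity
  by_cases hxx : x0 ≤ x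
  · obtain ⟨h1, h2⟩ := h0 x hxx
    have hcon : Concl a b x := by
      rcases le_total (a:ℝ) (Real.log x ^ B) with h | h
      · exact h2 a b ha hb hx h
      · exact h1 a b ha hab hx h
    obtain ⟨A, B', e1, e2, e3, e4⟩ := hcon
    refine ⟨A, B', e1, e2, e3, e4.trans ?_⟩
    rw [hx]
    have : 0 ≤ (C0:ℝ) * (a * b) := by positivity
    linarith
  · push Not at hxx
    have hab0 : 0 < a * b := Nat.mul_pos ha hb
    obtain ⟨h1, h2⟩ := hm (a * b) hab0
    refine ⟨a, b * m (a * b), le_rfl, Nat.le_mul_of_pos_right b h1, by rw [← mul_assoc]; exact h2, ?_⟩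
    have hlt : a * b < N0 := by
      rw [hN0, Nat.lt_ceil]
      have h3 : 1 ≤ Real.exp 4 := Real.one_le_exp (by norm_num)
      refine lt_of_le_of_lt ?_ hxx
      rw [hx]; push_cast; nlinarith
    have h4 : m (a * b) ≤ C0 :=
      Finset.single_le_sum (f := m) (fun _ _ => Nat.zero_le _) (Finset.mem_range.2 hlt)
    have h5 : (m (a * b) : ℝ) ≤ C0 := by exact_mod_cast h4
    have h6 : ((a * (b * m (a * b)) : ℕ) : ℝ) = m (a * b) * (a * b) := by push_cast; ring
    rw [h6]
    have h7 : (m (a * b) : ℝ) * (a * b) ≤ C0 * (a * b) := mul_le_mul_of_nonneg_right h5 habr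
    have h8 : 0 ≤ 4 * Real.exp 4 * Real.exp 4 * ((a:ℝ) * b) := by positivity
    linarith

end PPF

/-- **Lemma C.3.** There is an absolute constant `C > 0` such that for all positive
integers `a ≤ b` there exist `A ≥ a` and `B ≥ b` with `A·B + 1` prime and `A·B ≤ C·a·b`. -/
theorem exists_prime_product_factorization :
    ∃ C : ℝ, 0 < C ∧
      ∀ a b : ℕ, 0 < a → a ≤ b →
        ∃ A B : ℕ, a ≤ A ∧ b ≤ B ∧ Nat.Prime (A * B + 1) ∧
          ((A * B : ℕ) : ℝ) ≤ C * (a : ℝ) * (b : ℝ) :=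
  PPF.main
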